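/- Let n = 4 and let (u, p) be a smooth solution of the steady Navier-Stokes equations on Ω = ℝ⁴₊ \ {0}, where ℝ⁴₊ = {x ∈ ℝ⁴ : x₄ > 0}. Suppose u extends continuously to ∂ℝ⁴₊ \ {0} with the Dirichlet boundary condition u = 0 on {x : x₄ = 0, x ≠ 0}, and there is a constant C > 0 such that |u(x)| ≤ C/|x| for all x ∈ Ω. Then u ≡ 0 on Ω. -/

import Mathlib

namespace SteadyNS

open MeasureTheory Set Metric Filter Topology
open scoped NNReal ENNReal ContDiff

/-- The four-dimensional Euclidean space. -/
abbrev E := EuclideanSpace ℝ (Fin 4)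

/-- The standard basis vectors of `E`. -/
noncomputable abbrev e (i : Fin 4) : E := EuclideanSpace.single i 1

/-- The `i`-th partial derivative. -/
noncomputable def pd (i : Fin 4) (f : E → ℝ) (x : E) : ℝ := fderiv ℝ f x (e i)

section Partial

variable {f g : E → ℝ} {x : E} {i : Fin 4}

lemma pd_add (hf : DifferentiableAt ℝ f x) (hg : DifferentiableAt ℝ g x) :
    pd i (fun y => f y + g y) x = pd i f x + pd i g x := by
  simp [pd, fderiv_fun_add hf hg]

lemma pd_sub (hf : DifferentiableAt ℝ f x) (hg : DifferentiableAt ℝ g x) :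
    pd i (fun y => f y - g y) x = pd i f x - pd i g x := by
  simp [pd, fderiv_fun_sub hf hg]

lemma pd_mul (hf : DifferentiableAt ℝ f x) (hg : DifferentiableAt ℝ g x) :
    pd i (fun y => f y * g y) x = pd i f x * g x + f x * pd i g x := by
  simp [pd, fderiv_fun_mul hf hg]; ring

lemma pd_sum {ι : Type*} {s : Finset ι} {F : ι → E → ℝ}
    (hF : ∀ j ∈ s, DifferentiableAt ℝ (F j) x) :
    pd i (fun y => ∑ j ∈ s, F j y) x = ∑ j ∈ s, pd i (F j) x := by
  simp [pd, fderiv_fun_sum hF]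

lemma pd_congr (h : f =ᶠ[𝓝 x] g) : pd i f x = pd i g x := by
  simp [pd, h.fderiv_eq]

lemma pd_const (c : ℝ) : pd i (fun _ : E => c) x = 0 := by simp [pd]

lemma continuous_pd (hf : ContDiff ℝ 1 f) : Continuous (pd i f) :=
  (hf.continuous_fderiv one_ne_zero).clm_apply continuous_const

lemma contDiff_pd {n : WithTop ℕ∞} (hf : ContDiff ℝ (n + 1) f) : ContDiff ℝ n (pd i f) :=
  (hf.fderiv_right le_rfl).clm_apply contDiff_const

lemma tsupport_pd_subset : tsupport (pd i f) ⊆ tsupport f :=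
  closure_minimal (fun y hy => by
    by_contra h
    exact hy (by simp [pd, fderiv_of_notMem_tsupport (𝕜 := ℝ) h])) (isClosed_tsupport f)

lemma hasCompactSupport_pd (hf : HasCompactSupport f) : HasCompactSupport (pd i f) :=
  hf.mono' (subset_closure.trans tsupport_pd_subset)

lemma pd_eq_zero_of_notMem (h : x ∉ tsupport f) : pd i f x = 0 := by
  simp [pd, fderiv_of_notMem_tsupport (𝕜 := ℝ) h]

lemma abs_coord_le (x : E) (i : Fin 4) : |x i| ≤ ‖x‖ := by
  simpa using PiLp.norm_apply_le x i

lemma abs_pd_le (f : E → ℝ) (x : E) (i : Fin 4) : |pd i f x| ≤ ‖fderiv ℝ f x‖ := by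
  simpa [pd] using (fderiv ℝ f x).le_opNorm (e i)

lemma sum_coord_e (v : E) : v = ∑ i, v i • e i := by
  ext j
  simp [Pi.single_apply]

lemma fderiv_apply_eq_sum (f : E → ℝ) (x v : E) :
    fderiv ℝ f x v = ∑ i, v i * pd i f x := by
  conv_lhs => rw [sum_coord_e v]
  simp [pd]

lemma norm_fderiv_le (f : E → ℝ) (x : E) : ‖fderiv ℝ f x‖ ≤ ∑ i, |pd i f x| := by
  refine ContinuousLinearMap.opNorm_le_bound _ (Finset.sum_nonneg fun i _ => abs_nonneg _)
    fun v => ?_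
  rw [fderiv_apply_eq_sum, Finset.sum_mul]
  refine (Finset.abs_sum_le_sum_abs _ _).trans (Finset.sum_le_sum fun i _ => ?_)
  rw [abs_mul, mul_comm]
  exact mul_le_mul_of_nonneg_left (abs_coord_le v i) (abs_nonneg _)

lemma integrable_mul_of_tsupport_subset {Ω : Set E} (hΩ : IsOpen Ω) (hf : ContinuousOn f Ω)
    (hg : Continuous g) (hgΩ : tsupport g ⊆ Ω) (hgc : HasCompactSupport g) :
    Integrable (fun x => f x * g x) := by
  refine Continuous.integrable_of_hasCompactSupport ?_ hgc.mul_left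
  refine continuous_iff_continuousAt.2 fun x => ?_
  by_cases hx : x ∈ tsupport g
  · exact (hf.continuousAt (hΩ.mem_nhds (hgΩ hx))).mul hg.continuousAt
  · have : (fun x => f x * g x) =ᶠ[𝓝 x] fun _ => 0 := by
      filter_upwards [notMem_tsupport_iff_eventuallyEq.mp hx] with y hy
      simp [hy]
    exact continuousAt_const.congr this.symm

/-- Integration by parts when one factor is only differentiable near the support of the other. -/
lemma integral_mul_pd {Ω : Set E} (hΩ : IsOpen Ω) (hf : ContDiffOn ℝ 1 f Ω)
    (hg : ContDiff ℝ 1 g) (hgc : HasCompactSupport g) (hgΩ : tsupport g ⊆ Ω) :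
    ∫ x, f x * pd i g x = - ∫ x, pd i f x * g x := by
  have hf' : ContinuousOn (pd i f) Ω :=
    (hf.continuousOn_fderiv_of_isOpen hΩ le_rfl).clm_apply continuousOn_const
  exact integral_mul_fderiv_eq_neg_fderiv_mul_of_integrable
    (integrable_mul_of_tsupport_subset hΩ hf' hg.continuous hgΩ hgc)
    (integrable_mul_of_tsupport_subset hΩ hf.continuousOn (continuous_pd hg)
      (tsupport_pd_subset.trans hgΩ)
      (hasCompactSupport_pd hgc))
    (integrable_mul_of_tsupport_subset hΩ hf.continuousOn hg.continuous hgΩ hgc)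
    (fun x hx => (hf.differentiableOn one_ne_zero).differentiableAt (hΩ.mem_nhds (hgΩ hx)))
    (fun x _ => hg.differentiable one_ne_zero x)

end Partial

section ParametricIntegral

set_option linter.unusedSectionVars false

variable {P : Type*} [NormedAddCommGroup P] [NormedSpace ℝ P] [MeasurableSpace P] [BorelSpace P]
  [SecondCountableTopology P] {μ : Measure P} [IsLocallyFiniteMeasure μ] {K : Set P}
  {a : P → ℝ} {q : P → E} {f : E → ℝ} {H : Set E}

lemma eventually_translates_mem (hK : IsCompact K) (hq : Continuous q) (hH : IsOpen H) {x : E}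
    (hx : ∀ p ∈ K, x - q p ∈ H) :
    ∃ δ > 0, ∀ y ∈ closedBall x δ, ∀ p ∈ K, y - q p ∈ H := by
  have hc : IsCompact ((fun p => x - q p) '' K) := hK.image (by fun_prop)
  obtain ⟨δ, hδ, h⟩ := hc.exists_cthickening_subset_open hH (by rintro _ ⟨p, hp, rfl⟩; exact hx p hp)
  refine ⟨δ, hδ, fun y hy p hp => h ?_⟩
  refine mem_cthickening_of_dist_le _ (x - q p) δ _ ⟨p, hp, rfl⟩ ?_
  simpa using hy

lemma hasFDerivAt_integral_translates (hK : IsCompact K) (ha : Continuous a) (hq : Continuous q)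
    (hH : IsOpen H) (hf : ContDiffOn ℝ 1 f H) {x : E} (hx : ∀ p ∈ K, x - q p ∈ H) :
    HasFDerivAt (fun x => ∫ p in K, a p * f (x - q p) ∂μ)
      (∫ p in K, a p • fderiv ℝ f (x - q p) ∂μ) x := by
  obtain ⟨δ, hδ, hδH⟩ := eventually_translates_mem hK hq hH hx
  have hfd := hf.continuousOn_fderiv_of_isOpen hH le_rfl
  have hfc := hf.continuousOn
  have hmap : MapsTo (fun z : E × P => z.1 - q z.2) (closedBall x δ ×ˢ K) H :=
    fun z hz => hδH z.1 hz.1 z.2 hz.2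
  have hc : ContinuousOn (fun z : E × P => a z.2 • fderiv ℝ f (z.1 - q z.2))
      (closedBall x δ ×ˢ K) :=
    ContinuousOn.smul (f := fun z : E × P => a z.2) (Continuous.continuousOn (by fun_prop))
      (hfd.comp (Continuous.continuousOn (by fun_prop)) hmap)
  obtain ⟨M, hM⟩ := ((isCompact_closedBall x δ).prod hK).bddAbove_image hc.norm
  have hM' : ∀ y ∈ closedBall x δ, ∀ p ∈ K, ‖a p • fderiv ℝ f (y - q p)‖ ≤ M :=
    fun y hy p hp => hM ⟨(y, p), ⟨hy, hp⟩, rfl⟩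
  have hμ : μ K ≠ ⊤ := hK.measure_lt_top.ne
  have hcf : ∀ y ∈ closedBall x δ, ContinuousOn (fun p => a p * f (y - q p)) K := fun y hy =>
    ha.continuousOn.mul (hfc.comp (Continuous.continuousOn (by fun_prop)) (hδH y hy))
  have hcd : ContinuousOn (fun p => a p • fderiv ℝ f (x - q p)) K :=
    ha.continuousOn.smul (hfd.comp (Continuous.continuousOn (by fun_prop)) hx)
  have hball : closedBall x δ ∈ 𝓝 x := closedBall_mem_nhds x hδ
  have hdiff : ∀ᵐ p ∂(μ.restrict K), ∀ y ∈ closedBall x δ,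
      HasFDerivAt (fun x => a p * f (x - q p)) (a p • fderiv ℝ f (y - q p)) y := by
    filter_upwards [ae_restrict_mem hK.measurableSet] with p hp y hy
    have h1 : HasFDerivAt f (fderiv ℝ f (y - q p)) (y - q p) :=
      ((hf.differentiableOn one_ne_zero).differentiableAt (hH.mem_nhds (hδH y hy p hp))).hasFDerivAt
    have h2 : HasFDerivAt (fun z => f (z - q p)) (fderiv ℝ f (y - q p)) y := by
      simpa using! h1.comp y ((hasFDerivAt_id y).sub_const (q p))
    exact h2.const_mul (a p)
  have hbound : ∀ᵐ p ∂(μ.restrict K), ∀ y ∈ closedBall x δ,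
      ‖a p • fderiv ℝ f (y - q p)‖ ≤ M := by
    filter_upwards [ae_restrict_mem hK.measurableSet] with p hp y hy using hM' y hy p hp
  exact hasFDerivAt_integral_of_dominated_of_fderiv_le hball
    (by filter_upwards [hball] with y hy using (hcf y hy).aestronglyMeasurable hK.measurableSet)
    ((hcf x (mem_closedBall_self hδ.le)).integrableOn_compact hK)
    (hcd.aestronglyMeasurable hK.measurableSet) hbound (integrableOn_const hμ) hdiff

lemma continuousOn_integral_translates {F : Type*} [NormedAddCommGroup F] [NormedSpace ℝ F]
    {g : E → F} (hK : IsCompact K) (ha : Continuous a)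
    (hq : Continuous q) (hH : IsOpen H) (hg : ContinuousOn g H) :
    ContinuousOn (fun x => ∫ p in K, a p • g (x - q p) ∂μ) {x | ∀ p ∈ K, x - q p ∈ H} := by
  intro x hx
  refine ContinuousAt.continuousWithinAt ?_
  obtain ⟨δ, hδ, hδH⟩ := eventually_translates_mem hK hq hH hx
  have hmap : MapsTo (fun z : E × P => z.1 - q z.2) (closedBall x δ ×ˢ K) H :=
    fun z hz => hδH z.1 hz.1 z.2 hz.2
  have hc : ContinuousOn (fun z : E × P => a z.2 • g (z.1 - q z.2)) (closedBall x δ ×ˢ K) :=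
    ContinuousOn.smul (f := fun z : E × P => a z.2) (Continuous.continuousOn (by fun_prop))
      (hg.comp (Continuous.continuousOn (by fun_prop)) hmap)
  obtain ⟨M, hM⟩ := ((isCompact_closedBall x δ).prod hK).bddAbove_image hc.norm
  have hball : closedBall x δ ∈ 𝓝 x := closedBall_mem_nhds x hδ
  have hcf : ∀ y ∈ closedBall x δ, ContinuousOn (fun p => a p • g (y - q p)) K := fun y hy =>
    ha.continuousOn.smul (hg.comp (Continuous.continuousOn (by fun_prop)) (hδH y hy))
  refine continuousAt_of_dominated (bound := fun _ => M) ?_ ?_ ?_ ?_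
  · filter_upwards [hball] with y hy using (hcf y hy).aestronglyMeasurable_of_isCompact hK
      hK.measurableSet
  · filter_upwards [hball] with y hy
    filter_upwards [ae_restrict_mem hK.measurableSet] with p hp
    exact hM ⟨(y, p), ⟨hy, hp⟩, rfl⟩
  · exact integrableOn_const hK.measure_lt_top.ne
  · filter_upwards [ae_restrict_mem hK.measurableSet] with p hp
    refine continuousAt_const.smul ?_
    have : ContinuousAt g (x - q p) := hg.continuousAt (hH.mem_nhds (hx p hp))
    exact ContinuousAt.comp (f := fun y => y - q p) this (by fun_prop)

lemma isOpen_translates_mem (hK : IsCompact K) (hq : Continuous q) (hH : IsOpen H) :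
    IsOpen {x : E | ∀ p ∈ K, x - q p ∈ H} := by
  rw [isOpen_iff_mem_nhds]
  intro x hx
  obtain ⟨δ, hδ, h⟩ := eventually_translates_mem hK hq hH hx
  filter_upwards [closedBall_mem_nhds x hδ] with y hy using h y hy

lemma contDiffOn_integral_translates (hK : IsCompact K) (ha : Continuous a) (hq : Continuous q)
    (hH : IsOpen H) (hf : ContDiffOn ℝ 1 f H) :
    ContDiffOn ℝ 1 (fun x => ∫ p in K, a p * f (x - q p) ∂μ) {x | ∀ p ∈ K, x - q p ∈ H} := by
  have hO := isOpen_translates_mem hK hq hH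
  have hfd := hf.continuousOn_fderiv_of_isOpen hH le_rfl
  have hd : ∀ x ∈ {x | ∀ p ∈ K, x - q p ∈ H}, HasFDerivAt _ _ x := fun x hx =>
    hasFDerivAt_integral_translates (μ := μ) hK ha hq hH hf hx
  have := (contDiffOn_succ_iff_fderiv_of_isOpen (𝕜 := ℝ) (n := 0)
    (f := fun x => ∫ p in K, a p * f (x - q p) ∂μ) hO).2
    ⟨fun x hx => (hd x hx).differentiableAt.differentiableWithinAt, by simp, ?_⟩
  · simpa using this
  · rw [contDiffOn_zero]
    exact (continuousOn_integral_translates hK ha hq hH hfd).congr fun x hx => (hd x hx).fderiv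

lemma pd_integral_translates (hK : IsCompact K) (ha : Continuous a) (hq : Continuous q)
    (hH : IsOpen H) (hf : ContDiffOn ℝ 1 f H) (i : Fin 4) {x : E} (hx : ∀ p ∈ K, x - q p ∈ H) :
    pd i (fun x => ∫ p in K, a p * f (x - q p) ∂μ) x =
      ∫ p in K, a p * pd i f (x - q p) ∂μ := by
  have hfd := hf.continuousOn_fderiv_of_isOpen hH le_rfl
  rw [pd, (hasFDerivAt_integral_translates hK ha hq hH hf hx).fderiv,
    ContinuousLinearMap.integral_apply]
  · simp [pd]
  · exact (ha.continuousOn.smul (hfd.comp (Continuous.continuousOn (by fun_prop)) hx)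
      ).integrableOn_compact hK

lemma contDiff_integral_translates (hK : IsCompact K) (ha : Continuous a) (hq : Continuous q)
    (hf : ContDiff ℝ 1 f) : ContDiff ℝ 1 (fun x => ∫ p in K, a p * f (x - q p) ∂μ) := by
  have := contDiffOn_integral_translates (μ := μ) hK ha hq isOpen_univ hf.contDiffOn
  simpa [contDiffOn_univ] using this

end ParametricIntegral

section Potential

/-- A bump function supported in a cone of directions pointing upwards. -/
noncomputable def upBump : ContDiffBump (e 3) := ⟨1 / 4, 1 / 2, by norm_num, by norm_num⟩

/-- A smooth probability density on upward pointing directions. -/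
noncomputable def rho : E → ℝ := upBump.normed volume

/-- The set of directions over which the potential operator averages. -/
noncomputable def dirs : Set E := closedBall (e 3) (1 / 2)

/-- Averaged ray integrals; `∑ j, T S j (∂ⱼ f) = f` for functions vanishing below the boundary. -/
noncomputable def T (S : ℝ) (j : Fin 4) (f : E → ℝ) (x : E) : ℝ :=
  ∫ p in Icc 0 S ×ˢ dirs, rho p.2 * p.2 j * f (x - p.1 • p.2)

lemma isCompact_dirs : IsCompact dirs := isCompact_closedBall _ _

lemma measurableSet_dirs : MeasurableSet dirs := isCompact_dirs.measurableSet

lemma contDiff_rho : ContDiff ℝ 1 rho := upBump.contDiff_normed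

lemma continuous_rho : Continuous rho := contDiff_rho.continuous

lemma tsupport_rho : tsupport rho = dirs := upBump.tsupport_normed_eq

lemma integral_rho : ∫ d in dirs, rho d = 1 := by
  rw [setIntegral_eq_integral_of_forall_compl_eq_zero, rho, upBump.integral_normed]
  intro x hx
  rw [← tsupport_rho] at hx
  exact image_eq_zero_of_notMem_tsupport hx

lemma dirs_coord {d : E} (hd : d ∈ dirs) : 1 / 2 ≤ d 3 := by
  have h := (abs_coord_le (d - e 3) 3).trans (by simpa [dirs, dist_eq_norm] using hd)
  have := (abs_le.1 h).1
  simp at this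
  linarith

lemma dirs_norm {d : E} (hd : d ∈ dirs) : ‖d‖ ≤ 3 / 2 := by
  have h : ‖d - e 3‖ ≤ 1 / 2 := by simpa [dirs, dist_eq_norm] using hd
  have h2 : ‖e 3‖ = 1 := by simp
  have := norm_add_le (d - e 3) (e 3)
  simp only [sub_add_cancel] at this
  linarith

lemma isCompact_ray (S : ℝ) : IsCompact (Icc 0 S ×ˢ dirs) := isCompact_Icc.prod isCompact_dirs

lemma continuous_weight (j : Fin 4) : Continuous fun p : ℝ × E => rho p.2 * p.2 j := by
  have := continuous_rho
  fun_prop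

variable {S : ℝ} {f : E → ℝ} {x : E}

lemma contDiff_T (S : ℝ) (j : Fin 4) (hf : ContDiff ℝ 1 f) : ContDiff ℝ 1 (T S j f) :=
  contDiff_integral_translates (isCompact_ray S) (continuous_weight j) (by fun_prop) hf

lemma pd_T (S : ℝ) (j l : Fin 4) (hf : ContDiff ℝ 1 f) (x : E) :
    pd l (T S j f) x = T S j (pd l f) x :=
  pd_integral_translates (isCompact_ray S) (continuous_weight j) (by fun_prop) isOpen_univ
    hf.contDiffOn l (fun _ _ => mem_univ _)

lemma ray_coord {s : ℝ} {d : E} (hd : d ∈ dirs) (hs : 2 * x 3 ≤ s) (hs0 : 0 ≤ s) :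
    (x - s • d) 3 ≤ 0 := by
  have := dirs_coord hd
  simp
  nlinarith

lemma T_eq_zero (j : Fin 4) (hf : ∀ x : E, x 3 ≤ 0 → f x = 0) (hx : x 3 ≤ 0) :
    T S j f x = 0 := by
  refine setIntegral_eq_zero_of_forall_eq_zero fun p hp => ?_
  rw [hf _ (ray_coord hp.2 (by linarith [hp.1.1]) hp.1.1), mul_zero]

lemma sum_T_pd (hf : ContDiff ℝ 1 f) (h0 : ∀ x : E, x 3 ≤ 0 → f x = 0) (hS : 0 ≤ S)
    (hx : 2 * x 3 ≤ S) : ∑ j, T S j (pd j f) x = f x := by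
  have hfd := hf.continuous_fderiv one_ne_zero
  have hrho := continuous_rho
  have hc : Continuous fun p : ℝ × E => rho p.2 * fderiv ℝ f (x - p.1 • p.2) p.2 := by
    refine (hrho.comp continuous_snd).mul (Continuous.clm_apply ?_ continuous_snd)
    exact hfd.comp (by fun_prop)
  have h1 : ∑ j, T S j (pd j f) x =
      ∫ p in Icc 0 S ×ˢ dirs, rho p.2 * fderiv ℝ f (x - p.1 • p.2) p.2 := by
    unfold T
    rw [← integral_finsetSum]
    · congr 1
      ext p
      rw [fderiv_apply_eq_sum, Finset.mul_sum]
      simp only [mul_assoc]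
    · intro j _
      have := continuous_pd (i := j) hf
      exact (Continuous.continuousOn (by fun_prop)).integrableOn_compact (isCompact_ray S)
  rw [h1, Measure.volume_eq_prod, ← Measure.prod_restrict, integral_prod_symm]
  · have h2 : ∀ d ∈ dirs, ∫ s in Icc 0 S, rho d * fderiv ℝ f (x - s • d) d = rho d * f x := by
      intro d hd
      rw [integral_const_mul, integral_Icc_eq_integral_Ioc, ← intervalIntegral.integral_of_le hS]
      rw [intervalIntegral.integral_eq_sub_of_hasDerivAt (f := fun s => - f (x - s • d))]
      · rw [h0 _ (ray_coord hd hx hS)]; simp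
      · intro s _
        have h3 : HasDerivAt (fun s : ℝ => x - s • d) (-d) s := by
          simpa using ((hasDerivAt_id s).smul_const d).const_sub x
        have := ((hf.differentiable one_ne_zero (x - s • d)).hasFDerivAt.comp_hasDerivAt s h3).neg
        simpa using! this
      · exact Continuous.intervalIntegrable ((hfd.comp (by fun_prop)).clm_apply continuous_const) _ _
    rw [setIntegral_congr_fun measurableSet_dirs h2, integral_mul_const, integral_rho, one_mul]
  · rw [Measure.prod_restrict]
    exact hc.continuousOn.integrableOn_compact (isCompact_ray S)

end Potential

section Estimates

lemma lintegral_translates {P : Type*} [MeasurableSpace P] {μ : Measure P} [SFinite μ]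
    {q : P → E} (hq : Measurable q) {H : E → P → ENNReal} (hH : Measurable (Function.uncurry H)) :
    ∫⁻ x, ∫⁻ p, H (x - q p) p ∂μ = ∫⁻ z, ∫⁻ p, H z p ∂μ := by
  rw [lintegral_lintegral_swap, lintegral_lintegral_swap hH.aemeasurable]
  · refine lintegral_congr fun p => ?_
    exact lintegral_sub_right_eq_self (fun x => H x p) (q p)
  · have : Measurable fun z : E × P => (z.1 - q z.2, z.2) := by fun_prop
    exact (hH.comp this).aemeasurable

lemma lintegral_sq_le {P : Type*} [MeasurableSpace P] {μ : Measure P} {h : P → ENNReal}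
    (hh : AEMeasurable h μ) : (∫⁻ p, h p ∂μ) ^ 2 ≤ μ univ * ∫⁻ p, h p ^ 2 ∂μ := by
  have := ENNReal.lintegral_mul_le_Lp_mul_Lq μ (p := 2) (q := 2)
    (Real.HolderConjugate.two_two) (aemeasurable_const (b := (1 : ENNReal))) hh
  simp only [Pi.mul_apply, one_mul, ENNReal.one_rpow, lintegral_const] at this
  calc (∫⁻ p, h p ∂μ) ^ 2 ≤ ((μ univ) ^ ((1 : ℝ) / 2) *
        (∫⁻ p, h p ^ (2 : ℝ) ∂μ) ^ ((1 : ℝ) / 2)) ^ 2 := by gcongr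
    _ = _ := by
      rw [mul_pow, ← ENNReal.rpow_natCast, ← ENNReal.rpow_mul, ← ENNReal.rpow_natCast,
        ← ENNReal.rpow_mul]
      norm_num

end Estimates

section PotentialBounds

lemma contDiff_rho_mul (j : Fin 4) : ContDiff ℝ 1 fun d : E => rho d * d j := by
  have := contDiff_rho
  fun_prop

lemma tsupport_rho_mul (j : Fin 4) : tsupport (fun d : E => rho d * d j) ⊆ dirs := by
  rw [← tsupport_rho]; exact tsupport_mul_subset_left

lemma hasCompactSupport_rho_mul (j : Fin 4) : HasCompactSupport fun d : E => rho d * d j :=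
  isCompact_dirs.of_isClosed_subset (isClosed_tsupport _) (tsupport_rho_mul j)

lemma exists_weight_bound : ∃ M : ℝ≥0, ∀ (j l : Fin 4) (d : E),
    ‖rho d * d j‖ₑ ≤ M ∧ ‖pd l (fun d : E => rho d * d j) d‖ₑ ≤ M := by
  have h1 : ∀ j : Fin 4, ∃ A, ∀ d : E, ‖rho d * d j‖ ≤ A := fun j =>
    (hasCompactSupport_rho_mul j).exists_bound_of_continuous (contDiff_rho_mul j).continuous
  have h2 : ∀ j l : Fin 4, ∃ A, ∀ d : E, ‖pd l (fun d : E => rho d * d j) d‖ ≤ A := fun j l =>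
    (hasCompactSupport_pd (hasCompactSupport_rho_mul j)).exists_bound_of_continuous
      (continuous_pd (contDiff_rho_mul j))
  choose A hA using h1
  choose B hB using h2
  refine ⟨(∑ j, |A j| + ∑ j, ∑ l, |B j l|).toNNReal, fun j l d => ⟨?_, ?_⟩⟩
  · rw [← ofReal_norm, ← ENNReal.ofReal]
    refine ENNReal.ofReal_le_ofReal ((hA j d).trans ((le_abs_self _).trans ?_))
    have := Finset.single_le_sum (f := fun j => |A j|) (fun _ _ => abs_nonneg _) (Finset.mem_univ j)
    have h0 : 0 ≤ ∑ j, ∑ l, |B j l| := by positivity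
    linarith
  · rw [← ofReal_norm, ← ENNReal.ofReal]
    refine ENNReal.ofReal_le_ofReal ((hB j l d).trans ((le_abs_self _).trans ?_))
    have h3 := Finset.single_le_sum (f := fun l => |B j l|) (fun _ _ => abs_nonneg _)
      (Finset.mem_univ l)
    have h4 := Finset.single_le_sum (f := fun j => ∑ l, |B j l|)
      (fun _ _ => Finset.sum_nonneg fun _ _ => abs_nonneg _) (Finset.mem_univ j)
    have h0 : 0 ≤ ∑ j, |A j| := by positivity
    linarith

/-- A common bound for the weights of the potential operator and their derivatives. -/
noncomputable def wt : ℝ≥0 := exists_weight_bound.choose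

lemma weight_le (j : Fin 4) (d : E) : ‖rho d * d j‖ₑ ≤ wt :=
  (exists_weight_bound.choose_spec j 0 d).1

lemma pd_weight_le (j l : Fin 4) (d : E) : ‖pd l (fun d : E => rho d * d j) d‖ₑ ≤ wt :=
  (exists_weight_bound.choose_spec j l d).2

variable {S : ℝ} {f : E → ℝ} {x : E}

lemma measurable_enorm_ray (hf : Continuous f) (x : E) :
    Measurable fun p : ℝ × E => ‖f (x - p.1 • p.2)‖ₑ := by
  have : Continuous fun p : ℝ × E => f (x - p.1 • p.2) := by fun_prop
  exact this.measurable.enorm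

lemma enorm_T_le (S : ℝ) (j : Fin 4) (f : E → ℝ) (hf : Continuous f) (x : E) :
    ‖T S j f x‖ₑ ≤ wt * ∫⁻ p in Icc 0 S ×ˢ dirs, ‖f (x - p.1 • p.2)‖ₑ := by
  rw [← lintegral_const_mul _ (measurable_enorm_ray hf x)]
  refine (enorm_integral_le_lintegral_enorm _).trans (lintegral_mono fun p => ?_)
  simp only [enorm_mul]
  gcongr
  simpa [enorm_mul] using weight_le j p.2

lemma pd_ray (hf : ContDiff ℝ 1 f) (l : Fin 4) (s : ℝ) (x d : E) :
    pd l (fun d => f (x - s • d)) d = -s * pd l f (x - s • d) := by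
  have h1 : HasFDerivAt f (fderiv ℝ f (x - s • d)) (x - s • d) :=
    (hf.differentiable one_ne_zero _).hasFDerivAt
  have h2 : HasFDerivAt (fun d => x - s • d) (-(s • ContinuousLinearMap.id ℝ E)) d :=
    ((hasFDerivAt_id d).const_smul s).const_sub x
  have h3 := (h1.comp d h2).fderiv
  simp only [pd, Function.comp_def] at h3 ⊢
  rw [h3]
  simp

lemma integral_dirs_pd (hf : ContDiff ℝ 1 f) (j l : Fin 4) {s : ℝ} (hs : 0 < s) (x : E) :
    ∫ d in dirs, rho d * d j * pd l f (x - s • d) =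
      s⁻¹ * ∫ d in dirs, pd l (fun d : E => rho d * d j) d * f (x - s • d) := by
  have hf' : ContDiff ℝ 1 fun d => f (x - s • d) := hf.comp (by fun_prop)
  have := integral_mul_pd (i := l) isOpen_univ hf'.contDiffOn (contDiff_rho_mul j)
    (hasCompactSupport_rho_mul j) (subset_univ _)
  simp only [pd_ray hf] at this
  rw [setIntegral_eq_integral_of_forall_compl_eq_zero,
    setIntegral_eq_integral_of_forall_compl_eq_zero]
  · have h2 : ∀ d : E, pd l (fun d : E => rho d * d j) d * f (x - s • d) =
      f (x - s • d) * pd l (fun d : E => rho d * d j) d := fun d => mul_comm _ _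
    simp only [h2, this]
    rw [← integral_neg, ← integral_const_mul]
    congr 1
    ext d
    field_simp
  · intro d hd
    rw [pd_eq_zero_of_notMem fun h => hd (tsupport_rho_mul j h), zero_mul]
  · intro d hd
    rw [image_eq_zero_of_notMem_tsupport (f := fun d : E => rho d * d j)
      fun h => hd (tsupport_rho_mul j h), zero_mul]

lemma enorm_pd_T_le (S : ℝ) (j l : Fin 4) (hf : ContDiff ℝ 1 f) {σ : ℝ} (hσ : 0 < σ) (x : E) :
    ‖pd l (T S j f) x‖ₑ ≤
      wt * (∫⁻ p in Ico 0 σ ×ˢ dirs, ‖pd l f (x - p.1 • p.2)‖ₑ) +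
      wt * ENNReal.ofReal σ⁻¹ * ∫⁻ p in Icc 0 S ×ˢ dirs, ‖f (x - p.1 • p.2)‖ₑ := by
  have hg := continuous_pd (i := l) hf
  have hrho := continuous_rho
  have hc : Continuous fun p : ℝ × E => rho p.2 * p.2 j * pd l f (x - p.1 • p.2) := by fun_prop
  have hint : IntegrableOn (fun p : ℝ × E => rho p.2 * p.2 j * pd l f (x - p.1 • p.2))
    (Icc 0 S ×ˢ dirs) := hc.continuousOn.integrableOn_compact (isCompact_ray S)
  have hsplit : Icc 0 S ×ˢ dirs = (Icc 0 S ∩ Iio σ) ×ˢ dirs ∪ (Icc 0 S ∩ Ici σ) ×ˢ dirs := by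
    rw [← union_prod, ← inter_union_distrib_left, Iio_union_Ici, inter_univ]
  have hdisj : Disjoint ((Icc 0 S ∩ Iio σ) ×ˢ dirs) ((Icc 0 S ∩ Ici σ) ×ˢ dirs) := by
    rw [Set.disjoint_left]
    rintro p ⟨⟨_, h1⟩, _⟩ ⟨⟨_, h2⟩, _⟩
    exact (not_lt.2 (mem_Ici.1 h2)) (mem_Iio.1 h1)
  have hm1 : MeasurableSet (Icc 0 S ∩ Ici σ) := measurableSet_Icc.inter measurableSet_Ici
  have hsub : (Icc 0 S ∩ Ici σ) ×ˢ dirs ⊆ Icc 0 S ×ˢ dirs :=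
    Set.prod_mono inter_subset_left le_rfl
  rw [pd_T S j l hf, T, hsplit, setIntegral_union hdisj (hm1.prod measurableSet_dirs)
    (hint.mono_set (hsplit ▸ subset_union_left)) (hint.mono_set hsub), ← hsplit]
  refine (enorm_add_le _ _).trans (add_le_add ?_ ?_)
  · rw [← lintegral_const_mul _ (measurable_enorm_ray hg x)]
    refine (enorm_integral_le_lintegral_enorm _).trans ?_
    refine (lintegral_mono_set (Set.prod_mono ?_ le_rfl)).trans (lintegral_mono fun p => ?_)
    · exact fun s hs => ⟨hs.1.1, hs.2⟩
    · simp only [enorm_mul]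
      gcongr
      simpa [enorm_mul] using weight_le j p.2
  · have hdc := continuous_pd (i := l) (contDiff_rho_mul j)
    rw [Measure.volume_eq_prod, setIntegral_prod _ (hint.mono_set hsub)]
    refine (enorm_integral_le_lintegral_enorm _).trans ?_
    have h1 : ∀ s ∈ Icc 0 S ∩ Ici σ, ‖∫ d in dirs, rho d * d j * pd l f (x - s • d)‖ₑ ≤
        wt * ENNReal.ofReal σ⁻¹ * ∫⁻ d in dirs, ‖f (x - s • d)‖ₑ := by
      intro s hs
      have hs0 : 0 < s := hσ.trans_le hs.2
      rw [integral_dirs_pd hf j l hs0, enorm_mul, mul_comm (wt : ENNReal), mul_assoc]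
      gcongr
      · rw [Real.enorm_of_nonneg (by positivity)]
        exact ENNReal.ofReal_le_ofReal (inv_anti₀ hσ hs.2)
      · rw [← lintegral_const_mul]
        · refine (enorm_integral_le_lintegral_enorm _).trans (lintegral_mono fun d => ?_)
          simp only [enorm_mul]
          gcongr
          exact pd_weight_le j l d
        · have : Continuous fun d => f (x - s • d) := hf.continuous.comp (by fun_prop)
          exact this.measurable.enorm
    refine (setLIntegral_mono' hm1 h1).trans ?_
    rw [← Measure.prod_restrict, lintegral_prod _ (measurable_enorm_ray hf.continuous x).aemeasurable,
      ← lintegral_const_mul]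
    · exact lintegral_mono_set inter_subset_left
    · exact (measurable_enorm_ray hf.continuous x).lintegral_prod_right'

end PotentialBounds

section PotentialL2

/-- The volume of the set of directions. -/
noncomputable def dvol : ℝ := volume.real dirs

lemma dvol_nonneg : 0 ≤ dvol := measureReal_nonneg

lemma volume_dirs : volume dirs = ENNReal.ofReal dvol := by
  rw [dvol, Measure.real, ENNReal.ofReal_toReal isCompact_dirs.measure_lt_top.ne]

lemma volume_Icc_dirs (a : ℝ) (ha : 0 ≤ a) :
    volume (Icc 0 a ×ˢ dirs) = ENNReal.ofReal (a * dvol) := by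
  rw [Measure.volume_eq_prod, Measure.prod_prod, volume_dirs, Real.volume_Icc, sub_zero,
    ENNReal.ofReal_mul ha]

lemma volume_Ico_dirs (a : ℝ) (ha : 0 ≤ a) :
    volume (Ico 0 a ×ˢ dirs) = ENNReal.ofReal (a * dvol) := by
  rw [Measure.volume_eq_prod, Measure.prod_prod, volume_dirs, Real.volume_Ico, sub_zero,
    ENNReal.ofReal_mul ha]

variable {S a : ℝ} {f : E → ℝ} {x : E}

/-- The square mean of `f` along rays of length at most `4 a`. -/
noncomputable def raySq (a : ℝ) (f : E → ℝ) (x : E) : ENNReal :=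
  ∫⁻ p in Icc 0 (4 * a) ×ˢ dirs, ‖f (x - p.1 • p.2)‖ₑ ^ 2

lemma ray_sq_le (ha : 0 ≤ a) (hf : Continuous f) (h0 : ∀ x : E, x 3 ≤ 0 → f x = 0)
    (hx : ‖x‖ ≤ 2 * a) :
    (∫⁻ p in Icc 0 S ×ˢ dirs, ‖f (x - p.1 • p.2)‖ₑ) ^ 2 ≤
      ENNReal.ofReal (4 * a * dvol) * raySq a f x := by
  have h1 : ∫⁻ p in Icc 0 S ×ˢ dirs, ‖f (x - p.1 • p.2)‖ₑ ≤
      ∫⁻ p in Icc 0 (4 * a) ×ˢ dirs, ‖f (x - p.1 • p.2)‖ₑ := by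
    rw [← lintegral_indicator (measurableSet_Icc.prod measurableSet_dirs),
      ← lintegral_indicator (measurableSet_Icc.prod measurableSet_dirs)]
    refine lintegral_mono fun p => ?_
    by_cases hp : p ∈ Icc 0 S ×ˢ dirs
    · rw [indicator_of_mem hp]
      by_cases h4 : p.1 ≤ 4 * a
      · rw [indicator_of_mem (show p ∈ Icc 0 (4 * a) ×ˢ dirs from ⟨⟨hp.1.1, h4⟩, hp.2⟩)]
      · have hx3 : x 3 ≤ 2 * a := ((le_abs_self _).trans (abs_coord_le x 3)).trans hx
        rw [h0 _ (ray_coord hp.2 (by linarith) hp.1.1)]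
        simp
    · rw [indicator_of_notMem hp]; exact zero_le
  calc _ ≤ (∫⁻ p in Icc 0 (4 * a) ×ˢ dirs, ‖f (x - p.1 • p.2)‖ₑ) ^ 2 := by gcongr
    _ ≤ _ := by
      refine (lintegral_sq_le (measurable_enorm_ray hf x).aemeasurable).trans ?_
      rw [Measure.restrict_apply_univ, volume_Icc_dirs _ (by positivity), raySq]

lemma lintegral_raySq_le (ha : 0 ≤ a) (hf : Continuous f) :
    ∫⁻ x in closedBall 0 (2 * a), raySq a f x ≤
      ENNReal.ofReal (4 * a * dvol) * ∫⁻ z in closedBall 0 (8 * a), ‖f z‖ₑ ^ 2 := by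
  have hm : Measurable ((closedBall (0 : E) (8 * a)).indicator fun z => ‖f z‖ₑ ^ 2) :=
    (hf.measurable.enorm.pow_const 2).indicator measurableSet_closedBall
  have key := lintegral_translates (μ := volume.restrict (Icc 0 (4 * a) ×ˢ dirs))
    (q := fun p : ℝ × E => p.1 • p.2) (by fun_prop)
    (H := fun z _ => (closedBall (0 : E) (8 * a)).indicator (fun z => ‖f z‖ₑ ^ 2) z)
    (hm.comp measurable_fst)
  have h2 : ∫⁻ z, ∫⁻ _ in Icc 0 (4 * a) ×ˢ dirs,
      (closedBall (0 : E) (8 * a)).indicator (fun z => ‖f z‖ₑ ^ 2) z =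
      ENNReal.ofReal (4 * a * dvol) * ∫⁻ z in closedBall 0 (8 * a), ‖f z‖ₑ ^ 2 := by
    simp only [lintegral_const, Measure.restrict_apply_univ]
    rw [lintegral_mul_const _ hm, lintegral_indicator measurableSet_closedBall,
      volume_Icc_dirs _ (by positivity), mul_comm]
  rw [← h2, ← key, ← lintegral_indicator measurableSet_closedBall]
  refine lintegral_mono fun x => ?_
  by_cases hx : x ∈ closedBall (0 : E) (2 * a)
  · rw [indicator_of_mem hx, raySq]
    refine setLIntegral_mono' (measurableSet_Icc.prod measurableSet_dirs) fun p hp => ?_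
    rw [indicator_of_mem]
    rw [mem_closedBall_zero_iff] at hx ⊢
    refine (norm_sub_le _ _).trans ?_
    rw [norm_smul, Real.norm_of_nonneg hp.1.1]
    nlinarith [dirs_norm hp.2, hp.1.2, hp.1.1, norm_nonneg p.2]
  · rw [indicator_of_notMem hx]; exact zero_le

lemma lintegral_T_sq_le (ha : 0 ≤ a) (hf : Continuous f)
    (h0 : ∀ x : E, x 3 ≤ 0 → f x = 0) (j : Fin 4) :
    ∫⁻ x in closedBall 0 (2 * a), ‖T S j f x‖ₑ ^ 2 ≤
      ENNReal.ofReal (16 * wt ^ 2 * dvol ^ 2 * a ^ 2) *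
        ∫⁻ z in closedBall 0 (8 * a), ‖f z‖ₑ ^ 2 := by
  have hD := dvol_nonneg
  have h1 : ∀ x ∈ closedBall (0 : E) (2 * a), ‖T S j f x‖ₑ ^ 2 ≤
      ENNReal.ofReal (wt ^ 2 * (4 * a * dvol)) * raySq a f x := by
    intro x hx
    rw [mem_closedBall_zero_iff] at hx
    calc ‖T S j f x‖ₑ ^ 2 ≤ (wt * ∫⁻ p in Icc 0 S ×ˢ dirs, ‖f (x - p.1 • p.2)‖ₑ) ^ 2 := by
          gcongr; exact enorm_T_le S j f hf x
      _ ≤ wt ^ 2 * (ENNReal.ofReal (4 * a * dvol) * raySq a f x) := by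
          rw [mul_pow]; gcongr; exact ray_sq_le ha hf h0 hx
      _ = _ := by
          rw [ENNReal.ofReal_mul (p := (wt : ℝ) ^ 2) (by positivity),
            ENNReal.ofReal_pow (by positivity), ENNReal.ofReal_coe_nnreal]
          ring
  refine (setLIntegral_mono' measurableSet_closedBall h1).trans ?_
  rw [lintegral_const_mul']
  · calc _ ≤ ENNReal.ofReal (wt ^ 2 * (4 * a * dvol)) * (ENNReal.ofReal (4 * a * dvol) *
          ∫⁻ z in closedBall 0 (8 * a), ‖f z‖ₑ ^ 2) := by
          gcongr; exact lintegral_raySq_le ha hf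
      _ = _ := by
          rw [← mul_assoc, ← ENNReal.ofReal_mul (by positivity)]
          ring_nf
  · exact ENNReal.ofReal_ne_top

/-- A nonnegative weight that varies slowly along rays. -/
def SlowlyVarying (c : ℝ) (χ : E → ℝ) : Prop :=
  ∀ x d : E, ∀ s : ℝ, d ∈ dirs → 0 ≤ s → s < c * ‖x‖ * χ x → χ x ≤ 2 * χ (x - s • d)

variable {c : ℝ} {χ : E → ℝ}

lemma lintegral_near_le (hc : 0 < c) (hc3 : c ≤ 1 / 3) (hχ : Continuous χ)
    (hχ0 : ∀ x, 0 ≤ χ x) (hχ1 : ∀ x, χ x ≤ 1) (hs : SlowlyVarying c χ) {g : E → ℝ}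
    (hg : Continuous g) (X : Set E) (hX : MeasurableSet X) (hX0 : 0 ∉ X) :
    ∫⁻ x in X, ENNReal.ofReal (χ x ^ 5 / ‖x‖) *
        ∫⁻ p in Ico 0 (c * ‖x‖ * χ x) ×ˢ dirs, ‖g (x - p.1 • p.2)‖ₑ ^ 2 ≤
      ENNReal.ofReal (256 * c * dvol) * ∫⁻ z, ENNReal.ofReal (χ z ^ 6) * ‖g z‖ₑ ^ 2 := by
  have hD := dvol_nonneg
  set A : Set (E × (ℝ × E)) := {w | 0 ≤ w.2.1 ∧ w.2.1 < 4 * c * ‖w.1‖ * χ w.1 ∧ w.2.2 ∈ dirs}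
    with hA
  have hAm : MeasurableSet A := by
    have h1 := hχ.measurable
    have h2 : Measurable fun w : E × (ℝ × E) => w.2.1 := by fun_prop
    have h3 : Measurable fun w : E × (ℝ × E) => 4 * c * ‖w.1‖ * χ w.1 := by fun_prop
    have h4 : Measurable fun w : E × (ℝ × E) => w.2.2 := by fun_prop
    exact (measurableSet_le measurable_const h2).inter
      ((measurableSet_lt h2 h3).inter (h4 measurableSet_dirs))
  set H : E → ℝ × E → ENNReal := fun z p =>
    A.indicator (fun w => ENNReal.ofReal (64 * (χ w.1 ^ 5 / ‖w.1‖)) * ‖g w.1‖ₑ ^ 2) (z, p) with hH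
  have hHm : Measurable (Function.uncurry H) := by
    have h1 := hχ.measurable
    have h2 := hg.measurable
    have : Measurable fun w : E × (ℝ × E) =>
        ENNReal.ofReal (64 * (χ w.1 ^ 5 / ‖w.1‖)) * ‖g w.1‖ₑ ^ 2 := by fun_prop
    exact this.indicator hAm
  have key := lintegral_translates (μ := (volume : Measure (ℝ × E)))
    (q := fun p : ℝ × E => p.1 • p.2) (by fun_prop) hHm
  have hz : ∀ z, ∫⁻ p, H z p ≤
      ENNReal.ofReal (256 * c * dvol) * (ENNReal.ofReal (χ z ^ 6) * ‖g z‖ₑ ^ 2) := by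
    intro z
    have h1 : ∀ p, H z p = (Ico 0 (4 * c * ‖z‖ * χ z) ×ˢ dirs).indicator
        (fun _ => ENNReal.ofReal (64 * (χ z ^ 5 / ‖z‖)) * ‖g z‖ₑ ^ 2) p := by
      intro p
      have : (z, p) ∈ A ↔ p ∈ Ico 0 (4 * c * ‖z‖ * χ z) ×ˢ dirs := by
        simp [hA, mem_prod, and_assoc]
      by_cases hp : (z, p) ∈ A
      · simp only [hH]
        rw [indicator_of_mem hp, indicator_of_mem (this.1 hp)]
      · simp only [hH]
        rw [indicator_of_notMem hp, indicator_of_notMem fun h => hp (this.2 h)]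
    have hχz := hχ0 z
    simp only [h1]
    rw [lintegral_indicator (measurableSet_Ico.prod measurableSet_dirs), lintegral_const,
      Measure.restrict_apply_univ, volume_Ico_dirs _ (by positivity),
      mul_right_comm, ← ENNReal.ofReal_mul (by positivity), ← mul_assoc (ENNReal.ofReal (256 * c * dvol)),
      ← ENNReal.ofReal_mul (by positivity)]
    gcongr ?_ * _
    refine ENNReal.ofReal_le_ofReal ?_
    rcases eq_or_ne z 0 with rfl | hz0
    · simp; positivity
    · have : 0 < ‖z‖ := norm_pos_iff.2 hz0
      apply le_of_eq
      field_simp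
      ring
  calc _ ≤ ∫⁻ x, ∫⁻ p, H (x - p.1 • p.2) p := by
        rw [← lintegral_indicator hX]
        refine lintegral_mono fun x => ?_
        by_cases hx : x ∈ X
        swap
        · rw [indicator_of_notMem hx]; exact zero_le
        rw [indicator_of_mem hx, ← lintegral_const_mul' _ _ ENNReal.ofReal_ne_top,
          ← lintegral_indicator (measurableSet_Ico.prod measurableSet_dirs)]
        refine lintegral_mono fun p => ?_
        by_cases hp : p ∈ Ico 0 (c * ‖x‖ * χ x) ×ˢ dirs
        swap
        · rw [indicator_of_notMem hp]; exact zero_le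
        have hx0 : 0 < ‖x‖ := norm_pos_iff.2 fun h => hX0 (h ▸ hx)
        have hχx : 0 < χ x := by
          by_contra hcon
          have : χ x = 0 := le_antisymm (not_lt.1 hcon) (hχ0 x)
          have h3 := hp.1
          simp [this] at h3
        have hslow := hs x p.2 p.1 hp.2 hp.1.1 hp.1.2
        have hp1 : p.1 ≤ ‖x‖ / 3 := by
          have : c * ‖x‖ * χ x ≤ 1 / 3 * ‖x‖ * 1 := by gcongr; exact hχ1 x
          linarith [hp.1.2]
        have hsd : ‖p.1 • p.2‖ ≤ ‖x‖ / 2 := by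
          rw [norm_smul, Real.norm_of_nonneg hp.1.1]
          nlinarith [dirs_norm hp.2, hp.1.1, norm_nonneg p.2]
        have hzu : ‖x - p.1 • p.2‖ ≤ 2 * ‖x‖ := (norm_sub_le _ _).trans (by linarith)
        have hzl : ‖x‖ ≤ 2 * ‖x - p.1 • p.2‖ := by
          have := norm_sub_norm_le x (p.1 • p.2)
          linarith
        have hz0 : 0 < ‖x - p.1 • p.2‖ := by linarith
        have hmem : (x - p.1 • p.2, p) ∈ A := by
          refine ⟨hp.1.1, lt_of_lt_of_le hp.1.2 ?_, hp.2⟩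
          calc c * ‖x‖ * χ x ≤ c * (2 * ‖x - p.1 • p.2‖) * (2 * χ (x - p.1 • p.2)) := by gcongr
            _ = _ := by ring
        rw [indicator_of_mem hp]
        simp only [hH]
        rw [indicator_of_mem hmem]
        gcongr
        rw [div_le_iff₀ hx0]
        calc χ x ^ 5 ≤ (2 * χ (x - p.1 • p.2)) ^ 5 := by gcongr
          _ = 64 * (χ (x - p.1 • p.2) ^ 5 / ‖x - p.1 • p.2‖) * (‖x - p.1 • p.2‖ / 2) := by
            field_simp
            ring
          _ ≤ _ := by
            have := hχ0 (x - p.1 • p.2)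
            gcongr
            linarith
    _ = ∫⁻ z, ∫⁻ p, H z p := key
    _ ≤ _ := by
      rw [← lintegral_const_mul' _ _ ENNReal.ofReal_ne_top]
      exact lintegral_mono hz

lemma lintegral_pd_T_sq_le (ha : 0 < a) (hc : 0 < c) (hc3 : c ≤ 1 / 3) (hχ : Continuous χ)
    (hχ0 : ∀ x, 0 ≤ χ x) (hχ1 : ∀ x, χ x ≤ 1) (hs : SlowlyVarying c χ)
    (hf : ContDiff ℝ 1 f) (h0 : ∀ x : E, x 3 ≤ 0 → f x = 0) (j l : Fin 4) :
    ∫⁻ x in closedBall 0 (2 * a) \ ball 0 a,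
        ENNReal.ofReal (χ x ^ 4 / ‖x‖ ^ 2) * ‖pd l (T S j f) x‖ₑ ^ 2 ≤
      ENNReal.ofReal (512 * wt ^ 2 * dvol ^ 2 * c ^ 2) *
        (∫⁻ z, ENNReal.ofReal (χ z ^ 6) * ‖pd l f z‖ₑ ^ 2) +
      ENNReal.ofReal (32 * wt ^ 2 * dvol ^ 2 / c ^ 2 / a ^ 2) *
        ∫⁻ z in closedBall 0 (8 * a), ‖f z‖ₑ ^ 2 := by
  have hD := dvol_nonneg
  have hg := continuous_pd (i := l) hf
  have hXm : MeasurableSet (closedBall (0 : E) (2 * a) \ ball 0 a) :=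
    measurableSet_closedBall.diff measurableSet_ball
  have h1 : ∀ x ∈ closedBall (0 : E) (2 * a) \ ball 0 a,
      ENNReal.ofReal (χ x ^ 4 / ‖x‖ ^ 2) * ‖pd l (T S j f) x‖ₑ ^ 2 ≤
      ENNReal.ofReal (2 * wt ^ 2 * dvol * c) * (ENNReal.ofReal (χ x ^ 5 / ‖x‖) *
        ∫⁻ p in Ico 0 (c * ‖x‖ * χ x) ×ˢ dirs, ‖pd l f (x - p.1 • p.2)‖ₑ ^ 2) +
      ENNReal.ofReal (8 * wt ^ 2 * dvol / c ^ 2 / a ^ 3) * raySq a f x := by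
    intro x hx
    have hx2 : ‖x‖ ≤ 2 * a := by simpa using hx.1
    have hxa : a ≤ ‖x‖ := by simpa using hx.2
    have hx0 : 0 < ‖x‖ := ha.trans_le hxa
    rcases (hχ0 x).eq_or_lt with h | hχx
    · simp [← h]
    have hσ : 0 < c * ‖x‖ * χ x := by positivity
    have hsq : ∀ A B : ENNReal, (A + B) ^ 2 ≤ 2 * (A ^ 2 + B ^ 2) := fun A B => by
      have := ENNReal.rpow_add_le_mul_rpow_add_rpow A B (p := 2) one_le_two
      norm_num at this
      exact this
    set N := ∫⁻ p in Ico 0 (c * ‖x‖ * χ x) ×ˢ dirs, ‖pd l f (x - p.1 • p.2)‖ₑ ^ 2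
    have hwt : (wt : ENNReal) = ENNReal.ofReal wt := ENNReal.ofReal_coe_nnreal.symm
    have h2 : (wt * ∫⁻ p in Ico 0 (c * ‖x‖ * χ x) ×ˢ dirs, ‖pd l f (x - p.1 • p.2)‖ₑ) ^ 2 ≤
        ENNReal.ofReal (wt ^ 2 * (c * ‖x‖ * χ x * dvol)) * N := by
      rw [mul_pow, ENNReal.ofReal_mul (p := (wt : ℝ) ^ 2) (by positivity),
        mul_assoc (ENNReal.ofReal ((wt : ℝ) ^ 2)),
        ENNReal.ofReal_pow (by positivity), ← hwt]
      gcongr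
      refine (lintegral_sq_le (measurable_enorm_ray hg x).aemeasurable).trans ?_
      rw [Measure.restrict_apply_univ, volume_Ico_dirs _ hσ.le]
    have h3 : (wt * ENNReal.ofReal (c * ‖x‖ * χ x)⁻¹ *
        ∫⁻ p in Icc 0 S ×ˢ dirs, ‖f (x - p.1 • p.2)‖ₑ) ^ 2 ≤
        ENNReal.ofReal ((wt * (c * ‖x‖ * χ x)⁻¹) ^ 2 * (4 * a * dvol)) * raySq a f x := by
      rw [mul_pow, ENNReal.ofReal_mul (p := (wt * (c * ‖x‖ * χ x)⁻¹) ^ 2) (by positivity),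
        mul_assoc (ENNReal.ofReal ((wt * (c * ‖x‖ * χ x)⁻¹) ^ 2)),
        ENNReal.ofReal_pow (by positivity), ENNReal.ofReal_mul (p := wt) (by positivity), ← hwt]
      gcongr
      exact ray_sq_le ha.le hf.continuous h0 hx2
    calc ENNReal.ofReal (χ x ^ 4 / ‖x‖ ^ 2) * ‖pd l (T S j f) x‖ₑ ^ 2
        ≤ ENNReal.ofReal (χ x ^ 4 / ‖x‖ ^ 2) * (2 *
          (ENNReal.ofReal (wt ^ 2 * (c * ‖x‖ * χ x * dvol)) * N +
          ENNReal.ofReal ((wt * (c * ‖x‖ * χ x)⁻¹) ^ 2 * (4 * a * dvol)) * raySq a f x)) := by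
          gcongr
          refine (pow_le_pow_left' (enorm_pd_T_le S j l hf hσ x) 2).trans ((hsq _ _).trans ?_)
          gcongr
      _ = ENNReal.ofReal (χ x ^ 4 / ‖x‖ ^ 2 * 2 * (wt ^ 2 * (c * ‖x‖ * χ x * dvol))) * N +
          ENNReal.ofReal (χ x ^ 4 / ‖x‖ ^ 2 * 2 *
            ((wt * (c * ‖x‖ * χ x)⁻¹) ^ 2 * (4 * a * dvol))) * raySq a f x := by
          rw [ENNReal.ofReal_mul (p := χ x ^ 4 / ‖x‖ ^ 2 * 2) (by positivity),
            ENNReal.ofReal_mul (p := χ x ^ 4 / ‖x‖ ^ 2 * 2) (by positivity),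
            ENNReal.ofReal_mul (p := χ x ^ 4 / ‖x‖ ^ 2) (by positivity), ENNReal.ofReal_ofNat]
          ring
      _ ≤ _ := by
          rw [← mul_assoc (ENNReal.ofReal (2 * wt ^ 2 * dvol * c)),
            ← ENNReal.ofReal_mul (by positivity)]
          gcongr ?_ * _ + ?_ * _
          · refine ENNReal.ofReal_le_ofReal (le_of_eq ?_)
            field_simp
          · refine ENNReal.ofReal_le_ofReal ?_
            have e1 : χ x ^ 4 / ‖x‖ ^ 2 * 2 * ((wt * (c * ‖x‖ * χ x)⁻¹) ^ 2 * (4 * a * dvol)) =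
                8 * wt ^ 2 * dvol / c ^ 2 * (χ x ^ 2 * (a / ‖x‖ ^ 4)) := by
              field_simp
              ring
            have e2 : 8 * wt ^ 2 * dvol / c ^ 2 / a ^ 3 =
                8 * wt ^ 2 * dvol / c ^ 2 * (1 ^ 2 * (a / a ^ 4)) := by
              field_simp
            rw [e1, e2]
            have := hχ1 x
            gcongr
  have hmN : Measurable fun x => raySq a f x := by
    have h5 : Continuous fun w : E × (ℝ × E) => f (w.1 - w.2.1 • w.2.2) := by
      have := hf.continuous
      fun_prop
    exact (h5.measurable.enorm.pow_const 2).lintegral_prod_right'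
  refine (setLIntegral_mono' hXm h1).trans ?_
  rw [lintegral_add_right _ (hmN.const_mul _), lintegral_const_mul' _ _ ENNReal.ofReal_ne_top,
    lintegral_const_mul' _ _ ENNReal.ofReal_ne_top]
  refine add_le_add ?_ ?_
  · calc _ ≤ ENNReal.ofReal (2 * wt ^ 2 * dvol * c) * (ENNReal.ofReal (256 * c * dvol) *
          ∫⁻ z, ENNReal.ofReal (χ z ^ 6) * ‖pd l f z‖ₑ ^ 2) := by
          gcongr
          exact lintegral_near_le hc hc3 hχ hχ0 hχ1 hs hg _ hXm (by simp [ha])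
      _ = _ := by
          rw [← mul_assoc, ← ENNReal.ofReal_mul (by positivity)]
          ring_nf
  · calc _ ≤ ENNReal.ofReal (8 * wt ^ 2 * dvol / c ^ 2 / a ^ 3) *
          (ENNReal.ofReal (4 * a * dvol) * ∫⁻ z in closedBall 0 (8 * a), ‖f z‖ₑ ^ 2) := by
          gcongr
          exact (lintegral_mono_set sdiff_subset).trans (lintegral_raySq_le ha.le hf.continuous)
      _ = _ := by
          rw [← mul_assoc, ← ENNReal.ofReal_mul (by positivity)]
          congr 2
          field_simp
          ring

end PotentialL2

section Cutoff

/-- The dyadic annulus of inner radius `a`. -/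
def annulus (a : ℝ) : Set E := closedBall 0 (2 * a) \ ball 0 a

lemma mem_annulus {a : ℝ} {x : E} : x ∈ annulus a ↔ a ≤ ‖x‖ ∧ ‖x‖ ≤ 2 * a := by
  simp [annulus, and_comm]

/-- A smooth cutoff of the ball of radius `a`. -/
noncomputable def ballCutoff (a : ℝ) (x : E) : ℝ := Real.smoothTransition (2 - ‖x‖ ^ 2 / a ^ 2)

lemma contDiff_ballCutoff (a : ℝ) : ContDiff ℝ ∞ (ballCutoff a) := by
  have h : ContDiff ℝ ∞ fun x : E => ‖x‖ ^ 2 := contDiff_norm_sq ℝ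
  exact Real.smoothTransition.contDiff.comp (contDiff_const.sub (h.div_const _))

lemma ballCutoff_nonneg (a : ℝ) (x : E) : 0 ≤ ballCutoff a x := Real.smoothTransition.nonneg _

lemma ballCutoff_le_one (a : ℝ) (x : E) : ballCutoff a x ≤ 1 := Real.smoothTransition.le_one _

lemma ballCutoff_eq_one {a : ℝ} (ha : 0 < a) {x : E} (hx : ‖x‖ ≤ a) : ballCutoff a x = 1 := by
  refine Real.smoothTransition.one_of_one_le ?_
  have : ‖x‖ ^ 2 / a ^ 2 ≤ 1 := by rw [div_le_one (by positivity)]; gcongr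
  linarith

lemma ballCutoff_eq_zero {a : ℝ} (ha : 0 < a) {x : E} (hx : 2 * a ≤ ‖x‖) : ballCutoff a x = 0 := by
  refine Real.smoothTransition.zero_of_nonpos ?_
  have : 2 ≤ ‖x‖ ^ 2 / a ^ 2 := by rw [le_div_iff₀ (by positivity)]; nlinarith
  linarith

lemma ballCutoff_scale (a : ℝ) (x : E) : ballCutoff a x = ballCutoff 1 (a⁻¹ • x) := by
  simp [ballCutoff, norm_smul, mul_pow, div_eq_inv_mul]

lemma pd_scale {f : E → ℝ} {b : ℝ} (hf : Differentiable ℝ f) (i : Fin 4) (x : E) :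
    pd i (fun y => f (b • y)) x = b * pd i f (b • x) := by
  have h1 : HasFDerivAt (fun y : E => b • y) (b • ContinuousLinearMap.id ℝ E) x :=
    (hasFDerivAt_id x).const_smul b
  have h3 := ((hf (b • x)).hasFDerivAt.comp x h1).fderiv
  simp only [pd, Function.comp_def] at h3 ⊢
  rw [h3]
  simp

lemma pd_const_mul {f : E → ℝ} {x : E} (hf : DifferentiableAt ℝ f x) (c : ℝ) (i : Fin 4) :
    pd i (fun y => c * f y) x = c * pd i f x := by
  simp [pd, fderiv_const_mul hf]

lemma pd_ballCutoff (a : ℝ) (i : Fin 4) (x : E) :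
    pd i (ballCutoff a) x = a⁻¹ * pd i (ballCutoff 1) (a⁻¹ • x) := by
  rw [funext (ballCutoff_scale a)]
  exact pd_scale ((contDiff_ballCutoff 1).differentiable (by simp)) i x

lemma contDiff_pd_top {f : E → ℝ} (hf : ContDiff ℝ ∞ f) (i : Fin 4) : ContDiff ℝ ∞ (pd i f) :=
  contDiff_pd (n := ∞) hf

lemma pd_pd_ballCutoff (a : ℝ) (i l : Fin 4) (x : E) :
    pd i (pd l (ballCutoff a)) x = a⁻¹ ^ 2 * pd i (pd l (ballCutoff 1)) (a⁻¹ • x) := by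
  have h := (contDiff_pd_top (contDiff_ballCutoff 1) l).differentiable (by simp)
  rw [funext (pd_ballCutoff a l), pd_const_mul, pd_scale h]
  · ring
  · exact (h.comp (differentiable_id.const_smul a⁻¹)) x

lemma pd_eq_zero_of_const {f : E → ℝ} {U : Set E} (hU : IsOpen U) {c : ℝ} (h : ∀ x ∈ U, f x = c)
    {x : E} (hx : x ∈ U) (i : Fin 4) : pd i f x = 0 := by
  rw [pd_congr (g := fun _ => c) (by filter_upwards [hU.mem_nhds hx] with y hy using h y hy),
    pd_const]

lemma pd_ballCutoff_eq_zero {a : ℝ} (ha : 0 < a) {x : E} (hx : x ∉ annulus a) (i : Fin 4) :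
    pd i (ballCutoff a) x = 0 := by
  rw [mem_annulus, not_and_or, not_le, not_le] at hx
  rcases hx with hx | hx
  · exact pd_eq_zero_of_const (isOpen_lt continuous_norm continuous_const)
      (fun y hy => ballCutoff_eq_one ha (le_of_lt hy)) hx i
  · exact pd_eq_zero_of_const (isOpen_lt continuous_const continuous_norm)
      (fun y hy => ballCutoff_eq_zero ha (le_of_lt hy)) hx i

lemma isOpen_compl_annulus (a : ℝ) : IsOpen (annulus a)ᶜ :=
  (isClosed_closedBall.sdiff isOpen_ball).isOpen_compl

lemma pd_pd_ballCutoff_eq_zero {a : ℝ} (ha : 0 < a) {x : E} (hx : x ∉ annulus a) (i l : Fin 4) :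
    pd i (pd l (ballCutoff a)) x = 0 :=
  pd_eq_zero_of_const (isOpen_compl_annulus a) (fun _ hy => pd_ballCutoff_eq_zero ha hy l) hx i

lemma exists_ballCutoff_bound : ∃ L : ℝ, 0 < L ∧ ∀ a : ℝ, 0 < a → ∀ (x : E) (i l : Fin 4),
    |pd i (ballCutoff a) x| * ‖x‖ ≤ L ∧ |pd i (pd l (ballCutoff a)) x| * ‖x‖ ^ 2 ≤ L := by
  have hcs : HasCompactSupport (ballCutoff 1) :=
    HasCompactSupport.intro (isCompact_closedBall (0 : E) 2) fun x hx => by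
      refine ballCutoff_eq_zero one_pos ?_
      simp only [mem_closedBall_zero_iff, not_le] at hx
      linarith
  have h1 : ∀ i : Fin 4, ∃ A, ∀ x : E, ‖pd i (ballCutoff 1) x‖ ≤ A := fun i =>
    (hasCompactSupport_pd hcs).exists_bound_of_continuous
      (contDiff_pd_top (contDiff_ballCutoff 1) i).continuous
  have h2 : ∀ i l : Fin 4, ∃ A, ∀ x : E, ‖pd i (pd l (ballCutoff 1)) x‖ ≤ A := fun i l =>
    (hasCompactSupport_pd (hasCompactSupport_pd hcs)).exists_bound_of_continuous
      (contDiff_pd_top (contDiff_pd_top (contDiff_ballCutoff 1) l) i).continuous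
  choose A hA using h1
  choose B hB using h2
  set M := 1 + ∑ j, |A j| + ∑ j, ∑ l, |B j l| with hM
  have hMA : ∀ i, A i ≤ M := fun i => by
    have := Finset.single_le_sum (f := fun j => |A j|) (fun _ _ => abs_nonneg _) (Finset.mem_univ i)
    have h0 : 0 ≤ ∑ j, ∑ l, |B j l| := by positivity
    linarith [le_abs_self (A i)]
  have hMB : ∀ i l, B i l ≤ M := fun i l => by
    have h3 := Finset.single_le_sum (f := fun l => |B i l|) (fun _ _ => abs_nonneg _)
      (Finset.mem_univ l)
    have h4 := Finset.single_le_sum (f := fun j => ∑ l, |B j l|)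
      (fun _ _ => Finset.sum_nonneg fun _ _ => abs_nonneg _) (Finset.mem_univ i)
    have h0 : 0 ≤ ∑ j, |A j| := by positivity
    linarith [le_abs_self (B i l)]
  have hM0 : 0 < M := by positivity
  refine ⟨4 * M, by positivity, fun a ha x i l => ?_⟩
  by_cases hx : x ∈ annulus a
  · obtain ⟨hx1, hx2⟩ := mem_annulus.1 hx
    rw [pd_ballCutoff, pd_pd_ballCutoff, abs_mul, abs_mul, abs_of_pos (inv_pos.2 ha),
      abs_of_pos (by positivity : 0 < a⁻¹ ^ 2)]
    have e1 : |pd i (ballCutoff 1) (a⁻¹ • x)| ≤ M := (hA i _).trans (hMA i)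
    have e2 : |pd i (pd l (ballCutoff 1)) (a⁻¹ • x)| ≤ M := (hB i l _).trans (hMB i l)
    constructor
    · calc a⁻¹ * |pd i (ballCutoff 1) (a⁻¹ • x)| * ‖x‖ ≤ a⁻¹ * M * (2 * a) := by gcongr
        _ = 2 * M := by field_simp
        _ ≤ 4 * M := by linarith
    · calc a⁻¹ ^ 2 * |pd i (pd l (ballCutoff 1)) (a⁻¹ • x)| * ‖x‖ ^ 2
          ≤ a⁻¹ ^ 2 * M * (2 * a) ^ 2 := by gcongr
        _ = 4 * M := by field_simp; ring
  · rw [pd_ballCutoff_eq_zero ha hx, pd_pd_ballCutoff_eq_zero ha hx]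
    simp [hM0.le]

/-- The cutoff of the region `r ≤ ‖x‖ ≤ R`. -/
noncomputable def shell (r R : ℝ) (x : E) : ℝ := ballCutoff R x * (1 - ballCutoff (r / 2) x)

variable {r R : ℝ}

lemma contDiff_shell (r R : ℝ) : ContDiff ℝ ∞ (shell r R) :=
  (contDiff_ballCutoff R).mul (contDiff_const.sub (contDiff_ballCutoff _))

lemma shell_nonneg (r R : ℝ) (x : E) : 0 ≤ shell r R x :=
  mul_nonneg (ballCutoff_nonneg _ _) (by linarith [ballCutoff_le_one (r / 2) x])

lemma shell_le_one (r R : ℝ) (x : E) : shell r R x ≤ 1 :=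
  mul_le_one₀ (ballCutoff_le_one _ _) (by linarith [ballCutoff_le_one (r / 2) x])
    (by linarith [ballCutoff_nonneg (r / 2) x])

lemma shell_eq_one (hr : 0 < r) (hR : 0 < R) {x : E} (h1 : r ≤ ‖x‖) (h2 : ‖x‖ ≤ R) :
    shell r R x = 1 := by
  rw [shell, ballCutoff_eq_one hR h2, ballCutoff_eq_zero (by positivity) (by linarith)]
  norm_num

lemma shell_eq_zero (hr : 0 < r) (hR : 0 < R) {x : E} (h : ‖x‖ ≤ r / 2 ∨ 2 * R ≤ ‖x‖) :
    shell r R x = 0 := by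
  rcases h with h | h
  · rw [shell, ballCutoff_eq_one (by positivity) h]; ring
  · rw [shell, ballCutoff_eq_zero hR h, zero_mul]

lemma tsupport_shell (hr : 0 < r) (hR : 0 < R) :
    tsupport (shell r R) ⊆ closedBall 0 (2 * R) \ ball 0 (r / 2) := by
  refine closure_minimal (fun x hx => ?_) (isClosed_closedBall.sdiff isOpen_ball)
  by_contra h
  refine hx (shell_eq_zero hr hR ?_)
  simp only [Set.mem_sdiff, mem_closedBall_zero_iff, mem_ball_zero_iff, not_lt, not_and_or, not_le] at h
  rcases h with h | h
  · exact Or.inr h.le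
  · exact Or.inl h.le

lemma pd_shell_eq_zero (hr : 0 < r) (hR : 0 < R) {x : E}
    (hx : x ∉ annulus (r / 2) ∪ annulus R) (i : Fin 4) : pd i (shell r R) x = 0 := by
  simp only [mem_union, not_or] at hx
  have d1 := (contDiff_ballCutoff R).differentiable (by simp) x
  have d2 := (contDiff_ballCutoff (r / 2)).differentiable (by simp) x
  have d3 : DifferentiableAt ℝ (fun y => 1 - ballCutoff (r / 2) y) x := by fun_prop
  unfold shell
  rw [pd_mul d1 d3, pd_sub (by fun_prop) d2, pd_const, pd_ballCutoff_eq_zero hR hx.2,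
    pd_ballCutoff_eq_zero (by positivity) hx.1]
  ring

lemma pd_pd_shell_eq_zero (hr : 0 < r) (hR : 0 < R) {x : E}
    (hx : x ∉ annulus (r / 2) ∪ annulus R) (i l : Fin 4) : pd i (pd l (shell r R)) x = 0 := by
  refine pd_eq_zero_of_const (U := (annulus (r / 2) ∪ annulus R)ᶜ) ?_
    (fun _ hy => pd_shell_eq_zero hr hR hy l) hx i
  rw [compl_union]
  exact (isOpen_compl_annulus _).inter (isOpen_compl_annulus _)

lemma exists_shell_bound : ∃ L : ℝ, 0 < L ∧ ∀ r R : ℝ, 0 < r → 0 < R → ∀ (x : E) (i l : Fin 4),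
    |pd i (shell r R) x| * ‖x‖ ≤ L ∧ |pd i (pd l (shell r R)) x| * ‖x‖ ^ 2 ≤ L := by
  obtain ⟨L, hL, h⟩ := exists_ballCutoff_bound
  refine ⟨2 * L + 2 * L ^ 2, by positivity, fun r R hr hR x i l => ?_⟩
  have s1 := contDiff_ballCutoff R
  have s2 := contDiff_ballCutoff (r / 2)
  have d1 : Differentiable ℝ (ballCutoff R) := s1.differentiable (by simp)
  have d2 : Differentiable ℝ (ballCutoff (r / 2)) := s2.differentiable (by simp)
  have d1' : ∀ l, Differentiable ℝ (pd l (ballCutoff R)) := fun l =>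
    (contDiff_pd_top s1 l).differentiable (by simp)
  have d2' : ∀ l, Differentiable ℝ (pd l (ballCutoff (r / 2))) := fun l =>
    (contDiff_pd_top s2 l).differentiable (by simp)
  have e1 : ∀ i y, pd i (shell r R) y = pd i (ballCutoff R) y * (1 - ballCutoff (r / 2) y) -
      ballCutoff R y * pd i (ballCutoff (r / 2)) y := by
    intro i y
    unfold shell
    rw [pd_mul (d1 y) (by fun_prop), pd_sub (by fun_prop) (d2 y), pd_const]
    ring
  have e2 : pd i (pd l (shell r R)) x =
      pd i (pd l (ballCutoff R)) x * (1 - ballCutoff (r / 2) x) -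
      pd l (ballCutoff R) x * pd i (ballCutoff (r / 2)) x -
      (pd i (ballCutoff R) x * pd l (ballCutoff (r / 2)) x +
      ballCutoff R x * pd i (pd l (ballCutoff (r / 2))) x) := by
    have := d1' l
    have := d2' l
    rw [funext (e1 l), pd_sub (by fun_prop) (by fun_prop), pd_mul (by fun_prop) (by fun_prop),
      pd_mul (by fun_prop) (by fun_prop), pd_sub (by fun_prop) (by fun_prop), pd_const]
    ring
  have hr2 : 0 < r / 2 := by positivity
  obtain ⟨a1, a2⟩ := h R hR x i l
  obtain ⟨b1, b2⟩ := h (r / 2) hr2 x i l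
  obtain ⟨a3, -⟩ := h R hR x l l
  obtain ⟨b3, -⟩ := h (r / 2) hr2 x l l
  have k0 : |1 - ballCutoff (r / 2) x| ≤ 1 := by
    rw [abs_le]
    constructor <;> linarith [ballCutoff_nonneg (r / 2) x, ballCutoff_le_one (r / 2) x]
  have k1 : |ballCutoff R x| ≤ 1 := by
    rw [abs_le]
    constructor <;> linarith [ballCutoff_nonneg R x, ballCutoff_le_one R x]
  have hx := norm_nonneg x
  constructor
  · rw [e1]
    calc _ ≤ (|pd i (ballCutoff R) x| * |1 - ballCutoff (r / 2) x| +
          |ballCutoff R x| * |pd i (ballCutoff (r / 2)) x|) * ‖x‖ := by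
          gcongr
          refine (abs_sub _ _).trans ?_
          rw [abs_mul, abs_mul]
      _ ≤ (|pd i (ballCutoff R) x| * 1 + 1 * |pd i (ballCutoff (r / 2)) x|) * ‖x‖ := by gcongr
      _ ≤ _ := by nlinarith
  · rw [e2]
    calc _ ≤ (|pd i (pd l (ballCutoff R)) x| * |1 - ballCutoff (r / 2) x| +
          |pd l (ballCutoff R) x| * |pd i (ballCutoff (r / 2)) x| +
          (|pd i (ballCutoff R) x| * |pd l (ballCutoff (r / 2)) x| +
          |ballCutoff R x| * |pd i (pd l (ballCutoff (r / 2))) x|)) * ‖x‖ ^ 2 := by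
          gcongr
          refine (abs_sub _ _).trans (add_le_add ((abs_sub _ _).trans ?_) ((abs_add_le _ _).trans ?_))
          · rw [abs_mul, abs_mul]
          · rw [abs_mul, abs_mul]
      _ ≤ (|pd i (pd l (ballCutoff R)) x| * 1 +
          |pd l (ballCutoff R) x| * |pd i (ballCutoff (r / 2)) x| +
          (|pd i (ballCutoff R) x| * |pd l (ballCutoff (r / 2)) x| +
          1 * |pd i (pd l (ballCutoff (r / 2))) x|)) * ‖x‖ ^ 2 := by gcongr
      _ = |pd i (pd l (ballCutoff R)) x| * ‖x‖ ^ 2 +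
          (|pd l (ballCutoff R) x| * ‖x‖) * (|pd i (ballCutoff (r / 2)) x| * ‖x‖) +
          ((|pd i (ballCutoff R) x| * ‖x‖) * (|pd l (ballCutoff (r / 2)) x| * ‖x‖) +
          |pd i (pd l (ballCutoff (r / 2))) x| * ‖x‖ ^ 2) := by ring
      _ ≤ L + L * L + (L * L + L) := by gcongr
      _ = _ := by ring

lemma slowlyVarying_of_pd_bound {χ : E → ℝ} {L c : ℝ} (hχ : Differentiable ℝ χ)
    (hχ0 : ∀ x, 0 ≤ χ x) (hχ1 : ∀ x, χ x ≤ 1) (hL : 0 < L)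
    (hb : ∀ (x : E) (i : Fin 4), |pd i χ x| * ‖x‖ ≤ L) (hc : 0 < c) (hc3 : c ≤ 1 / 3)
    (hcL : 24 * L * c ≤ 1) : SlowlyVarying c χ := by
  intro x d s hd hs hsc
  rcases (norm_nonneg x).eq_or_lt with hx | hx
  · rw [← hx] at hsc; simp at hsc; linarith
  have hs3 : s ≤ ‖x‖ / 3 := by
    have : c * ‖x‖ * χ x ≤ 1 / 3 * ‖x‖ * 1 := by gcongr; exacts [hχ0 x, hχ1 x]
    linarith
  have hball : ∀ y ∈ closedBall x (‖x‖ / 2), ‖fderiv ℝ χ y‖ ≤ 8 * L / ‖x‖ := by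
    intro y hy
    rw [mem_closedBall, dist_eq_norm] at hy
    have hy2 : ‖x‖ / 2 ≤ ‖y‖ := by
      have := norm_sub_norm_le x y
      rw [norm_sub_rev] at this
      linarith
    have hi : ∀ i : Fin 4, |pd i χ y| ≤ 2 * L / ‖x‖ := by
      intro i
      rw [le_div_iff₀ hx]
      nlinarith [hb y i, abs_nonneg (pd i χ y)]
    refine (norm_fderiv_le χ y).trans ((Finset.sum_le_sum fun i _ => hi i).trans (le_of_eq ?_))
    simp
    ring
  have hsd : ‖s • d‖ ≤ 3 / 2 * s := by
    rw [norm_smul, Real.norm_of_nonneg hs]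
    nlinarith [dirs_norm hd]
  have := (convex_closedBall x (‖x‖ / 2)).norm_image_sub_le_of_norm_fderiv_le (𝕜 := ℝ)
    (fun y _ => hχ y) hball (x := x - s • d) (y := x)
    (by rw [mem_closedBall, dist_eq_norm]; simp only [sub_sub_cancel_left, norm_neg]; linarith)
    (mem_closedBall_self (by positivity))
  rw [sub_sub_cancel, Real.norm_eq_abs] at this
  have h2 : 8 * L / ‖x‖ * ‖s • d‖ ≤ χ x / 2 := by
    calc 8 * L / ‖x‖ * ‖s • d‖ ≤ 8 * L / ‖x‖ * (3 / 2 * (c * ‖x‖ * χ x)) := by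
          gcongr; linarith
      _ = (24 * L * c) * χ x / 2 := by field_simp; ring
      _ ≤ 1 * χ x / 2 := by gcongr; exact hχ0 x
      _ = _ := by ring
  linarith [le_abs_self (χ x - χ (x - s • d))]

end Cutoff

section RealBounds

variable {a c S : ℝ} {f χ : E → ℝ}

/-- The scale invariant local mass. -/
noncomputable def mass (a : ℝ) (f : E → ℝ) : ℝ := (a ^ 2)⁻¹ * ∫ z in closedBall 0 (8 * a), f z ^ 2

lemma mass_nonneg (a : ℝ) (f : E → ℝ) : 0 ≤ mass a f :=
  mul_nonneg (by positivity) (integral_nonneg fun _ => sq_nonneg _)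

lemma isCompact_annulus (a : ℝ) : IsCompact (annulus a) :=
  (isCompact_closedBall _ _).diff isOpen_ball

lemma ne_zero_of_mem_annulus (ha : 0 < a) {x : E} (hx : x ∈ annulus a) : ‖x‖ ≠ 0 :=
  (ha.trans_le (mem_annulus.1 hx).1).ne'

lemma ofReal_integral_sq {s : Set E} {g : E → ℝ} (h : IntegrableOn (fun x => g x ^ 2) s) :
    ENNReal.ofReal (∫ x in s, g x ^ 2) = ∫⁻ x in s, ‖g x‖ₑ ^ 2 := by
  rw [ofReal_integral_eq_lintegral_ofReal h (ae_of_all _ fun x => sq_nonneg _)]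
  refine lintegral_congr fun x => ?_
  rw [← sq_abs, ENNReal.ofReal_pow (abs_nonneg _), ← Real.norm_eq_abs, ofReal_norm]

lemma integrableOn_sq {s : Set E} (hs : IsCompact s) {g : E → ℝ} (hg : Continuous g) :
    IntegrableOn (fun x => g x ^ 2) s :=
  (hg.pow 2).continuousOn.integrableOn_compact hs

lemma integral_T_sq_le (ha : 0 < a) (hf : ContDiff ℝ 1 f) (h0 : ∀ x : E, x 3 ≤ 0 → f x = 0)
    (j : Fin 4) :
    ∫ x in annulus a, (T S j f x) ^ 2 / ‖x‖ ^ 4 ≤ 16 * wt ^ 2 * dvol ^ 2 * mass a f := by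
  have hT := (contDiff_T S j hf).continuous
  have h1 : ∫ x in closedBall 0 (2 * a), (T S j f x) ^ 2 ≤
      16 * wt ^ 2 * dvol ^ 2 * a ^ 2 * ∫ z in closedBall 0 (8 * a), f z ^ 2 := by
    rw [← ENNReal.ofReal_le_ofReal_iff (by positivity), ENNReal.ofReal_mul (by positivity),
      ofReal_integral_sq (integrableOn_sq (isCompact_closedBall _ _) hT),
      ofReal_integral_sq (integrableOn_sq (isCompact_closedBall _ _) hf.continuous)]
    exact lintegral_T_sq_le ha.le hf.continuous h0 j
  calc ∫ x in annulus a, (T S j f x) ^ 2 / ‖x‖ ^ 4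
      ≤ ∫ x in annulus a, (T S j f x) ^ 2 * (a ^ 4)⁻¹ := by
        refine setIntegral_mono_on ?_ ?_ (isCompact_annulus a).measurableSet fun x hx => ?_
        · refine ContinuousOn.integrableOn_compact (isCompact_annulus a) ?_
          exact (hT.pow 2).continuousOn.div (by fun_prop)
            fun x hx => pow_ne_zero _ (ne_zero_of_mem_annulus ha hx)
        · exact ((hT.pow 2).mul continuous_const).continuousOn.integrableOn_compact
            (isCompact_annulus a)
        · rw [div_eq_mul_inv]
          have := (mem_annulus.1 hx).1
          gcongr
    _ = (∫ x in annulus a, (T S j f x) ^ 2) * (a ^ 4)⁻¹ := integral_mul_const _ _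
    _ ≤ (∫ x in closedBall 0 (2 * a), (T S j f x) ^ 2) * (a ^ 4)⁻¹ := by
        gcongr ?_ * _
        exact setIntegral_mono_set (integrableOn_sq (isCompact_closedBall _ _) hT)
          (ae_of_all _ fun x => sq_nonneg _) (sdiff_subset.eventuallyLE)
    _ ≤ (16 * wt ^ 2 * dvol ^ 2 * a ^ 2 * ∫ z in closedBall 0 (8 * a), f z ^ 2) * (a ^ 4)⁻¹ := by
        gcongr
    _ = _ := by
        unfold mass
        field_simp

lemma integral_sq_div_le (ha : 0 < a) (hf : Continuous f) :
    ∫ x in annulus a, f x ^ 2 / ‖x‖ ^ 2 ≤ mass a f := by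
  calc ∫ x in annulus a, f x ^ 2 / ‖x‖ ^ 2
      ≤ ∫ x in annulus a, (a ^ 2)⁻¹ * f x ^ 2 := by
        refine setIntegral_mono_on ?_ ?_ (isCompact_annulus a).measurableSet fun x hx => ?_
        · refine ContinuousOn.integrableOn_compact (isCompact_annulus a) ?_
          exact (hf.pow 2).continuousOn.div (by fun_prop)
            fun x hx => pow_ne_zero _ (ne_zero_of_mem_annulus ha hx)
        · exact (continuous_const.mul (hf.pow 2)).continuousOn.integrableOn_compact
            (isCompact_annulus a)
        · rw [div_eq_mul_inv, mul_comm]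
          have := (mem_annulus.1 hx).1
          gcongr
    _ = (a ^ 2)⁻¹ * ∫ x in annulus a, f x ^ 2 := integral_const_mul _ _
    _ ≤ mass a f := by
        unfold mass
        refine mul_le_mul_of_nonneg_left ?_ (by positivity)
        refine setIntegral_mono_set (integrableOn_sq (isCompact_closedBall _ _) hf)
          (ae_of_all _ fun x => sq_nonneg _) (LE.le.eventuallyLE ?_)
        exact sdiff_subset.trans (closedBall_subset_closedBall (by linarith))

lemma integral_pd_T_sq_le (ha : 0 < a) (hc : 0 < c) (hc3 : c ≤ 1 / 3) (hχ : Continuous χ)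
    (hχc : HasCompactSupport χ)
    (hχ0 : ∀ x, 0 ≤ χ x) (hχ1 : ∀ x, χ x ≤ 1) (hs : SlowlyVarying c χ)
    (hf : ContDiff ℝ 1 f) (h0 : ∀ x : E, x 3 ≤ 0 → f x = 0) (j l : Fin 4) :
    ∫ x in annulus a, χ x ^ 4 / ‖x‖ ^ 2 * (pd l (T S j f) x) ^ 2 ≤
      512 * wt ^ 2 * dvol ^ 2 * c ^ 2 * (∫ z, χ z ^ 6 * pd l f z ^ 2) +
      32 * wt ^ 2 * dvol ^ 2 / c ^ 2 * mass a f := by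
  have hT := continuous_pd (i := l) (contDiff_T S j hf)
  have hF := continuous_pd (i := l) hf
  have i1 : IntegrableOn (fun x => χ x ^ 4 / ‖x‖ ^ 2 * (pd l (T S j f) x) ^ 2) (annulus a) := by
    refine ContinuousOn.integrableOn_compact (isCompact_annulus a) ?_
    have h4 : ContinuousOn (fun x => χ x ^ 4) (annulus a) := (hχ.pow 4).continuousOn
    have h2 : ContinuousOn (fun x => pd l (T S j f) x ^ 2) (annulus a) := (hT.pow 2).continuousOn
    refine (h4.div (by fun_prop) fun x hx => ?_).mul h2
    exact pow_ne_zero _ (ne_zero_of_mem_annulus ha hx)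
  have i2 : Integrable (fun z => χ z ^ 6 * pd l f z ^ 2) := by
    refine Continuous.integrable_of_hasCompactSupport (by fun_prop) ?_
    exact HasCompactSupport.mul_right (hχc.comp_left (g := fun t : ℝ => t ^ 6) (by norm_num))
  have e2 : ENNReal.ofReal (∫ z, χ z ^ 6 * pd l f z ^ 2) =
      ∫⁻ z, ENNReal.ofReal (χ z ^ 6) * ‖pd l f z‖ₑ ^ 2 := by
    rw [ofReal_integral_eq_lintegral_ofReal i2
      (ae_of_all _ fun x => mul_nonneg (pow_nonneg (hχ0 x) _) (sq_nonneg _))]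
    refine lintegral_congr fun x => ?_
    rw [ENNReal.ofReal_mul (pow_nonneg (hχ0 x) _), ← sq_abs, ENNReal.ofReal_pow (abs_nonneg _),
      ← Real.norm_eq_abs, ofReal_norm]
  have e1 : ENNReal.ofReal (∫ x in annulus a, χ x ^ 4 / ‖x‖ ^ 2 * (pd l (T S j f) x) ^ 2) =
      ∫⁻ x in annulus a, ENNReal.ofReal (χ x ^ 4 / ‖x‖ ^ 2) * ‖pd l (T S j f) x‖ₑ ^ 2 := by
    have hn : ∀ x, 0 ≤ χ x ^ 4 / ‖x‖ ^ 2 := fun x => by have := hχ0 x; positivity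
    rw [ofReal_integral_eq_lintegral_ofReal i1
      (ae_of_all _ fun x => mul_nonneg (hn x) (sq_nonneg _))]
    refine lintegral_congr fun x => ?_
    rw [ENNReal.ofReal_mul (hn x), ← sq_abs (pd l (T S j f) x), ENNReal.ofReal_pow (abs_nonneg _),
      ← Real.norm_eq_abs, ofReal_norm]
  have p1 : 0 ≤ ∫ z, χ z ^ 6 * pd l f z ^ 2 :=
    integral_nonneg fun x => mul_nonneg (pow_nonneg (hχ0 x) _) (sq_nonneg _)
  have p2 : 0 ≤ ∫ z in closedBall (0 : E) (8 * a), f z ^ 2 :=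
    integral_nonneg fun x => sq_nonneg _
  have p3 := mass_nonneg a f
  have e3 : 32 * wt ^ 2 * dvol ^ 2 / c ^ 2 * mass a f =
      32 * wt ^ 2 * dvol ^ 2 / c ^ 2 / a ^ 2 * ∫ z in closedBall 0 (8 * a), f z ^ 2 := by
    unfold mass; ring
  rw [e3, ← ENNReal.ofReal_le_ofReal_iff (by positivity), ENNReal.ofReal_add (by positivity)
    (by positivity), ENNReal.ofReal_mul (p := 512 * wt ^ 2 * dvol ^ 2 * c ^ 2) (by positivity),
    e1, e2, ENNReal.ofReal_mul (p := 32 * wt ^ 2 * dvol ^ 2 / c ^ 2 / a ^ 2) (by positivity),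
    ofReal_integral_sq (integrableOn_sq (isCompact_closedBall _ _) hf.continuous)]
  exact lintegral_pd_T_sq_le ha hc hc3 hχ hχ0 hχ1 hs hf h0 j l

end RealBounds

section TestField

variable {S : ℝ} {V : Fin 4 → E → ℝ} {ψ χ : E → ℝ} {x : E}

/-- The skew potential of a solenoidal field. -/
noncomputable def potential (S : ℝ) (V : Fin 4 → E → ℝ) (i l : Fin 4) (x : E) : ℝ :=
  T S l (V i) x - T S i (V l) x

/-- The solenoidal localisation of the field `V` by the cutoff `ψ`. -/
noncomputable def testField (S : ℝ) (ψ : E → ℝ) (V : Fin 4 → E → ℝ) (i : Fin 4) (x : E) : ℝ :=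
  ψ x * V i x + ∑ l, pd l ψ x * potential S V i l x

lemma contDiff_potential (hV : ∀ i, ContDiff ℝ 1 (V i)) (i l : Fin 4) :
    ContDiff ℝ 1 (potential S V i l) :=
  (contDiff_T S l (hV i)).sub (contDiff_T S i (hV l))

lemma pd_potential (hV : ∀ i, ContDiff ℝ 1 (V i)) (i l m : Fin 4) :
    pd m (potential S V i l) x = pd m (T S l (V i)) x - pd m (T S i (V l)) x :=
  pd_sub ((contDiff_T S l (hV i)).differentiable one_ne_zero x)
    ((contDiff_T S i (hV l)).differentiable one_ne_zero x)

lemma potential_skew (i l : Fin 4) : potential S V l i x = - potential S V i l x := by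
  simp [potential]

lemma integrableOn_ray (j : Fin 4) {f : E → ℝ} (hf : Continuous f) :
    IntegrableOn (fun p : ℝ × E => rho p.2 * p.2 j * f (x - p.1 • p.2)) (Icc 0 S ×ˢ dirs) := by
  refine ContinuousOn.integrableOn_compact (isCompact_ray S) (Continuous.continuousOn ?_)
  exact (continuous_weight j).mul (hf.comp (by fun_prop))

lemma sum_T_eq_zero (hV : ∀ i, ContDiff ℝ 1 (V i)) (hdiv : ∀ x, ∑ i, pd i (V i) x = 0)
    (i : Fin 4) : ∑ l, T S i (pd l (V l)) x = 0 := by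
  unfold T
  rw [← integral_finsetSum _ fun l _ => integrableOn_ray i (continuous_pd (hV l))]
  simp [← Finset.mul_sum, hdiv]

lemma sum_pd_potential (hV : ∀ i, ContDiff ℝ 1 (V i)) (hdiv : ∀ x, ∑ i, pd i (V i) x = 0)
    (h0 : ∀ i, ∀ x : E, x 3 ≤ 0 → V i x = 0) (hS : 0 ≤ S) (hx : 2 * x 3 ≤ S) (i : Fin 4) :
    ∑ l, pd l (potential S V i l) x = V i x := by
  simp_rw [pd_potential hV, Finset.sum_sub_distrib, pd_T _ _ _ (hV _)]
  rw [sum_T_pd (hV i) (h0 i) hS hx, sum_T_eq_zero hV hdiv, sub_zero]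

lemma contDiff_testField (hV : ∀ i, ContDiff ℝ 1 (V i)) (hψ : ContDiff ℝ ∞ ψ) (i : Fin 4) :
    ContDiff ℝ 1 (testField S ψ V i) := by
  refine ((hψ.of_le (by simp)).mul (hV i)).add (ContDiff.sum fun l _ => ?_)
  exact ((contDiff_pd_top hψ l).of_le (by simp)).mul (contDiff_potential hV i l)

lemma pd_testField (hV : ∀ i, ContDiff ℝ 1 (V i)) (hψ : ContDiff ℝ ∞ ψ) (i j : Fin 4) :
    pd i (testField S ψ V j) x = ψ x * pd i (V j) x + (pd i ψ x * V j x +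
      ∑ l, (pd i (pd l ψ) x * potential S V j l x + pd l ψ x * pd i (potential S V j l) x)) := by
  have d1 : Differentiable ℝ ψ := hψ.differentiable (by simp)
  have d2 : ∀ l, Differentiable ℝ (pd l ψ) := fun l =>
    (contDiff_pd_top hψ l).differentiable (by simp)
  have d3 : Differentiable ℝ (V j) := (hV j).differentiable one_ne_zero
  have d4 : ∀ l, Differentiable ℝ (potential S V j l) := fun l =>
    (contDiff_potential hV j l).differentiable one_ne_zero
  have d5 : ∀ l, Differentiable ℝ (fun y => pd l ψ y * potential S V j l y) := fun l =>
    (d2 l).mul (d4 l)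
  have d6 : Differentiable ℝ (fun y => ψ y * V j y) := d1.mul d3
  unfold testField
  rw [pd_add (d6 x) (DifferentiableAt.fun_sum fun l _ => d5 l x),
    pd_mul (d1 x) (d3 x), pd_sum fun l _ => d5 l x]
  simp_rw [pd_mul (d2 _ x) (d4 _ x)]
  ring

lemma sum_pd_testField (hV : ∀ i, ContDiff ℝ 1 (V i)) (hψ : ContDiff ℝ ∞ ψ)
    (hdiv : ∀ x, ∑ i, pd i (V i) x = 0)
    (h0 : ∀ i, ∀ x : E, x 3 ≤ 0 → V i x = 0) (hS : 0 ≤ S)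
    (hx : 2 * x 3 ≤ S ∨ ∀ l, pd l ψ x = 0) :
    ∑ i, pd i (testField S ψ V i) x = 0 := by
  have hsym : ∀ i l, pd i (pd l ψ) x = pd l (pd i ψ) x := by
    intro i l
    have hd : Differentiable ℝ (fderiv ℝ ψ) :=
      (hψ.fderiv_right (m := ∞) le_rfl).differentiable (by simp)
    have := second_derivative_symmetric (f := ψ) (f' := fderiv ℝ ψ)
      (f'' := fderiv ℝ (fderiv ℝ ψ) x) (x := x)
      (fun y => (hψ.differentiable (by simp) y).hasFDerivAt) (hd x).hasFDerivAt (e i) (e l)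
    unfold pd
    rw [fderiv_clm_apply (hd x) (by fun_prop), fderiv_clm_apply (hd x) (by fun_prop)]
    simpa using this
  simp_rw [pd_testField hV hψ]
  rw [Finset.sum_add_distrib, ← Finset.mul_sum, hdiv, mul_zero, zero_add,
    Finset.sum_add_distrib]
  simp_rw [Finset.sum_add_distrib]
  have s1 : ∑ i, ∑ l, pd i (pd l ψ) x * potential S V i l x = 0 := by
    have h : ∑ i, ∑ l, pd i (pd l ψ) x * potential S V i l x =
        - ∑ i, ∑ l, pd i (pd l ψ) x * potential S V i l x := by
      conv_lhs => rw [Finset.sum_comm]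
      rw [← Finset.sum_neg_distrib]
      refine Finset.sum_congr rfl fun i _ => ?_
      rw [← Finset.sum_neg_distrib]
      refine Finset.sum_congr rfl fun l _ => ?_
      rw [hsym, potential_skew i l]; ring
    linarith
  rw [s1, zero_add]
  rcases hx with hx | hx
  · rw [Finset.sum_comm, ← Finset.sum_add_distrib]
    refine Finset.sum_eq_zero fun l _ => ?_
    rw [← Finset.mul_sum]
    have : ∑ i, pd i (potential S V i l) x = - V l x := by
      rw [← sum_pd_potential hV hdiv h0 hS hx l, ← Finset.sum_neg_distrib]
      refine Finset.sum_congr rfl fun i _ => ?_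
      rw [pd_potential hV, pd_potential hV]; ring
    rw [this]; ring
  · simp [hx]

lemma testField_eq_zero (h0 : ∀ i, ∀ x : E, x 3 ≤ 0 → V i x = 0) (hx : x 3 ≤ 0) (i : Fin 4) :
    testField S ψ V i x = 0 := by
  simp [testField, potential, h0 i x hx, T_eq_zero _ (h0 _) hx]

lemma tsupport_testField_subset (i : Fin 4) : tsupport (testField S ψ V i) ⊆ tsupport ψ := by
  refine closure_minimal (fun y hy => ?_) (isClosed_tsupport ψ)
  by_contra h
  refine hy ?_
  simp [testField, image_eq_zero_of_notMem_tsupport h, pd_eq_zero_of_notMem h]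

/-- The part of the gradient of the localised field due to the cutoff. -/
noncomputable def remainder (S : ℝ) (χ : E → ℝ) (V : Fin 4 → E → ℝ) (i j : Fin 4) (x : E) : ℝ :=
  6 * χ x ^ 2 * pd i χ x * V j x +
    ∑ l, ((30 * χ x * pd i χ x * pd l χ x + 6 * χ x ^ 2 * pd i (pd l χ) x) * potential S V j l x +
      6 * χ x ^ 2 * pd l χ x * pd i (potential S V j l) x)

lemma pd_pow {f : E → ℝ} (hf : DifferentiableAt ℝ f x) (n : ℕ) (i : Fin 4) :
    pd i (fun y => f y ^ n) x = n * f x ^ (n - 1) * pd i f x := by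
  have := (hf.hasFDerivAt.pow n).fderiv
  unfold pd
  erw [this]
  simp

lemma pd_testField_pow (hV : ∀ i, ContDiff ℝ 1 (V i)) (hχ : ContDiff ℝ ∞ χ) (i j : Fin 4) :
    pd i (testField S (fun y => χ y ^ 6) V j) x =
      χ x ^ 6 * pd i (V j) x + χ x ^ 3 * remainder S χ V i j x := by
  have d1 : Differentiable ℝ χ := hχ.differentiable (by simp)
  have d2 : ∀ l, Differentiable ℝ (pd l χ) := fun l =>
    (contDiff_pd_top hχ l).differentiable (by simp)
  have e1 : ∀ l, pd l (fun y => χ y ^ 6) = fun y => 6 * (χ y ^ 5 * pd l χ y) := by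
    intro l; ext y; rw [pd_pow (d1 y)]; norm_num; ring
  have e2 : ∀ l, pd i (fun y => 6 * (χ y ^ 5 * pd l χ y)) x =
      30 * χ x ^ 4 * pd i χ x * pd l χ x + 6 * χ x ^ 5 * pd i (pd l χ) x := by
    intro l
    have d3 : Differentiable ℝ (fun y => χ y ^ 5) := d1.pow 5
    have d4 : Differentiable ℝ (fun y => χ y ^ 5 * pd l χ y) := d3.mul (d2 l)
    rw [pd_const_mul (d4 x), pd_mul (d3 x) (d2 l x), pd_pow (d1 x)]
    norm_num
    ring
  rw [pd_testField hV (hχ.pow 6)]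
  simp only [e1, e2, remainder]
  rw [mul_add, Finset.mul_sum]
  congr 2
  · ring
  · exact Finset.sum_congr rfl fun l _ => by ring

lemma remainder_eq_zero (h : ∀ l, pd l χ x = 0) (h2 : ∀ i l, pd i (pd l χ) x = 0) (i j : Fin 4) :
    remainder S χ V i j x = 0 := by
  simp [remainder, h, h2]

lemma continuous_remainder (hV : ∀ i, ContDiff ℝ 1 (V i)) (hχ : ContDiff ℝ ∞ χ) (i j : Fin 4) :
    Continuous (remainder S χ V i j) := by
  have c0 := hχ.continuous
  have c1 : ∀ l, Continuous (pd l χ) := fun l => (contDiff_pd_top hχ l).continuous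
  have c2 : ∀ l, Continuous (pd i (pd l χ)) := fun l =>
    (contDiff_pd_top (contDiff_pd_top hχ l) i).continuous
  have c3 := (hV j).continuous
  have c4 : ∀ l, Continuous (potential S V j l) := fun l => (contDiff_potential hV j l).continuous
  have c5 : ∀ l, Continuous (pd i (potential S V j l)) := fun l =>
    continuous_pd (contDiff_potential hV j l)
  unfold remainder
  fun_prop

lemma remainder_sq_le {L : ℝ} (hL : 0 < L) (hx : x ≠ 0) (hχ0 : 0 ≤ χ x) (hχ1 : χ x ≤ 1)
    (hb1 : ∀ l, |pd l χ x| * ‖x‖ ≤ L) (hb2 : ∀ i l, |pd i (pd l χ) x| * ‖x‖ ^ 2 ≤ L)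
    (i j : Fin 4) :
    remainder S χ V i j x ^ 2 ≤ 9 * (36 * L ^ 2 + (30 * L ^ 2 + 6 * L) ^ 2) *
      (V j x ^ 2 / ‖x‖ ^ 2 + ∑ l, (potential S V j l x ^ 2 / ‖x‖ ^ 4 +
        χ x ^ 4 / ‖x‖ ^ 2 * pd i (potential S V j l) x ^ 2)) := by
  have hn : 0 < ‖x‖ := norm_pos_iff.2 hx
  have hs : ∀ (a : ℝ) (A B : Fin 4 → ℝ), (a + ∑ l, (A l + B l)) ^ 2 ≤
      9 * (a ^ 2 + ∑ l, (A l ^ 2 + B l ^ 2)) := by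
    intro a A B
    have h1 := sq_sum_le_card_mul_sum_sq (s := (Finset.univ : Finset (Option (Fin 4 ⊕ Fin 4))))
      (f := fun o => o.elim a (Sum.elim A B))
    simpa [Fintype.sum_option, Finset.sum_add_distrib] using h1
  unfold remainder
  refine (hs _ _ _).trans ?_
  rw [mul_assoc (9 : ℝ)]
  refine mul_le_mul_of_nonneg_left (a := (9 : ℝ)) ?_ (by norm_num)
  rw [mul_add, Finset.mul_sum]
  set K := 36 * L ^ 2 + (30 * L ^ 2 + 6 * L) ^ 2 with hK
  have hK1 : 36 * L ^ 2 ≤ K := by rw [hK]; nlinarith [sq_nonneg (30 * L ^ 2 + 6 * L)]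
  have hK2 : (30 * L ^ 2 + 6 * L) ^ 2 ≤ K := by rw [hK]; nlinarith
  have b1 : ∀ l, |pd l χ x| ≤ L / ‖x‖ := fun l => by rw [le_div_iff₀ hn]; exact hb1 l
  have b2 : ∀ i l, |pd i (pd l χ) x| ≤ L / ‖x‖ ^ 2 := fun i l => by
    rw [le_div_iff₀ (by positivity)]; exact hb2 i l
  have q1 : ∀ l, (pd l χ x) ^ 2 ≤ L ^ 2 / ‖x‖ ^ 2 := fun l => by
    rw [← div_pow, ← sq_abs]; gcongr; exact b1 l
  have t4 : χ x ^ 4 ≤ 1 := pow_le_one₀ hχ0 hχ1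
  have t2 : χ x ^ 2 ≤ 1 := pow_le_one₀ hχ0 hχ1
  gcongr ?_ + ∑ l, ?_ with l
  · calc (6 * χ x ^ 2 * pd i χ x * V j x) ^ 2 = 36 * χ x ^ 4 * pd i χ x ^ 2 * V j x ^ 2 := by ring
      _ ≤ 36 * 1 * (L ^ 2 / ‖x‖ ^ 2) * V j x ^ 2 := by gcongr; exact q1 i
      _ = 36 * L ^ 2 * (V j x ^ 2 / ‖x‖ ^ 2) := by ring
      _ ≤ _ := by gcongr
  · rw [mul_add]
    gcongr ?_ + ?_
    · have h1 : |30 * χ x * pd i χ x * pd l χ x + 6 * χ x ^ 2 * pd i (pd l χ) x| ≤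
          (30 * L ^ 2 + 6 * L) / ‖x‖ ^ 2 := by
        refine (abs_add_le _ _).trans ?_
        simp only [abs_mul, abs_pow, abs_of_nonneg hχ0]
        norm_num
        calc 30 * χ x * |pd i χ x| * |pd l χ x| + 6 * χ x ^ 2 * |pd i (pd l χ) x|
            ≤ 30 * 1 * (L / ‖x‖) * (L / ‖x‖) + 6 * 1 * (L / ‖x‖ ^ 2) := by
              gcongr
              exacts [b1 i, b1 l, b2 i l]
          _ = _ := by ring
      calc ((30 * χ x * pd i χ x * pd l χ x + 6 * χ x ^ 2 * pd i (pd l χ) x) *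
            potential S V j l x) ^ 2
          = |30 * χ x * pd i χ x * pd l χ x + 6 * χ x ^ 2 * pd i (pd l χ) x| ^ 2 *
            potential S V j l x ^ 2 := by rw [sq_abs]; ring
        _ ≤ ((30 * L ^ 2 + 6 * L) / ‖x‖ ^ 2) ^ 2 * potential S V j l x ^ 2 := by gcongr
        _ = (30 * L ^ 2 + 6 * L) ^ 2 * (potential S V j l x ^ 2 / ‖x‖ ^ 4) := by ring
        _ ≤ _ := by gcongr
    · calc (6 * χ x ^ 2 * pd l χ x * pd i (potential S V j l) x) ^ 2
          = 36 * χ x ^ 4 * pd l χ x ^ 2 * pd i (potential S V j l) x ^ 2 := by ring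
        _ ≤ 36 * χ x ^ 4 * (L ^ 2 / ‖x‖ ^ 2) * pd i (potential S V j l) x ^ 2 := by
            gcongr; exact q1 l
        _ = 36 * L ^ 2 * (χ x ^ 4 / ‖x‖ ^ 2 * pd i (potential S V j l) x ^ 2) := by ring
        _ ≤ _ := by gcongr

end TestField

section Energy

variable {a b c S : ℝ} {V : Fin 4 → E → ℝ} {χ : E → ℝ}

/-- The quantity controlling the remainder of the localisation. -/
noncomputable def cutoffError (S : ℝ) (χ : E → ℝ) (V : Fin 4 → E → ℝ) (i j : Fin 4) (x : E) : ℝ :=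
  V j x ^ 2 / ‖x‖ ^ 2 + ∑ l, (potential S V j l x ^ 2 / ‖x‖ ^ 4 +
    χ x ^ 4 / ‖x‖ ^ 2 * pd i (potential S V j l) x ^ 2)

lemma integrableOn_annulus_div (ha : 0 < a) {f : E → ℝ} (hf : Continuous f) (n : ℕ) :
    IntegrableOn (fun x => f x / ‖x‖ ^ n) (annulus a) := by
  refine ContinuousOn.integrableOn_compact (isCompact_annulus a) ?_
  exact hf.continuousOn.div (by fun_prop) fun x hx => pow_ne_zero _ (ne_zero_of_mem_annulus ha hx)

lemma integrableOn_annulus_div_mul (ha : 0 < a) {f g : E → ℝ} (hf : Continuous f)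
    (hg : Continuous g) (n : ℕ) :
    IntegrableOn (fun x => f x / ‖x‖ ^ n * g x) (annulus a) := by
  have := integrableOn_annulus_div ha (hf.mul hg) n
  refine this.congr_fun (fun x _ => ?_) (isCompact_annulus a).measurableSet
  simp only [Pi.mul_apply]
  ring

lemma integrableOn_cutoffError (ha : 0 < a) (hV : ∀ i, ContDiff ℝ 1 (V i)) (hχ : Continuous χ)
    (i j : Fin 4) : IntegrableOn (cutoffError S χ V i j) (annulus a) := by
  refine (integrableOn_annulus_div ha ((hV j).continuous.pow 2) 2).add ?_
  refine integrable_finsetSum _ fun l _ => ?_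
  have h := contDiff_potential (S := S) hV j l
  exact (integrableOn_annulus_div ha (h.continuous.pow 2) 4).add
    (integrableOn_annulus_div_mul ha (hχ.pow 4) ((continuous_pd h).pow 2) 2)

lemma cutoffError_nonneg (hχ0 : ∀ x, 0 ≤ χ x) (i j : Fin 4) (x : E) :
    0 ≤ cutoffError S χ V i j x := by
  have := hχ0 x
  unfold cutoffError
  positivity

lemma integral_cutoffError_le {I M : ℝ} (ha : 0 < a) (hc : 0 < c) (hc3 : c ≤ 1 / 3)
    (hχ : Continuous χ) (hχc : HasCompactSupport χ)
    (hχ0 : ∀ x, 0 ≤ χ x) (hχ1 : ∀ x, χ x ≤ 1) (hs : SlowlyVarying c χ)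
    (hV : ∀ i, ContDiff ℝ 1 (V i)) (h0 : ∀ i, ∀ x : E, x 3 ≤ 0 → V i x = 0)
    (hI : ∀ i j, ∫ z, χ z ^ 6 * pd i (V j) z ^ 2 ≤ I) (hM : ∀ j, mass a (V j) ≤ M) (i j : Fin 4) :
    ∫ x in annulus a, cutoffError S χ V i j x ≤
      M + 4 * (64 * (wt ^ 2 * dvol ^ 2) * M + 4 * (512 * (wt ^ 2 * dvol ^ 2) * c ^ 2 * I +
        32 * (wt ^ 2 * dvol ^ 2) / c ^ 2 * M)) := by
  have hP := fun l => contDiff_potential (S := S) hV j l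
  have hm := (isCompact_annulus a).measurableSet
  have sq2 : ∀ p q : ℝ, (p - q) ^ 2 ≤ 2 * (p ^ 2 + q ^ 2) := fun p q => by
    nlinarith [sq_nonneg (p + q)]
  have i1 : ∀ l m, IntegrableOn (fun x => T S l (V m) x ^ 2 / ‖x‖ ^ 4) (annulus a) := fun l m =>
    integrableOn_annulus_div ha ((contDiff_T S l (hV m)).continuous.pow 2) 4
  have i2 : ∀ l m, IntegrableOn (fun x => χ x ^ 4 / ‖x‖ ^ 2 * pd i (T S l (V m)) x ^ 2)
      (annulus a) := fun l m =>
    integrableOn_annulus_div_mul ha (hχ.pow 4) ((continuous_pd (contDiff_T S l (hV m))).pow 2) 2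
  have j1 : ∀ l, IntegrableOn (fun x => potential S V j l x ^ 2 / ‖x‖ ^ 4) (annulus a) := fun l =>
    integrableOn_annulus_div ha ((hP l).continuous.pow 2) 4
  have j2 : ∀ l, IntegrableOn (fun x => χ x ^ 4 / ‖x‖ ^ 2 * pd i (potential S V j l) x ^ 2)
      (annulus a) := fun l =>
    integrableOn_annulus_div_mul ha (hχ.pow 4) ((continuous_pd (hP l)).pow 2) 2
  have e1 : ∀ l, ∫ x in annulus a, potential S V j l x ^ 2 / ‖x‖ ^ 4 ≤
      64 * (wt ^ 2 * dvol ^ 2) * M := by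
    intro l
    calc ∫ x in annulus a, potential S V j l x ^ 2 / ‖x‖ ^ 4
        ≤ ∫ x in annulus a, 2 * (T S l (V j) x ^ 2 / ‖x‖ ^ 4 + T S j (V l) x ^ 2 / ‖x‖ ^ 4) := by
          refine setIntegral_mono_on (j1 l) (((i1 l j).add (i1 j l)).const_mul 2) hm fun x _ => ?_
          rw [← add_div, ← mul_div_assoc]
          gcongr
          exact sq2 _ _
      _ = 2 * ((∫ x in annulus a, T S l (V j) x ^ 2 / ‖x‖ ^ 4) +
          ∫ x in annulus a, T S j (V l) x ^ 2 / ‖x‖ ^ 4) := by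
          rw [integral_const_mul, integral_add (i1 l j) (i1 j l)]
      _ ≤ 2 * (16 * wt ^ 2 * dvol ^ 2 * M + 16 * wt ^ 2 * dvol ^ 2 * M) := by
          gcongr
          · exact (integral_T_sq_le ha (hV j) (h0 j) l).trans (by gcongr; exact hM j)
          · exact (integral_T_sq_le ha (hV l) (h0 l) j).trans (by gcongr; exact hM l)
      _ = _ := by ring
  have e2 : ∀ l, ∫ x in annulus a, χ x ^ 4 / ‖x‖ ^ 2 * pd i (potential S V j l) x ^ 2 ≤
      4 * (512 * (wt ^ 2 * dvol ^ 2) * c ^ 2 * I + 32 * (wt ^ 2 * dvol ^ 2) / c ^ 2 * M) := by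
    intro l
    have hT : ∀ l m, ∫ x in annulus a, χ x ^ 4 / ‖x‖ ^ 2 * pd i (T S l (V m)) x ^ 2 ≤
        512 * (wt ^ 2 * dvol ^ 2) * c ^ 2 * I + 32 * (wt ^ 2 * dvol ^ 2) / c ^ 2 * M := by
      intro l m
      refine (integral_pd_T_sq_le ha hc hc3 hχ hχc hχ0 hχ1 hs (hV m) (h0 m) l i).trans ?_
      calc _ ≤ 512 * wt ^ 2 * dvol ^ 2 * c ^ 2 * I + 32 * wt ^ 2 * dvol ^ 2 / c ^ 2 * M := by
            gcongr
            exacts [hI i m, hM m]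
        _ = _ := by ring
    calc ∫ x in annulus a, χ x ^ 4 / ‖x‖ ^ 2 * pd i (potential S V j l) x ^ 2
        ≤ ∫ x in annulus a, 2 * (χ x ^ 4 / ‖x‖ ^ 2 * pd i (T S l (V j)) x ^ 2 +
            χ x ^ 4 / ‖x‖ ^ 2 * pd i (T S j (V l)) x ^ 2) := by
          refine setIntegral_mono_on (j2 l) (((i2 l j).add (i2 j l)).const_mul 2) hm fun x _ => ?_
          rw [pd_potential hV, ← mul_add, mul_left_comm]
          have := hχ0 x
          gcongr
          exact sq2 _ _
      _ = 2 * ((∫ x in annulus a, χ x ^ 4 / ‖x‖ ^ 2 * pd i (T S l (V j)) x ^ 2) +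
          ∫ x in annulus a, χ x ^ 4 / ‖x‖ ^ 2 * pd i (T S j (V l)) x ^ 2) := by
          rw [integral_const_mul, integral_add (i2 l j) (i2 j l)]
      _ ≤ _ := by linarith [hT l j, hT j l]
  have e3 : ∫ x in annulus a, V j x ^ 2 / ‖x‖ ^ 2 ≤ M :=
    (integral_sq_div_le ha (hV j).continuous).trans (hM j)
  have j3 : IntegrableOn (fun x => V j x ^ 2 / ‖x‖ ^ 2) (annulus a) :=
    integrableOn_annulus_div ha ((hV j).continuous.pow 2) 2
  have j4 : ∀ l, IntegrableOn (fun x => potential S V j l x ^ 2 / ‖x‖ ^ 4 +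
      χ x ^ 4 / ‖x‖ ^ 2 * pd i (potential S V j l) x ^ 2) (annulus a) :=
    fun l => (j1 l).add (j2 l)
  unfold cutoffError
  rw [integral_add j3 (integrable_finsetSum _ fun l _ => j4 l), integral_finsetSum _ fun l _ => j4 l]
  refine add_le_add e3 ((Finset.sum_le_sum fun l _ => ?_).trans_eq
    (Finset.sum_const _ |>.trans (by rw [Finset.card_univ, Fintype.card_fin, nsmul_eq_mul]; rfl)))
  rw [integral_add (j1 l) (j2 l)]
  exact add_le_add (e1 l) (e2 l)

lemma integral_le_of_annuli {f g : E → ℝ} (hf : Integrable f)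
    (hg0 : ∀ x, 0 ≤ g x) (hga : IntegrableOn g (annulus a)) (hgb : IntegrableOn g (annulus b))
    (h0 : ∀ x ∉ annulus a ∪ annulus b, f x ≤ 0) (h1 : ∀ x ∈ annulus a ∪ annulus b, f x ≤ g x) :
    ∫ x, f x ≤ (∫ x in annulus a, g x) + ∫ x in annulus b, g x := by
  have ma := (isCompact_annulus a).measurableSet
  have mb := (isCompact_annulus b).measurableSet
  rw [← integral_indicator ma, ← integral_indicator mb, ← integral_add (hga.integrable_indicator ma)
    (hgb.integrable_indicator mb)]
  refine integral_mono hf ((hga.integrable_indicator ma).add (hgb.integrable_indicator mb))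
    fun x => ?_
  have pa := indicator_nonneg (s := annulus a) (fun x _ => hg0 x) x
  have pb := indicator_nonneg (s := annulus b) (fun x _ => hg0 x) x
  by_cases hxa : x ∈ annulus a
  · rw [indicator_of_mem hxa]
    linarith [h1 x (Or.inl hxa)]
  by_cases hxb : x ∈ annulus b
  · rw [indicator_of_mem hxb]
    linarith [h1 x (Or.inr hxb)]
  have : x ∉ annulus a ∪ annulus b := by simp [hxa, hxb]
  linarith [h0 x this]

end Energy

section Energy

variable {r R C₀ L : ℝ} {V : Fin 4 → E → ℝ}

lemma hasCompactSupport_shell (hr : 0 < r) (hR : 0 < R) : HasCompactSupport (shell r R) :=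
  HasCompactSupport.of_support_subset_isCompact (isCompact_closedBall 0 (2 * R))
    (subset_closure.trans ((tsupport_shell hr hR).trans sdiff_subset))

lemma integrable_shell_mul (hr : 0 < r) (hR : 0 < R) {g : E → ℝ} (hg : Continuous g) {n : ℕ}
    (hn : n ≠ 0) : Integrable fun x => shell r R x ^ n * g x := by
  have := (contDiff_shell r R).continuous
  refine Continuous.integrable_of_hasCompactSupport (by fun_prop) ?_
  exact HasCompactSupport.mul_right
    ((hasCompactSupport_shell hr hR).comp_left (g := fun t : ℝ => t ^ n) (by simp [hn]))

lemma norm_pos_of_mem_annuli (hr : 0 < r) (hR : 0 < R) {x : E}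
    (hx : x ∈ annulus (r / 2) ∪ annulus R) : 0 < ‖x‖ := by
  rcases hx with hx | hx
  · exact (by positivity : 0 < r / 2).trans_le (mem_annulus.1 hx).1
  · exact hR.trans_le (mem_annulus.1 hx).1

lemma transport_le (hr : 0 < r) (hR : 0 < R) (hC : 0 ≤ C₀) (hL : 0 < L)
    (hb : ∀ (x : E) (l : Fin 4), |pd l (shell r R) x| * ‖x‖ ≤ L)
    (hV : ∀ i, ContDiff ℝ 1 (V i)) (hdiv : ∀ x, ∑ i, pd i (V i) x = 0)
    (hVb : ∀ x ∈ annulus (r / 2) ∪ annulus R, ∀ i, |V i x| * ‖x‖ ≤ C₀) (j : Fin 4) :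
    ∑ i, ∫ x, shell r R x ^ 6 * (V i x * V j x * pd i (V j) x) ≤
      12 * L * C₀ * (mass (r / 2) (V j) + mass R (V j)) := by
  have hχ : ContDiff ℝ 1 (shell r R) := (contDiff_shell r R).of_le (by simp)
  have hχd : Differentiable ℝ (shell r R) := hχ.differentiable one_ne_zero
  have hχc := hχ.continuous
  have hχp := fun i => continuous_pd (i := i) hχ
  have hVd := fun i => (hV i).differentiable one_ne_zero
  have hVc := fun i => (hV i).continuous
  have hVp := fun i j => continuous_pd (i := i) (hV j)
  have hg : ∀ i, ContDiff ℝ 1 fun y => shell r R y ^ 6 * V i y := fun i => (hχ.pow 6).mul (hV i)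
  have hgc : ∀ i, HasCompactSupport fun y => shell r R y ^ 6 * V i y := fun i =>
    HasCompactSupport.mul_right ((hasCompactSupport_shell hr hR).comp_left
      (g := fun t : ℝ => t ^ 6) (by norm_num))
  have step : ∀ i, ∫ x, shell r R x ^ 6 * (V i x * V j x * pd i (V j) x) =
      ∫ x, -(1 / 2) * (V j x ^ 2 * pd i (fun y => shell r R y ^ 6 * V i y) x) := by
    intro i
    rw [integral_const_mul, integral_mul_pd isOpen_univ ((hV j).pow 2).contDiffOn (hg i) (hgc i)
      (subset_univ _), neg_mul_neg, ← integral_const_mul]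
    refine integral_congr_ae (ae_of_all _ fun x => ?_)
    simp only
    rw [pd_pow (hVd j x)]
    simp
    ring
  have hint : ∀ i, Integrable fun x =>
      -(1 / 2) * (V j x ^ 2 * pd i (fun y => shell r R y ^ 6 * V i y) x) := by
    intro i
    have h1 := continuous_pd (i := i) (hg i)
    refine (Continuous.integrable_of_hasCompactSupport (by fun_prop) ?_).const_mul _
    exact HasCompactSupport.mul_left (hasCompactSupport_pd (hgc i))
  simp_rw [step]
  rw [← integral_finsetSum _ fun i _ => hint i]
  have hpt : ∀ x, ∑ i, -(1 / 2) * (V j x ^ 2 * pd i (fun y => shell r R y ^ 6 * V i y) x) =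
      -3 * V j x ^ 2 * shell r R x ^ 5 * ∑ i, pd i (shell r R) x * V i x := by
    intro x
    have h1 : ∀ i, pd i (fun y => shell r R y ^ 6 * V i y) x =
        6 * shell r R x ^ 5 * (pd i (shell r R) x * V i x) + shell r R x ^ 6 * pd i (V i) x := by
      intro i
      have d : DifferentiableAt ℝ (fun y => shell r R y ^ 6) x := (hχd x).pow 6
      rw [pd_mul d (hVd i x), pd_pow (hχd x)]
      norm_num
      ring
    simp_rw [h1]
    rw [← Finset.mul_sum, ← Finset.mul_sum, Finset.sum_add_distrib, ← Finset.mul_sum,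
      ← Finset.mul_sum, hdiv]
    ring
  have hN : ∀ a, 0 < a → IntegrableOn (fun x => 12 * L * C₀ * (V j x ^ 2 / ‖x‖ ^ 2)) (annulus a) :=
    fun a ha => (integrableOn_annulus_div ha ((hVc j).pow 2) 2).const_mul _
  refine (integral_le_of_annuli (a := r / 2) (b := R)
    (g := fun x => 12 * L * C₀ * (V j x ^ 2 / ‖x‖ ^ 2)) (integrable_finsetSum _ fun i _ => hint i)
    (fun x => by positivity) (hN _ (by positivity)) (hN _ hR) (fun x hx => ?_)
    (fun x hx => ?_)).trans ?_
  · rw [hpt]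
    simp [pd_shell_eq_zero hr hR hx]
  · rw [hpt]
    have hx0 := norm_pos_of_mem_annuli hr hR hx
    have h1 : |∑ i, pd i (shell r R) x * V i x| ≤ 4 * (L / ‖x‖ * (C₀ / ‖x‖)) := by
      refine (Finset.abs_sum_le_sum_abs _ _).trans ((Finset.sum_le_sum fun i _ => ?_).trans_eq
        (by simp : ∑ _i : Fin 4, L / ‖x‖ * (C₀ / ‖x‖) = _))
      rw [abs_mul]
      gcongr
      · rw [le_div_iff₀ hx0]; exact hb x i
      · rw [le_div_iff₀ hx0]; exact hVb x hx i
    have h2 : shell r R x ^ 5 ≤ 1 := pow_le_one₀ (shell_nonneg _ _ _) (shell_le_one _ _ _)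
    have h3 : 0 ≤ shell r R x ^ 5 := pow_nonneg (shell_nonneg _ _ _) _
    calc -3 * V j x ^ 2 * shell r R x ^ 5 * ∑ i, pd i (shell r R) x * V i x
        ≤ |-3 * V j x ^ 2 * shell r R x ^ 5 * ∑ i, pd i (shell r R) x * V i x| := le_abs_self _
      _ = 3 * V j x ^ 2 * shell r R x ^ 5 * |∑ i, pd i (shell r R) x * V i x| := by
          rw [abs_mul, abs_mul, abs_mul, abs_of_nonneg h3, abs_of_nonneg (sq_nonneg (V j x))]
          norm_num
      _ ≤ 3 * V j x ^ 2 * 1 * (4 * (L / ‖x‖ * (C₀ / ‖x‖))) := by gcongr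
      _ = _ := by ring
  · rw [integral_const_mul, integral_const_mul, ← mul_add]
    gcongr
    · exact integral_sq_div_le (by positivity) (hVc j)
    · exact integral_sq_div_le hR (hVc j)

/-- `V` satisfies the weak steady Navier-Stokes inequality up to an error `Q`. -/
def WeakIneq (r R Q : ℝ) (V : Fin 4 → E → ℝ) : Prop :=
  ∀ w : Fin 4 → E → ℝ, (∀ i, ContDiff ℝ 1 (w i)) →
    (∀ i, tsupport (w i) ⊆ closedBall 0 (2 * R) \ ball 0 (r / 2)) →
    (∀ x, ∑ i, pd i (w i) x = 0) → (∀ i, ∀ x : E, x 3 ≤ 0 → w i x = 0) →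
    ∑ i, ∑ j, ∫ x, (pd i (V j) x - V i x * V j x) * pd i (w j) x ≤
      Q + 1 / 4 * ∑ i, ∑ j, ∫ x, pd i (w j) x ^ 2

lemma pointwise_energy {s D v y : ℝ} (h0 : 0 ≤ s) (h1 : s ≤ 1) :
    3 / 8 * (s ^ 6 * D ^ 2) ≤ (D - v) * (s ^ 6 * D + s ^ 3 * y) -
      1 / 4 * (s ^ 6 * D + s ^ 3 * y) ^ 2 + s ^ 6 * (v * D) + (5 / 2 * y ^ 2 + |v * y|) := by
  have h3 : s ^ 3 ≤ 1 := pow_le_one₀ h0 h1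
  have h6 : s ^ 6 ≤ 1 := pow_le_one₀ h0 h1
  have h30 : 0 ≤ s ^ 3 := pow_nonneg h0 _
  have e : s ^ 6 = s ^ 3 * s ^ 3 := by ring
  have a1 : (s ^ 6 * D + s ^ 3 * y) ^ 2 ≤ 2 * (s ^ 6 * D ^ 2) + 2 * y ^ 2 := by
    have b1 : (s ^ 6 * D) ^ 2 ≤ s ^ 6 * D ^ 2 := by
      calc (s ^ 6 * D) ^ 2 = s ^ 6 * (s ^ 6 * D ^ 2) := by ring
        _ ≤ 1 * (s ^ 6 * D ^ 2) := by gcongr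
        _ = _ := one_mul _
    have b2 : (s ^ 3 * y) ^ 2 ≤ y ^ 2 := by
      calc (s ^ 3 * y) ^ 2 = s ^ 6 * y ^ 2 := by ring
        _ ≤ 1 * y ^ 2 := by gcongr
        _ = _ := one_mul _
    nlinarith [sq_nonneg (s ^ 6 * D - s ^ 3 * y)]
  have a2 : -(s ^ 3 * D * y) ≤ 1 / 8 * (s ^ 6 * D ^ 2) + 2 * y ^ 2 := by
    rw [e]
    nlinarith [sq_nonneg (s ^ 3 * D + 4 * y)]
  have a3 : s ^ 3 * (v * y) ≤ |v * y| := by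
    calc s ^ 3 * (v * y) ≤ s ^ 3 * |v * y| := by gcongr; exact le_abs_self _
      _ ≤ 1 * |v * y| := by gcongr
      _ = _ := one_mul _
  linarith

end Energy

section Energy

variable {r R C₀ L S : ℝ} {V : Fin 4 → E → ℝ}

lemma remainder_integral_le (hr : 0 < r) (hR : 0 < R) (hL : 0 < L)
    (hb1 : ∀ (x : E) (l : Fin 4), |pd l (shell r R) x| * ‖x‖ ≤ L)
    (hb2 : ∀ (x : E) (i l : Fin 4), |pd i (pd l (shell r R)) x| * ‖x‖ ^ 2 ≤ L)
    (hV : ∀ i, ContDiff ℝ 1 (V i))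
    (hVb : ∀ x ∈ annulus (r / 2) ∪ annulus R, ∀ i, |V i x| * ‖x‖ ≤ C₀) (i j : Fin 4) :
    ∫ x, (5 / 2 * remainder S (shell r R) V i j x ^ 2 +
        |V i x * V j x * remainder S (shell r R) V i j x|) ≤
      (27 * (36 * L ^ 2 + (30 * L ^ 2 + 6 * L) ^ 2) + C₀ ^ 2) *
        ((∫ x in annulus (r / 2), cutoffError S (shell r R) V i j x) +
          ∫ x in annulus R, cutoffError S (shell r R) V i j x) := by
  have hχ := contDiff_shell r R
  have hχc := hχ.continuous
  have hVc := fun i => (hV i).continuous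
  have hrem := continuous_remainder (S := S) hV hχ i j
  have hzero : ∀ x ∉ annulus (r / 2) ∪ annulus R, remainder S (shell r R) V i j x = 0 :=
    fun x hx => remainder_eq_zero (fun l => pd_shell_eq_zero hr hR hx l)
      (fun i l => pd_pd_shell_eq_zero hr hR hx i l) i j
  have hcs : HasCompactSupport (remainder S (shell r R) V i j) := by
    refine HasCompactSupport.intro ((isCompact_annulus (r / 2)).union (isCompact_annulus R)) hzero
  have hcs2 : HasCompactSupport fun x => 5 / 2 * remainder S (shell r R) V i j x ^ 2 +
        |V i x * V j x * remainder S (shell r R) V i j x| := by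
    refine HasCompactSupport.intro ((isCompact_annulus (r / 2)).union (isCompact_annulus R))
      fun x hx => ?_
    simp [hzero x hx]
  have hE := fun a ha => integrableOn_cutoffError (S := S) (a := a) ha hV hχc i j
  have hE0 := fun x => cutoffError_nonneg (S := S) (V := V) (shell_nonneg r R) i j x
  rw [mul_add, ← integral_const_mul, ← integral_const_mul]
  refine integral_le_of_annuli
    (Continuous.integrable_of_hasCompactSupport (by fun_prop) hcs2)
    (fun x => mul_nonneg (by positivity) (hE0 x)) ((hE _ (by positivity)).const_mul _)
    ((hE _ hR).const_mul _) (fun x hx => ?_) (fun x hx => ?_)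
  · simp [hzero x hx]
  · have hx0 := norm_pos_of_mem_annuli hr hR hx
    have h1 := remainder_sq_le (S := S) (V := V) hL (norm_pos_iff.1 hx0) (shell_nonneg r R x)
      (shell_le_one r R x) (hb1 x) (hb2 x) i j
    change _ ≤ _ * cutoffError S (shell r R) V i j x at h1
    have h2 : (V i x * V j x) ^ 2 ≤ C₀ ^ 2 * cutoffError S (shell r R) V i j x := by
      have h3 : V i x ^ 2 ≤ C₀ ^ 2 / ‖x‖ ^ 2 := by
        rw [← div_pow, ← sq_abs]
        gcongr
        rw [le_div_iff₀ hx0]; exact hVb x hx i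
      have h4 : V j x ^ 2 / ‖x‖ ^ 2 ≤ cutoffError S (shell r R) V i j x := by
        unfold cutoffError
        have := shell_nonneg r R x
        refine le_add_of_nonneg_right (Finset.sum_nonneg fun l _ => ?_)
        positivity
      calc (V i x * V j x) ^ 2 = V i x ^ 2 * V j x ^ 2 := by ring
        _ ≤ C₀ ^ 2 / ‖x‖ ^ 2 * V j x ^ 2 := by gcongr
        _ = C₀ ^ 2 * (V j x ^ 2 / ‖x‖ ^ 2) := by ring
        _ ≤ _ := by gcongr
    have h5 : |V i x * V j x * remainder S (shell r R) V i j x| ≤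
        1 / 2 * (V i x * V j x) ^ 2 + 1 / 2 * remainder S (shell r R) V i j x ^ 2 := by
      rw [abs_le]
      constructor <;>
      nlinarith [sq_nonneg (V i x * V j x + remainder S (shell r R) V i j x),
        sq_nonneg (V i x * V j x - remainder S (shell r R) V i j x)]
    have h6 : 0 ≤ (V i x * V j x) ^ 2 := sq_nonneg _
    linarith

/-- The localised energy inequality. -/
theorem exists_energy_const (C₀ : ℝ) (hC : 0 ≤ C₀) : ∃ K : ℝ, 0 < K ∧ ∀ (r R Q : ℝ), 0 < r → 0 < R →
    ∀ V : Fin 4 → E → ℝ, (∀ i, ContDiff ℝ 1 (V i)) → (∀ x, ∑ i, pd i (V i) x = 0) →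
    (∀ i, ∀ x : E, x 3 ≤ 0 → V i x = 0) →
    (∀ x ∈ annulus (r / 2) ∪ annulus R, ∀ i, |V i x| * ‖x‖ ≤ C₀) → WeakIneq r R Q V →
    ∑ i, ∑ j, ∫ x, shell r R x ^ 6 * pd i (V j) x ^ 2 ≤
      4 * Q + K * ∑ j, (mass (r / 2) (V j) + mass R (V j)) := by
  obtain ⟨L, hL, hb⟩ := exists_shell_bound
  set k : ℝ := wt ^ 2 * dvol ^ 2 with hk
  have hk0 : 0 ≤ k := by positivity
  set K₁ : ℝ := 27 * (36 * L ^ 2 + (30 * L ^ 2 + 6 * L) ^ 2) + C₀ ^ 2 with hK₁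
  have hK₁0 : 0 ≤ K₁ := by positivity
  set β : ℝ := 32 * K₁ * (4 * (4 * (512 * k))) with hβ
  have hβ0 : 0 ≤ β := by positivity
  obtain ⟨c, hc, hc3, hcL, hcβ⟩ : ∃ c : ℝ, 0 < c ∧ c ≤ 1 / 3 ∧ 24 * L * c ≤ 1 ∧
      β * c ^ 2 ≤ 1 / 8 := by
    refine ⟨min (1 / 3) (min (1 / (24 * L)) (1 / (8 * (β + 1)))), by positivity, min_le_left _ _,
      ?_, ?_⟩
    · calc 24 * L * _ ≤ 24 * L * (1 / (24 * L)) := by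
            gcongr; exact (min_le_right _ _).trans (min_le_left _ _)
        _ = 1 := by field_simp
    · set c := min (1 / 3) (min (1 / (24 * L)) (1 / (8 * (β + 1))))
      have h1 : c ≤ 1 / 3 := min_le_left _ _
      have h2 : c ≤ 1 / (8 * (β + 1)) := (min_le_right _ _).trans (min_le_right _ _)
      have h0 : 0 < c := by positivity
      rw [le_div_iff₀ (by positivity)] at h2
      nlinarith [mul_nonneg hβ0 h0.le]
  set γ : ℝ := K₁ * (1 + 4 * (64 * k + 4 * (32 * k / c ^ 2))) with hγ
  have hγ0 : 0 ≤ γ := by positivity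
  refine ⟨4 * (12 * L * C₀ + 16 * γ) + 1, by positivity,
    fun r R Q hr hR V hV hdiv h0 hVb hweak => ?_⟩
  have hχ := contDiff_shell r R
  have hχc := hχ.continuous
  have hsv : SlowlyVarying c (shell r R) :=
    slowlyVarying_of_pd_bound (hχ.differentiable (by simp)) (shell_nonneg r R) (shell_le_one r R)
      hL (fun x i => (hb r R hr hR x i i).1) hc hc3 hcL
  have hb1 : ∀ (x : E) (l : Fin 4), |pd l (shell r R) x| * ‖x‖ ≤ L :=
    fun x l => (hb r R hr hR x l l).1
  have hb2 : ∀ (x : E) (i l : Fin 4), |pd i (pd l (shell r R)) x| * ‖x‖ ^ 2 ≤ L :=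
    fun x i l => (hb r R hr hR x i l).2
  set S : ℝ := 4 * R with hS
  set w := testField S (fun y => shell r R y ^ 6) V with hw
  have hψ : ContDiff ℝ ∞ (fun y => shell r R y ^ 6) := hχ.pow 6
  have hwC : ∀ i, ContDiff ℝ 1 (w i) := contDiff_testField hV hψ
  have htsψ : tsupport (fun y => shell r R y ^ 6) ⊆ closedBall 0 (2 * R) \ ball 0 (r / 2) :=
    (closure_mono fun x (hx : shell r R x ^ 6 ≠ 0) (hx0 : shell r R x = 0) =>
      hx (by simp [hx0])).trans (tsupport_shell hr hR)
  have hwt : ∀ i, tsupport (w i) ⊆ closedBall 0 (2 * R) \ ball 0 (r / 2) := fun i =>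
    (tsupport_testField_subset i).trans htsψ
  have hwd : ∀ x, ∑ i, pd i (w i) x = 0 := by
    intro x
    refine sum_pd_testField hV hψ hdiv h0 (by positivity) ?_
    by_cases hx : x ∈ tsupport (fun y => shell r R y ^ 6)
    · left
      have h1 := (htsψ hx).1
      rw [mem_closedBall_zero_iff] at h1
      have h2 := (le_abs_self _).trans (abs_coord_le x 3)
      rw [hS]
      linarith
    · exact Or.inr fun l => pd_eq_zero_of_notMem hx
  have hmain := hweak w hwC hwt hwd fun i x hx => testField_eq_zero h0 hx i
  have hwp : ∀ i j x, pd i (w j) x = shell r R x ^ 6 * pd i (V j) x +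
      shell r R x ^ 3 * remainder S (shell r R) V i j x := fun i j x => pd_testField_pow hV hχ i j
  have hVc := fun i => (hV i).continuous
  have hVp := fun i j => continuous_pd (i := i) (hV j)
  have hwp' := fun i j => continuous_pd (i := i) (hwC j)
  have hrem := fun i j => continuous_remainder (S := S) hV hχ i j
  have hwcs : ∀ i, HasCompactSupport (w i) := fun i =>
    HasCompactSupport.of_support_subset_isCompact (isCompact_closedBall 0 (2 * R))
    (subset_closure.trans ((hwt i).trans sdiff_subset))
  have n1 : ∀ i j, Integrable fun x => shell r R x ^ 6 * pd i (V j) x ^ 2 := fun i j =>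
    integrable_shell_mul hr hR ((hVp i j).pow 2) (by norm_num)
  have n2 : ∀ i j, Integrable fun x => (pd i (V j) x - V i x * V j x) * pd i (w j) x := fun i j => by
    have := hVp i j
    have := hwp' i j
    exact Continuous.integrable_of_hasCompactSupport (by fun_prop)
      (HasCompactSupport.mul_left (hasCompactSupport_pd (hwcs j)))
  have n3 : ∀ i j, Integrable fun x => pd i (w j) x ^ 2 := fun i j =>
    Continuous.integrable_of_hasCompactSupport ((hwp' i j).pow 2)
      ((hasCompactSupport_pd (hwcs j)).comp_left (g := fun t : ℝ => t ^ 2) (by norm_num))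
  have n4 : ∀ i j, Integrable fun x => shell r R x ^ 6 * (V i x * V j x * pd i (V j) x) :=
    fun i j => integrable_shell_mul hr hR (((hVc i).mul (hVc j)).mul (hVp i j)) (by norm_num)
  have n5 : ∀ i j, Integrable fun x => 5 / 2 * remainder S (shell r R) V i j x ^ 2 +
        |V i x * V j x * remainder S (shell r R) V i j x| := by
    intro i j
    have := hrem i j
    refine Continuous.integrable_of_hasCompactSupport (by fun_prop) ?_
    refine HasCompactSupport.intro ((isCompact_annulus (r / 2)).union (isCompact_annulus R))
      fun x hx => ?_
    simp [remainder_eq_zero (fun l => pd_shell_eq_zero hr hR hx l)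
      (fun i l => pd_pd_shell_eq_zero hr hR hx i l) i j]
  have key : ∀ i j, 3 / 8 * ∫ x, shell r R x ^ 6 * pd i (V j) x ^ 2 ≤
      (∫ x, (pd i (V j) x - V i x * V j x) * pd i (w j) x) - 1 / 4 * (∫ x, pd i (w j) x ^ 2) +
      (∫ x, shell r R x ^ 6 * (V i x * V j x * pd i (V j) x)) +
      ∫ x, (5 / 2 * remainder S (shell r R) V i j x ^ 2 +
        |V i x * V j x * remainder S (shell r R) V i j x|) := by
    intro i j
    have m1 : Integrable fun x => (pd i (V j) x - V i x * V j x) * pd i (w j) x -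
        1 / 4 * pd i (w j) x ^ 2 := (n2 i j).sub ((n3 i j).const_mul _)
    have m2 : Integrable fun x => (pd i (V j) x - V i x * V j x) * pd i (w j) x -
        1 / 4 * pd i (w j) x ^ 2 + shell r R x ^ 6 * (V i x * V j x * pd i (V j) x) :=
      m1.add (n4 i j)
    rw [← integral_const_mul, ← integral_const_mul, ← integral_sub (n2 i j) ((n3 i j).const_mul _),
      ← integral_add m1 (n4 i j), ← integral_add m2 (n5 i j)]
    refine integral_mono ((n1 i j).const_mul _) (m2.add (n5 i j)) fun x => ?_
    simp only
    rw [hwp]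
    exact pointwise_energy (shell_nonneg r R x) (shell_le_one r R x)
  set I := ∑ i, ∑ j, ∫ x, shell r R x ^ 6 * pd i (V j) x ^ 2 with hIdef
  have hI0 : ∀ i j, 0 ≤ ∫ x, shell r R x ^ 6 * pd i (V j) x ^ 2 := fun i j =>
    integral_nonneg fun x => mul_nonneg (pow_nonneg (shell_nonneg r R x) _) (sq_nonneg _)
  have hI : ∀ i j, ∫ x, shell r R x ^ 6 * pd i (V j) x ^ 2 ≤ I := fun i j =>
    (Finset.single_le_sum (f := fun j => ∫ x, shell r R x ^ 6 * pd i (V j) x ^ 2)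
      (fun j _ => hI0 i j) (Finset.mem_univ j)).trans
    (Finset.single_le_sum (f := fun i => ∑ j, ∫ x, shell r R x ^ 6 * pd i (V j) x ^ 2)
      (fun i _ => Finset.sum_nonneg fun j _ => hI0 i j) (Finset.mem_univ i))
  set M := ∑ j, (mass (r / 2) (V j) + mass R (V j)) with hM
  have hM1 : ∀ j, mass (r / 2) (V j) + mass R (V j) ≤ M := fun j =>
    Finset.single_le_sum (f := fun j => mass (r / 2) (V j) + mass R (V j))
      (fun j _ => add_nonneg (mass_nonneg _ _) (mass_nonneg _ _)) (Finset.mem_univ j)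
  have t1 : ∑ i, ∑ j, ∫ x, shell r R x ^ 6 * (V i x * V j x * pd i (V j) x) ≤
      12 * L * C₀ * M := by
    rw [Finset.sum_comm, hM, Finset.mul_sum]
    exact Finset.sum_le_sum fun j _ => transport_le hr hR hC hL hb1 hV hdiv hVb j
  have t2 : ∀ i j, ∫ x, (5 / 2 * remainder S (shell r R) V i j x ^ 2 +
        |V i x * V j x * remainder S (shell r R) V i j x|) ≤ γ * M + β / 16 * c ^ 2 * I := by
    intro i j
    refine (remainder_integral_le hr hR hL hb1 hb2 hV hVb i j).trans ?_
    have u1 := integral_cutoffError_le (a := r / 2) (S := S) (M := ∑ j, mass (r / 2) (V j))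
      (by positivity) hc hc3 hχc (hasCompactSupport_shell hr hR) (shell_nonneg r R)
      (shell_le_one r R) hsv hV h0 hI (fun j =>
        Finset.single_le_sum (f := fun j => mass (r / 2) (V j)) (fun j _ => mass_nonneg _ _)
          (Finset.mem_univ j)) i j
    have u2 := integral_cutoffError_le (a := R) (S := S) (M := ∑ j, mass R (V j))
      hR hc hc3 hχc (hasCompactSupport_shell hr hR) (shell_nonneg r R)
      (shell_le_one r R) hsv hV h0 hI (fun j =>
        Finset.single_le_sum (f := fun j => mass R (V j)) (fun j _ => mass_nonneg _ _)
          (Finset.mem_univ j)) i j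
    refine (mul_le_mul_of_nonneg_left (add_le_add u1 u2) hK₁0).trans (le_of_eq ?_)
    rw [hM, Finset.sum_add_distrib, hγ, hβ]
    ring
  have t3 : 3 / 8 * I ≤ Q + 12 * L * C₀ * M + 16 * (γ * M + β / 16 * c ^ 2 * I) := by
    have h1 : 3 / 8 * I ≤ ∑ i, ∑ j,
        ((∫ x, (pd i (V j) x - V i x * V j x) * pd i (w j) x) - 1 / 4 * (∫ x, pd i (w j) x ^ 2) +
        (∫ x, shell r R x ^ 6 * (V i x * V j x * pd i (V j) x)) +
        (γ * M + β / 16 * c ^ 2 * I)) := by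
      rw [hIdef, Finset.mul_sum]
      refine Finset.sum_le_sum fun i _ => ?_
      rw [Finset.mul_sum]
      exact Finset.sum_le_sum fun j _ => (key i j).trans (by gcongr; exact t2 i j)
    simp only [Finset.sum_add_distrib, Finset.sum_sub_distrib, Finset.sum_const,
      Finset.card_univ, Fintype.card_fin, nsmul_eq_mul, ← Finset.mul_sum] at h1
    push_cast at h1
    linarith
  have hIn : 0 ≤ I := Finset.sum_nonneg fun i _ => Finset.sum_nonneg fun j _ => hI0 i j
  have hMn : 0 ≤ M := Finset.sum_nonneg fun j _ => add_nonneg (mass_nonneg _ _) (mass_nonneg _ _)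
  have t4 : β * c ^ 2 * I ≤ 1 / 8 * I := by gcongr
  linarith

end Energy

section Piola

/-- A smooth function vanishing on the negative half line and equal to the identity on `[1, ∞)`. -/
noncomputable def ramp (t : ℝ) : ℝ := t * Real.smoothTransition t

lemma contDiff_ramp : ContDiff ℝ ∞ ramp := contDiff_id.mul Real.smoothTransition.contDiff

lemma ramp_of_nonpos {t : ℝ} (ht : t ≤ 0) : ramp t = 0 := by
  simp [ramp, Real.smoothTransition.zero_of_nonpos ht]

lemma ramp_of_one_le {t : ℝ} (ht : 1 ≤ t) : ramp t = t := by
  simp [ramp, Real.smoothTransition.one_of_one_le ht]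

lemma ramp_nonneg (t : ℝ) : 0 ≤ ramp t := by
  rcases le_total t 0 with h | h
  · rw [ramp_of_nonpos h]
  · exact mul_nonneg h (Real.smoothTransition.nonneg t)

lemma ramp_le {t : ℝ} (ht : 0 ≤ t) : ramp t ≤ t :=
  mul_le_of_le_one_right ht (Real.smoothTransition.le_one t)

lemma contDiff_deriv_ramp : ContDiff ℝ ∞ (deriv ramp) :=
  ContDiff.iterate_deriv 1 contDiff_ramp

lemma continuous_deriv_deriv_ramp : Continuous (deriv (deriv ramp)) :=
  (ContDiff.iterate_deriv 1 contDiff_deriv_ramp).continuous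

lemma deriv_ramp_of_neg {t : ℝ} (ht : t < 0) : deriv ramp t = 0 := by
  have : ramp =ᶠ[𝓝 t] fun _ => 0 := by
    filter_upwards [Iio_mem_nhds ht] with s hs using ramp_of_nonpos (le_of_lt hs)
  rw [this.deriv_eq]; simp

lemma deriv_ramp_of_one_lt {t : ℝ} (ht : 1 < t) : deriv ramp t = 1 := by
  have : ramp =ᶠ[𝓝 t] fun s => s := by
    filter_upwards [Ioi_mem_nhds ht] with s hs using ramp_of_one_le (le_of_lt hs)
  rw [this.deriv_eq]; simp

lemma exists_ramp_bound : ∃ c : ℝ, 1 ≤ c ∧ ∀ t ≤ (1 : ℝ), |deriv ramp t| ≤ c ∧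
    |deriv (deriv ramp) t| ≤ c := by
  obtain ⟨c₁, h₁⟩ := (isCompact_Icc (a := (0 : ℝ)) (b := 1)).exists_bound_of_continuousOn
    contDiff_deriv_ramp.continuous.continuousOn
  obtain ⟨c₂, h₂⟩ := (isCompact_Icc (a := (0 : ℝ)) (b := 1)).exists_bound_of_continuousOn
    continuous_deriv_deriv_ramp.continuousOn
  refine ⟨max 1 (max c₁ c₂), le_max_left _ _, fun t ht => ?_⟩
  rcases le_or_gt 0 t with h0 | h0
  · exact ⟨(h₁ t ⟨h0, ht⟩).trans ((le_max_left _ _).trans (le_max_right _ _)),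
      (h₂ t ⟨h0, ht⟩).trans ((le_max_right _ _).trans (le_max_right _ _))⟩
  · have hd : deriv ramp =ᶠ[𝓝 t] fun _ => 0 := by
      filter_upwards [Iio_mem_nhds h0] with s hs using deriv_ramp_of_neg hs
    have : (0 : ℝ) ≤ max 1 (max c₁ c₂) := zero_le_one.trans (le_max_left _ _)
    simp [hd.deriv_eq, deriv_ramp_of_neg h0, this]

/-- The map compressing the strip of width `κ` to the boundary. -/
noncomputable def squeeze (κ : ℝ) (x : E) : E := x + (κ * ramp (x 3 / κ) - x 3) • e 3

variable {κ : ℝ} {x : E}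

lemma squeeze_three (κ : ℝ) (x : E) : squeeze κ x 3 = κ * ramp (x 3 / κ) := by
  simp [squeeze]

lemma squeeze_of_le (hκ : 0 < κ) (hx : κ ≤ x 3) : squeeze κ x = x := by
  rw [squeeze, ramp_of_one_le ((one_le_div hκ).2 hx)]
  field_simp
  simp

lemma contDiff_coord (i : Fin 4) : ContDiff ℝ ∞ fun x : E => x i :=
  (EuclideanSpace.proj (𝕜 := ℝ) i).contDiff

lemma contDiff_squeeze (κ : ℝ) : ContDiff ℝ ∞ (squeeze κ) := by
  have h := contDiff_ramp.comp ((contDiff_coord 3).div_const κ)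
  exact contDiff_id.add (((contDiff_const.mul h).sub (contDiff_coord 3)).smul contDiff_const)

lemma hasFDerivAt_squeeze (hκ : 0 < κ) (x : E) : HasFDerivAt (squeeze κ)
    (ContinuousLinearMap.id ℝ E + ((deriv ramp (x 3 / κ) - 1) •
      (EuclideanSpace.proj (𝕜 := ℝ) (3 : Fin 4))).smulRight (e 3)) x := by
  have h3 : HasFDerivAt (fun x : E => x 3) (EuclideanSpace.proj (𝕜 := ℝ) (3 : Fin 4)) x :=
    (EuclideanSpace.proj (𝕜 := ℝ) (3 : Fin 4)).hasFDerivAt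
  have hr : HasDerivAt ramp (deriv ramp (x 3 / κ)) (x 3 / κ) :=
    (contDiff_ramp.differentiable (by simp) _).hasDerivAt
  have h4 : HasDerivAt (fun t : ℝ => κ * ramp (t / κ) - t) (deriv ramp (x 3 / κ) - 1) (x 3) := by
    have h5 : HasDerivAt (fun t : ℝ => t / κ) (1 / κ) (x 3) := (hasDerivAt_id _).div_const κ
    have h6 := ((hr.comp (x 3) h5).const_mul κ).sub (hasDerivAt_id (x 3))
    refine h6.congr_deriv ?_
    field_simp
  have h7 := (h4.comp_hasFDerivAt x h3).smul_const (e 3)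
  exact (hasFDerivAt_id x).add h7

lemma pd_comp_squeeze (hκ : 0 < κ) {f : E → ℝ} (hf : DifferentiableAt ℝ f (squeeze κ x))
    (i : Fin 4) : pd i (fun y => f (squeeze κ y)) x =
      (if i = 3 then deriv ramp (x 3 / κ) else 1) * pd i f (squeeze κ x) := by
  have h := (hf.hasFDerivAt.comp x (hasFDerivAt_squeeze hκ x)).fderiv
  unfold pd
  change fderiv ℝ (f ∘ squeeze κ) x (e i) = _
  rw [h]
  by_cases hi : i = 3
  · subst hi
    simp
    ring
  · have : (3 : Fin 4) ≠ i := fun h => hi h.symm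
    simp [hi, this]

/-- The Piola factor of the `j`-th component. -/
noncomputable def piolaFactor (κ : ℝ) (j : Fin 4) (x : E) : ℝ :=
  if j = 3 then 1 else deriv ramp (x 3 / κ)

lemma contDiff_piolaFactor (κ : ℝ) (j : Fin 4) : ContDiff ℝ ∞ (piolaFactor κ j) := by
  unfold piolaFactor
  by_cases hj : j = 3
  · simp only [hj, if_true]; exact contDiff_const
  · simp only [hj, if_false]
    exact contDiff_deriv_ramp.comp ((contDiff_coord 3).div_const κ)

lemma pd_piolaFactor (κ : ℝ) (i j : Fin 4) : pd i (piolaFactor κ j) x =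
    if j ≠ 3 ∧ i = 3 then κ⁻¹ * deriv (deriv ramp) (x 3 / κ) else 0 := by
  by_cases hj : j = 3
  · subst hj
    have : piolaFactor κ 3 = fun _ => 1 := by ext; simp [piolaFactor]
    rw [this, pd_const]
    simp
  · have h3 : HasFDerivAt (fun x : E => x 3) (EuclideanSpace.proj (𝕜 := ℝ) (3 : Fin 4)) x :=
      (EuclideanSpace.proj (𝕜 := ℝ) (3 : Fin 4)).hasFDerivAt
    have hr : HasDerivAt (deriv ramp) (deriv (deriv ramp) (x 3 / κ)) (x 3 / κ) :=
      (contDiff_deriv_ramp.differentiable (by simp) _).hasDerivAt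
    have h5 : HasDerivAt (fun t : ℝ => t / κ) (1 / κ) (x 3) := (hasDerivAt_id _).div_const κ
    have h6 := ((hr.comp (x 3) h5).comp_hasFDerivAt x h3).fderiv
    have : piolaFactor κ j = (deriv ramp ∘ fun t => t / κ) ∘ fun x : E => x 3 := by
      ext; simp [piolaFactor, hj]
    unfold pd
    rw [this, h6]
    by_cases hi : i = 3
    · subst hi; simp [hj]; ring
    · have : (3 : Fin 4) ≠ i := fun h => hi h.symm
      simp [hi, this]

/-- Piola transform of a field under `squeeze κ`. -/
noncomputable def piola (κ : ℝ) (U : Fin 4 → E → ℝ) (j : Fin 4) (x : E) : ℝ :=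
  piolaFactor κ j x * U j (squeeze κ x)

variable {U : Fin 4 → E → ℝ} {τ : ℝ}

lemma squeeze_mem (hκ : 0 < κ) (x : E) : 0 ≤ squeeze κ x 3 := by
  rw [squeeze_three]
  exact mul_nonneg hκ.le (ramp_nonneg _)

lemma isOpen_above (τ : ℝ) : IsOpen {x : E | τ < x 3} :=
  isOpen_lt continuous_const (contDiff_coord 3).continuous

lemma differentiableAt_above {f : E → ℝ} (hf : ContDiffOn ℝ 1 f {x | τ < x 3}) (hx : τ < x 3) :
    DifferentiableAt ℝ f x :=
  (hf.differentiableOn one_ne_zero x hx).differentiableAt ((isOpen_above τ).mem_nhds hx)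

lemma contDiff_piola (hκ : 0 < κ) (hτ : τ < 0) (hU : ∀ j, ContDiffOn ℝ 1 (U j) {x | τ < x 3})
    (j : Fin 4) : ContDiff ℝ 1 (piola κ U j) := by
  refine ((contDiff_piolaFactor κ j).of_le (by simp)).mul ?_
  have := (hU j).comp (g := U j) (f := squeeze κ) (s := univ)
    ((contDiff_squeeze κ).of_le (by simp)).contDiffOn
    (fun x _ => hτ.trans_le (squeeze_mem hκ x))
  exact contDiffOn_univ.1 this

lemma pd_piola (hκ : 0 < κ) (hτ : τ < 0) (hU : ∀ j, ContDiffOn ℝ 1 (U j) {x | τ < x 3})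
    (i j : Fin 4) : pd i (piola κ U j) x = pd i (piolaFactor κ j) x * U j (squeeze κ x) +
      piolaFactor κ j x * ((if i = 3 then deriv ramp (x 3 / κ) else 1) *
        pd i (U j) (squeeze κ x)) := by
  have hd : DifferentiableAt ℝ (U j) (squeeze κ x) :=
    differentiableAt_above (hU j) (hτ.trans_le (squeeze_mem hκ x))
  have hd2 : DifferentiableAt ℝ (fun y => U j (squeeze κ y)) x :=
    hd.comp x ((contDiff_squeeze κ).differentiable (by simp) x)
  unfold piola
  rw [pd_mul ((contDiff_piolaFactor κ j).differentiable (by simp) x) hd2, pd_comp_squeeze hκ hd]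

lemma sum_pd_piola (hκ : 0 < κ) (hτ : τ < 0) (hU : ∀ j, ContDiffOn ℝ 1 (U j) {x | τ < x 3})
    (hdiv : ∀ x : E, τ < x 3 → ∑ i, pd i (U i) x = 0) (x : E) :
    ∑ i, pd i (piola κ U i) x = 0 := by
  have h : ∀ i, pd i (piola κ U i) x = deriv ramp (x 3 / κ) * pd i (U i) (squeeze κ x) := by
    intro i
    rw [pd_piola hκ hτ hU, pd_piolaFactor]
    by_cases hi : i = 3 <;> simp [hi, piolaFactor]
  simp_rw [h]
  rw [← Finset.mul_sum, hdiv _ (hτ.trans_le (squeeze_mem hκ x)), mul_zero]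

lemma piola_eq_zero (hκ : 0 < κ) (hU0 : ∀ j, ∀ x : E, x 3 = 0 → U j x = 0) (hx : x 3 ≤ 0)
    (j : Fin 4) : piola κ U j x = 0 := by
  rw [piola, hU0, mul_zero]
  rw [squeeze_three, ramp_of_nonpos (div_nonpos_of_nonpos_of_nonneg hx hκ.le), mul_zero]

lemma piola_eq_self (hκ : 0 < κ) (hx : κ < x 3) (j : Fin 4) : piola κ U j x = U j x := by
  rw [piola, squeeze_of_le hκ hx.le, piolaFactor, deriv_ramp_of_one_lt ((one_lt_div hκ).2 hx)]
  simp

lemma exists_piola (hτ : τ < 0) (hU : ∀ j, ContDiffOn ℝ 1 (U j) {x | τ < x 3})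
    (hdiv : ∀ x : E, τ < x 3 → ∑ i, pd i (U i) x = 0)
    (hU0 : ∀ j, ∀ x : E, x 3 = 0 → U j x = 0) (P : ℝ) :
    ∃ B : ℝ, 0 < B ∧ ∀ κ : ℝ, 0 < κ → κ ≤ 1 → ∃ V : Fin 4 → E → ℝ,
      (∀ j, ContDiff ℝ 1 (V j)) ∧ (∀ x, ∑ i, pd i (V i) x = 0) ∧
      (∀ j, ∀ x : E, x 3 ≤ 0 → V j x = 0) ∧ (∀ j, ∀ x : E, κ < x 3 → V j x = U j x) ∧
      (∀ j, ∀ x : E, ‖x‖ ≤ P → x 3 ≤ κ → |V j x| ≤ B * κ) ∧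
      (∀ i j, ∀ x : E, ‖x‖ ≤ P → 0 ≤ x 3 → x 3 ≤ κ → |pd i (V j) x| ≤ B) := by
  obtain ⟨c, hc, hr⟩ := exists_ramp_bound
  have hK : IsCompact ({x : E | 0 ≤ x 3} ∩ closedBall 0 (P + 2)) :=
    (isCompact_closedBall _ _).inter_left
      (isClosed_le continuous_const (contDiff_coord 3).continuous)
  have hb : ∀ j, ∃ b, ∀ x ∈ {x : E | 0 ≤ x 3} ∩ closedBall 0 (P + 2), ‖fderiv ℝ (U j) x‖ ≤ b :=
    fun j => hK.exists_bound_of_continuousOn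
      (((hU j).continuousOn_fderiv_of_isOpen (isOpen_above τ) le_rfl).mono
        fun x hx => hτ.trans_le hx.1)
  choose b hb using hb
  set b' := ∑ j, |b j| with hb'
  have hbb : ∀ j, b j ≤ b' := fun j => (le_abs_self _).trans
    (Finset.single_le_sum (f := fun j => |b j|) (fun j _ => abs_nonneg _) (Finset.mem_univ j))
  have hb0 : 0 ≤ b' := Finset.sum_nonneg fun j _ => abs_nonneg _
  refine ⟨2 * c ^ 2 * b' + 1, by positivity, fun κ hκ hκ1 => ⟨piola κ U, contDiff_piola hκ hτ hU,
    sum_pd_piola hκ hτ hU hdiv, fun j x hx => piola_eq_zero hκ hU0 hx j,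
    fun j x hx => piola_eq_self hκ hx j, ?_⟩⟩
  have hsq : ∀ x : E, ‖x‖ ≤ P → 0 ≤ x 3 → x 3 ≤ κ →
      squeeze κ x ∈ {x : E | 0 ≤ x 3} ∩ closedBall 0 (P + 2) ∧ squeeze κ x 3 ≤ κ := by
    intro x hP h0 hx
    have h1 : squeeze κ x 3 ≤ κ := by
      rw [squeeze_three]
      calc κ * ramp (x 3 / κ) ≤ κ * (x 3 / κ) := by gcongr; exact ramp_le (by positivity)
        _ = x 3 := by field_simp
        _ ≤ κ := hx
    have h2 := squeeze_mem hκ x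
    refine ⟨⟨h2, ?_⟩, h1⟩
    rw [mem_closedBall_zero_iff]
    have h3 : ‖squeeze κ x‖ ≤ ‖x‖ + |κ * ramp (x 3 / κ) - x 3| := by
      refine (norm_add_le _ _).trans ?_
      simp [norm_smul]
    rw [← squeeze_three] at h3
    have h4 : |squeeze κ x 3 - x 3| ≤ 1 := by rw [abs_le]; constructor <;> linarith
    linarith
  have hUs : ∀ j, ∀ x : E, ‖x‖ ≤ P → 0 ≤ x 3 → x 3 ≤ κ → |U j (squeeze κ x)| ≤ b' * κ := by
    intro j x hP h0 hx
    obtain ⟨hm, h1⟩ := hsq x hP h0 hx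
    set y := squeeze κ x with hy
    set y₀ : E := y - y 3 • e 3 with hy₀
    have hy03 : y₀ 3 = 0 := by simp [hy₀]
    have hconv : Convex ℝ ({x : E | 0 ≤ x 3} ∩ closedBall 0 (P + 2)) := by
      refine Convex.inter ?_ (convex_closedBall _ _)
      intro p hp q hq s t hs ht _
      have hp' : 0 ≤ p 3 := hp
      have hq' : 0 ≤ q 3 := hq
      have : 0 ≤ s * p 3 + t * q 3 := by positivity
      simpa using this
    have hy0m : y₀ ∈ {x : E | 0 ≤ x 3} ∩ closedBall 0 (P + 2) := by
      refine ⟨hy03.ge, ?_⟩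
      rw [mem_closedBall_zero_iff]
      refine le_trans ?_ (mem_closedBall_zero_iff.1 hm.2)
      rw [EuclideanSpace.norm_eq, EuclideanSpace.norm_eq]
      refine Real.sqrt_le_sqrt (Finset.sum_le_sum fun i _ => ?_)
      by_cases hi : i = 3
      · subst hi; rw [hy03]; simp [sq_nonneg]
      · simp [hy₀, hi]
    have := hconv.norm_image_sub_le_of_norm_fderiv_le (f := U j) (C := b')
      (fun z hz => differentiableAt_above (hU j) (hτ.trans_le hz.1))
      (fun z hz => (hb j z hz).trans (hbb j)) hy0m hm
    rw [hU0 j y₀ hy03, sub_zero] at this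
    have h5 : ‖y - y₀‖ ≤ κ := by
      rw [hy₀, sub_sub_cancel, norm_smul]
      simpa [abs_of_nonneg (show 0 ≤ y 3 from hm.1)] using h1
    calc |U j y| ≤ b' * ‖y - y₀‖ := this
      _ ≤ b' * κ := by gcongr
  have hc2 : c ≤ c ^ 2 := by nlinarith
  have hpf : ∀ j, ∀ x : E, x 3 ≤ κ → |piolaFactor κ j x| ≤ c := by
    intro j x hx
    unfold piolaFactor
    split_ifs
    · simpa using hc
    · exact (hr _ ((div_le_one hκ).2 hx)).1
  constructor
  · intro j x hP hx
    rcases le_or_gt (x 3) 0 with h0 | h0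
    · rw [piola_eq_zero hκ hU0 h0, abs_zero]; positivity
    · rw [piola, abs_mul]
      calc _ ≤ c * (b' * κ) := by
            gcongr
            exacts [hpf j x hx, hUs j x hP h0.le hx]
        _ ≤ (2 * c ^ 2 * b' + 1) * κ := by nlinarith [mul_nonneg hb0 hκ.le]
  · intro i j x hP h0 hx
    rw [pd_piola hκ hτ hU]
    have hx1 := hr _ ((div_le_one hκ).2 hx)
    have h1 : |pd i (piolaFactor κ j) x * U j (squeeze κ x)| ≤ c * b' := by
      rw [pd_piolaFactor, abs_mul]
      split_ifs
      · rw [abs_mul, abs_of_pos (inv_pos.2 hκ)]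
        calc _ ≤ κ⁻¹ * c * (b' * κ) := by
              gcongr
              exacts [hx1.2, hUs j x hP h0 hx]
          _ = c * b' := by field_simp
      · simp; positivity
    have h2 : |(if i = 3 then deriv ramp (x 3 / κ) else 1)| ≤ c := by
      split_ifs
      · exact hx1.1
      · simpa using hc
    have h3 : |pd i (U j) (squeeze κ x)| ≤ b' :=
      (abs_pd_le _ _ _).trans ((hb j _ (hsq x hP h0 hx).1).trans (hbb j))
    have h4 : |piolaFactor κ j x * ((if i = 3 then deriv ramp (x 3 / κ) else 1) *
        pd i (U j) (squeeze κ x))| ≤ c * (c * b') := by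
      rw [abs_mul, abs_mul]
      gcongr
      exact hpf j x hx
    refine (abs_add_le _ _).trans ?_
    nlinarith

end Piola

section Mollifier

/-- The orthogonal projection onto the boundary hyperplane. -/
noncomputable def proj (x : E) : E := x - x 3 • e 3

lemma contDiff_proj : ContDiff ℝ ∞ proj :=
  contDiff_id.sub ((contDiff_coord 3).smul contDiff_const)

lemma continuous_proj : Continuous proj := contDiff_proj.continuous

@[simp] lemma proj_three (x : E) : proj x 3 = 0 := by simp [proj]

lemma proj_apply_of_ne (x : E) {i : Fin 4} (hi : i ≠ 3) : proj x i = x i := by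
  simp [proj, hi]

lemma norm_proj_le (x : E) : ‖proj x‖ ≤ ‖x‖ := by
  rw [EuclideanSpace.norm_eq, EuclideanSpace.norm_eq]
  refine Real.sqrt_le_sqrt (Finset.sum_le_sum fun i _ => ?_)
  by_cases hi : i = 3
  · subst hi; simp [sq_nonneg]
  · rw [proj_apply_of_ne x hi]

lemma proj_of_three_eq_zero {x : E} (hx : x 3 = 0) : proj x = x := by simp [proj, hx]

lemma proj_sub (x y : E) : proj (x - y) = proj x - proj y := by
  ext i
  simp [proj]
  split_ifs <;> ring

/-- Tangential translations composed with a lift by `τ`. -/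
noncomputable def lower (τ : ℝ) (p : E) : E := proj p - τ • e 3

lemma continuous_lower (τ : ℝ) : Continuous (lower τ) := continuous_proj.sub continuous_const

lemma sub_lower_three (τ : ℝ) (x p : E) : (x - lower τ p) 3 = x 3 + τ := by simp [lower]

lemma norm_lower_le {τ : ℝ} (hτ : 0 ≤ τ) (p : E) : ‖lower τ p‖ ≤ ‖p‖ + τ := by
  refine (norm_sub_le _ _).trans (add_le_add (norm_proj_le p) ?_)
  rw [norm_smul]
  simp [abs_of_nonneg hτ]

/-- The open half space. -/
def H : Set E := {x | 0 < x 3}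

lemma isOpen_H : IsOpen H := isOpen_above 0

/-- Tangential mollification followed by a lift. -/
noncomputable def moll (a : E → ℝ) (ε τ : ℝ) (g : E → ℝ) (x : E) : ℝ :=
  ∫ p in closedBall (0 : E) ε, a p * g (x - lower τ p)

variable {a g : E → ℝ} {ε τ : ℝ} {x : E}

lemma sub_lower_mem (hx : -τ < x 3) (p : E) : x - lower τ p ∈ H := by
  change 0 < (x - lower τ p) 3
  rw [sub_lower_three]; linarith

lemma contDiffOn_moll (ha : Continuous a) (hg : ContDiffOn ℝ 1 g H) :
    ContDiffOn ℝ 1 (moll a ε τ g) {x | -τ < x 3} :=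
  (contDiffOn_integral_translates (μ := volume) (isCompact_closedBall 0 ε) ha (continuous_lower τ)
    isOpen_H hg).mono fun _ hx p _ => sub_lower_mem hx p

lemma continuousOn_moll (ha : Continuous a) (hg : ContinuousOn g H) :
    ContinuousOn (moll a ε τ g) {x | -τ < x 3} :=
  (continuousOn_integral_translates (μ := volume) (isCompact_closedBall 0 ε) ha
    (continuous_lower τ) isOpen_H hg).mono fun _ hx p _ => sub_lower_mem hx p

lemma pd_moll (ha : Continuous a) (hg : ContDiffOn ℝ 1 g H) (i : Fin 4) (hx : -τ < x 3) :
    pd i (moll a ε τ g) x = moll a ε τ (pd i g) x :=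
  pd_integral_translates (μ := volume) (isCompact_closedBall 0 ε) ha (continuous_lower τ)
    isOpen_H hg i fun p _ => sub_lower_mem hx p

lemma integrableOn_moll (ha : Continuous a) (hg : ContinuousOn g H) (hx : -τ < x 3) :
    IntegrableOn (fun p => a p * g (x - lower τ p)) (closedBall (0 : E) ε) := by
  refine ContinuousOn.integrableOn_compact (isCompact_closedBall 0 ε) ?_
  refine ha.continuousOn.mul (hg.comp ?_ fun p _ => sub_lower_mem hx p)
  exact (continuous_const.sub (continuous_lower τ)).continuousOn

lemma moll_sub {f : E → ℝ} (ha : Continuous a) (hf : ContinuousOn f H) (hg : ContinuousOn g H)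
    (hx : -τ < x 3) :
    moll a ε τ (fun y => f y - g y) x = moll a ε τ f x - moll a ε τ g x := by
  unfold moll
  rw [← integral_sub (integrableOn_moll ha hf hx) (integrableOn_moll ha hg hx)]
  simp only [mul_sub]

lemma moll_sum {f : Fin 4 → E → ℝ} (ha : Continuous a) (hf : ∀ i, ContinuousOn (f i) H)
    (hx : -τ < x 3) :
    moll a ε τ (fun y => ∑ i, f i y) x = ∑ i, moll a ε τ (f i) x := by
  unfold moll
  rw [← integral_finsetSum _ fun i _ => integrableOn_moll ha (hf i) hx]
  simp only [Finset.mul_sum]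

lemma moll_congr {f : E → ℝ} (hfg : ∀ y ∈ H, f y = g y) (hx : -τ < x 3) :
    moll a ε τ f x = moll a ε τ g x := by
  unfold moll
  simp only [hfg _ (sub_lower_mem hx _)]

/-- Mollification is close to the identity where the function is uniformly continuous. -/
lemma abs_moll_sub_le (ha : Continuous a) (ha0 : ∀ p, 0 ≤ a p)
    (ha1 : ∫ p in closedBall (0 : E) ε, a p = 1) (hg : ContinuousOn g H) (hx : -τ < x 3) {η : ℝ}
    (h : ∀ p ∈ closedBall (0 : E) ε, |g (x - lower τ p) - g x| ≤ η) :
    |moll a ε τ g x - g x| ≤ η := by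
  have hai : IntegrableOn a (closedBall (0 : E) ε) :=
    ha.continuousOn.integrableOn_compact (isCompact_closedBall 0 ε)
  have h1 : moll a ε τ g x - g x =
      ∫ p in closedBall (0 : E) ε, a p * (g (x - lower τ p) - g x) := by
    simp only [mul_sub]
    rw [integral_sub (integrableOn_moll ha hg hx) (hai.mul_const _), integral_mul_const, ha1,
      one_mul]
    rfl
  rw [h1, ← Real.norm_eq_abs]
  calc _ ≤ ∫ p in closedBall (0 : E) ε, a p * η := by
        refine norm_integral_le_of_norm_le (hai.mul_const _) ?_
        filter_upwards [ae_restrict_mem measurableSet_closedBall] with p hp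
        rw [norm_mul, Real.norm_eq_abs, abs_of_nonneg (ha0 p)]
        exact mul_le_mul_of_nonneg_left (h p hp) (ha0 p)
    _ = η := by rw [integral_mul_const, ha1, one_mul]

/-- Uniform continuity on compact shells of the (closed) half space. -/
lemma exists_uniform_step {k ρ₁ ρ₂ : ℝ} (hρ : 0 < ρ₁)
    (hg : ContinuousOn g {x | k ≤ x 3 ∧ x ≠ 0}) {η : ℝ} (hη : 0 < η) :
    ∃ δ > 0, ∀ ε τ : ℝ, 0 ≤ ε → 0 ≤ τ → ε ≤ δ → τ ≤ δ → ∀ x : E, k ≤ x 3 → ρ₁ ≤ ‖x‖ → ‖x‖ ≤ ρ₂ →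
      ∀ p ∈ closedBall (0 : E) ε, |g (x - lower τ p) - g x| ≤ η := by
  set K : Set E := {x | k ≤ x 3} ∩ {x | ρ₁ / 2 ≤ ‖x‖} ∩ closedBall 0 (ρ₂ + ρ₁) with hK
  have hKc : IsCompact K := by
    refine (isCompact_closedBall _ _).inter_left ?_
    exact (isClosed_le continuous_const (contDiff_coord 3).continuous).inter
      (isClosed_le continuous_const continuous_norm)
  have hu : UniformContinuousOn g K := hKc.uniformContinuousOn_of_continuous <| hg.mono
    fun x hx => ⟨hx.1.1, by rintro rfl; have := hx.1.2; simp at this; linarith⟩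
  obtain ⟨δ, hδ, h⟩ := Metric.uniformContinuousOn_iff.1 hu η hη
  refine ⟨min (δ / 3) (ρ₁ / 4), by positivity, fun ε τ _ hτ h1 h2 x hx h3 h4 p hp => ?_⟩
  have h5 : ‖lower τ p‖ ≤ ε + τ :=
    (norm_lower_le hτ p).trans (by gcongr; simpa using hp)
  have h6 : ε + τ ≤ ρ₁ / 2 := by
    have := h1.trans (min_le_right _ _); have := h2.trans (min_le_right _ _); linarith
  have h7 : ε + τ < δ := by
    have := h1.trans (min_le_left _ _); have := h2.trans (min_le_left _ _); linarith
  refine (h (x - lower τ p) ?_ x ?_ ?_).le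
  · refine ⟨⟨?_, ?_⟩, ?_⟩
    · change k ≤ (x - lower τ p) 3
      rw [sub_lower_three]; linarith
    · have := norm_sub_norm_le x (lower τ p)
      change ρ₁ / 2 ≤ ‖x - lower τ p‖
      linarith
    · rw [mem_closedBall_zero_iff]
      have := norm_sub_le x (lower τ p)
      linarith
  · refine ⟨⟨hx, ?_⟩, ?_⟩
    · change ρ₁ / 2 ≤ ‖x‖
      linarith
    · rw [mem_closedBall_zero_iff]; linarith
  · rw [dist_eq_norm, sub_sub_cancel_left, norm_neg]
    exact h5.trans_lt h7

end Mollifier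

section MollifiedEquation

variable {a g : E → ℝ} {ε τ : ℝ} {x : E}

lemma tsupport_subset_of_eq_zero (hg : ∀ x : E, x 3 ≤ 0 → g x = 0) :
    tsupport g ⊆ {x | 0 ≤ x 3} :=
  closure_minimal (fun y hy => by
    by_contra h
    exact hy (hg y (not_le.1 h).le)) (isClosed_le continuous_const (contDiff_coord 3).continuous)

/-- The mollified stress is weakly divergence free against solenoidal fields supported in the
closed half space. -/
theorem sum_integral_moll_stress {f : Fin 4 → Fin 4 → E → ℝ} {π : E → ℝ} {w : Fin 4 → E → ℝ}
    (ha : Continuous a) (hτ : 0 < τ) (hf : ∀ i j, ContDiffOn ℝ 1 (f i j) H)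
    (hπ : ContDiffOn ℝ 1 π H) (hfπ : ∀ y ∈ H, ∀ j, ∑ i, pd i (f i j) y = pd j π y)
    (hw : ∀ j, ContDiff ℝ 1 (w j)) (hwc : ∀ j, HasCompactSupport (w j))
    (hw0 : ∀ j, ∀ x : E, x 3 ≤ 0 → w j x = 0) (hdiv : ∀ x, ∑ j, pd j (w j) x = 0) :
    ∑ i, ∑ j, ∫ x, moll a ε τ (f i j) x * pd i (w j) x = 0 := by
  have hΩ := isOpen_above (-τ)
  have hs : ∀ j, tsupport (w j) ⊆ {x : E | -τ < x 3} := fun j x hx => by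
    have : 0 ≤ x 3 := tsupport_subset_of_eq_zero (hw0 j) hx
    change -τ < x 3
    linarith
  have hpdc : ∀ (q : E → ℝ) (i : Fin 4), ContDiffOn ℝ 1 q H → ContinuousOn (pd i q) H :=
    fun q i hq => (hq.continuousOn_fderiv_of_isOpen isOpen_H le_rfl).clm_apply continuousOn_const
  have h1 : ∀ i j, ∫ x, moll a ε τ (f i j) x * pd i (w j) x =
      -∫ x, moll a ε τ (pd i (f i j)) x * w j x := by
    intro i j
    rw [integral_mul_pd hΩ (contDiffOn_moll ha (hf i j)) (hw j) (hwc j) (hs j)]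
    congr 1
    refine integral_congr_ae (ae_of_all _ fun x => ?_)
    by_cases hx : -τ < x 3
    · simp only [pd_moll ha (hf i j) i hx]
    · simp only [image_eq_zero_of_notMem_tsupport fun h => hx (hs j h), mul_zero]
  have hint : ∀ j (q : E → ℝ), ContinuousOn q H →
      Integrable fun x => moll a ε τ q x * w j x := fun j q hq =>
    integrable_mul_of_tsupport_subset hΩ (continuousOn_moll ha hq) (hw j).continuous (hs j) (hwc j)
  have h2 : ∀ j, ∑ i, ∫ x, moll a ε τ (f i j) x * pd i (w j) x =
      ∫ x, moll a ε τ π x * pd j (w j) x := by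
    intro j
    simp only [h1]
    rw [integral_mul_pd hΩ (contDiffOn_moll ha hπ) (hw j) (hwc j) (hs j),
      Finset.sum_neg_distrib, ← integral_finsetSum _ fun i _ => hint j _ (hpdc _ i (hf i j))]
    congr 1
    refine integral_congr_ae (ae_of_all _ fun x => ?_)
    by_cases hx : -τ < x 3
    · simp only [pd_moll ha hπ j hx]
      rw [← Finset.sum_mul, ← moll_sum ha (fun i => hpdc _ i (hf i j)) hx,
        moll_congr (fun y hy => hfπ y hy j) hx]
    · simp only [image_eq_zero_of_notMem_tsupport fun h => hx (hs j h), mul_zero,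
        Finset.sum_const_zero]
  rw [Finset.sum_comm]
  simp only [h2]
  rw [← integral_finsetSum _ fun j _ => integrable_mul_of_tsupport_subset hΩ
    (continuousOn_moll ha hπ.continuousOn) (continuous_pd (hw j))
    (tsupport_pd_subset.trans (hs j)) (hasCompactSupport_pd (hwc j))]
  simp only [← Finset.mul_sum, hdiv, mul_zero, integral_zero]

/-- Mollification does not increase the local `L²` norm. -/
theorem lintegral_moll_sq_le {P : ℝ} (ha : Continuous a) (ha0 : ∀ p, 0 ≤ a p)
    (ha1 : ∫ p in closedBall (0 : E) ε, a p = 1) (hg : ContinuousOn g H) (hτ : 0 ≤ τ) :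
    ∫⁻ x in closedBall (0 : E) P ∩ H, ‖moll a ε τ g x‖ₑ ^ 2 ≤
      ∫⁻ x in closedBall (0 : E) (P + (ε + τ)) ∩ H, ‖g x‖ₑ ^ 2 := by
  have hHm : MeasurableSet H := isOpen_H.measurableSet
  set μ : Measure E := volume.restrict (closedBall (0 : E) ε)
  set ν : Measure E := μ.withDensity fun p => ENNReal.ofReal (a p)
  have ham : Measurable fun p => ENNReal.ofReal (a p) := ha.measurable.ennreal_ofReal
  have hν : ν univ = 1 := by
    rw [withDensity_apply _ MeasurableSet.univ, Measure.restrict_univ,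
      ← ofReal_integral_eq_lintegral_ofReal
        (ha.continuousOn.integrableOn_compact (isCompact_closedBall 0 ε)) (ae_of_all _ ha0), ha1,
      ENNReal.ofReal_one]
  have : IsProbabilityMeasure ν := ⟨hν⟩
  set G : E → ℝ := H.indicator g
  have hG : Measurable G := by
    classical
    rw [show G = H.piecewise g 0 from (piecewise_eq_indicator (s := H)).symm]
    exact hg.measurable_piecewise continuousOn_const hHm
  have hq : Measurable (lower τ) := (continuous_lower τ).measurable
  have h1 : ∀ x ∈ closedBall (0 : E) P ∩ H,
      ‖moll a ε τ g x‖ₑ ^ 2 ≤ ∫⁻ p, ‖G (x - lower τ p)‖ₑ ^ 2 ∂ν := by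
    intro x hx
    have hx3 : -τ < x 3 := by have : 0 < x 3 := hx.2; linarith
    have h2 : ‖moll a ε τ g x‖ₑ ≤ ∫⁻ p, ‖G (x - lower τ p)‖ₑ ∂ν := by
      refine (enorm_integral_le_lintegral_enorm _).trans ?_
      rw [lintegral_withDensity_eq_lintegral_mul _ ham (by fun_prop)]
      refine lintegral_mono fun p => ?_
      simp only [Pi.mul_apply, enorm_mul, Real.enorm_eq_ofReal (ha0 p)]
      rw [show G (x - lower τ p) = g (x - lower τ p) from
        indicator_of_mem (sub_lower_mem hx3 p) _]
    calc _ ≤ (∫⁻ p, ‖G (x - lower τ p)‖ₑ ∂ν) ^ 2 := by gcongr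
      _ ≤ ν univ * _ := lintegral_sq_le (by fun_prop)
      _ = _ := by rw [hν, one_mul]
  calc _ ≤ ∫⁻ x in closedBall (0 : E) P ∩ H, ∫⁻ p, ‖G (x - lower τ p)‖ₑ ^ 2 ∂ν :=
        setLIntegral_mono' (measurableSet_closedBall.inter hHm) h1
    _ = ∫⁻ p, (∫⁻ x in closedBall (0 : E) P ∩ H, ‖G (x - lower τ p)‖ₑ ^ 2) ∂ν :=
        lintegral_lintegral_swap (f := fun x p => ‖G (x - lower τ p)‖ₑ ^ 2)
          (Measurable.aemeasurable (by unfold Function.uncurry; fun_prop))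
    _ ≤ ∫⁻ _, (∫⁻ x in closedBall (0 : E) (P + (ε + τ)) ∩ H, ‖g x‖ₑ ^ 2) ∂ν := by
        refine lintegral_mono_ae ?_
        have : ∀ᵐ p ∂ν, p ∈ closedBall (0 : E) ε :=
          (withDensity_absolutelyContinuous _ _).ae_le (ae_restrict_mem measurableSet_closedBall)
        filter_upwards [this] with p hp
        set S := closedBall (0 : E) (P + (ε + τ)) ∩ H
        have hS : MeasurableSet S := measurableSet_closedBall.inter hHm
        calc _ ≤ ∫⁻ x, S.indicator (fun y => ‖g y‖ₑ ^ 2) (x - lower τ p) := by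
              rw [← lintegral_indicator (measurableSet_closedBall.inter hHm)]
              refine lintegral_mono fun x => ?_
              by_cases hx : x ∈ closedBall (0 : E) P ∩ H
              · have hx3 : -τ < x 3 := by have : 0 < x 3 := hx.2; linarith
                have hm := sub_lower_mem hx3 p
                have hxS : x - lower τ p ∈ S := by
                  refine ⟨?_, hm⟩
                  rw [mem_closedBall_zero_iff]
                  refine (norm_sub_le _ _).trans (add_le_add (by simpa using hx.1) ?_)
                  exact (norm_lower_le hτ p).trans (by gcongr; simpa using hp)
                rw [indicator_of_mem hx, indicator_of_mem hxS]
                rw [show G (x - lower τ p) = g (x - lower τ p) from indicator_of_mem hm _]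
              · rw [indicator_of_notMem hx]; exact zero_le
          _ = _ := by
              rw [lintegral_sub_right_eq_self (fun y => S.indicator (fun y => ‖g y‖ₑ ^ 2) y),
                lintegral_indicator hS]
    _ = _ := by simp

end MollifiedEquation

section Smear

/-- Full mollification by `b` of a function defined on the whole space. -/
noncomputable def smear (b : E → ℝ) (ε : ℝ) (h : E → ℝ) (x : E) : ℝ :=
  ∫ p in closedBall (0 : E) ε, b p * h (x - p)

variable {b h : E → ℝ} {ε : ℝ}

lemma contDiff_smear (hb : Continuous b) (hh : ContDiff ℝ 1 h) : ContDiff ℝ 1 (smear b ε h) :=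
  contDiff_integral_translates (μ := volume) (isCompact_closedBall 0 ε) hb continuous_id hh

lemma pd_smear (hb : Continuous b) (hh : ContDiff ℝ 1 h) (i : Fin 4) (x : E) :
    pd i (smear b ε h) x = smear b ε (pd i h) x :=
  pd_integral_translates (μ := volume) (isCompact_closedBall 0 ε) hb continuous_id isOpen_univ
    hh.contDiffOn i fun _ _ => mem_univ _

lemma smear_eq_integral (hb : tsupport b ⊆ closedBall 0 ε) (x : E) :
    smear b ε h x = ∫ p, b p * h (x - p) :=
  setIntegral_eq_integral_of_forall_compl_eq_zero fun p hp => by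
    rw [image_eq_zero_of_notMem_tsupport fun h => hp (hb h), zero_mul]

lemma smear_pd (hb : ContDiff ℝ 1 b) (hbs : tsupport b ⊆ closedBall 0 ε) (hh : ContDiff ℝ 1 h)
    (i : Fin 4) (x : E) : smear b ε (pd i h) x = smear (pd i b) ε h x := by
  have hc : HasCompactSupport b := (isCompact_closedBall (0 : E) ε).of_isClosed_subset
    (isClosed_tsupport b) hbs
  rw [smear_eq_integral hbs, smear_eq_integral (tsupport_pd_subset.trans hbs)]
  have h1 : ContDiff ℝ 1 fun p => h (x - p) := hh.comp (contDiff_const.sub contDiff_id)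
  have h2 : ∀ p, pd i (fun p => h (x - p)) p = -pd i h (x - p) := by
    intro p
    have h3 : HasFDerivAt (fun p => h (x - p)) ((fderiv ℝ h (x - p)).comp
        (-ContinuousLinearMap.id ℝ E)) p :=
      (hh.differentiable one_ne_zero (x - p)).hasFDerivAt.comp p
        ((hasFDerivAt_id p).const_sub x)
    unfold pd
    rw [h3.fderiv]
    simp
  have h4 := integral_mul_pd (i := i) isOpen_univ h1.contDiffOn hb hc (subset_univ _)
  simp only [h2] at h4
  have h5 : ∫ x_1, -pd i h (x - x_1) * b x_1 = -∫ p, b p * pd i h (x - p) := by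
    rw [← integral_neg]; congr 1; ext p; ring
  rw [h5, neg_neg] at h4
  rw [← h4]
  congr 1; ext p; ring

lemma abs_smear_le {B P : ℝ} (hB : ∀ p, |b p| ≤ B) (hh : Continuous h) {x : E} (hx : ‖x‖ ≤ P) :
    |smear b ε h x| ≤ B * ∫ y in closedBall (0 : E) (P + ε), |h y| := by
  have hB0 : 0 ≤ B := (abs_nonneg _).trans (hB 0)
  have hi : ∀ s : ℝ, IntegrableOn (fun y => |h y|) (closedBall (0 : E) s) := fun s =>
    hh.abs.continuousOn.integrableOn_compact (isCompact_closedBall _ _)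
  have hi2 : IntegrableOn (fun p => |h (x - p)|) (closedBall (0 : E) ε) :=
    (Continuous.continuousOn (by fun_prop)).integrableOn_compact (isCompact_closedBall _ _)
  unfold smear
  rw [← Real.norm_eq_abs]
  calc _ ≤ ∫ p in closedBall (0 : E) ε, B * |h (x - p)| := by
        refine norm_integral_le_of_norm_le (hi2.const_mul B) (ae_of_all _ fun p => ?_)
        rw [norm_mul]
        exact mul_le_mul_of_nonneg_right (hB p) (abs_nonneg _)
    _ = B * ∫ p in closedBall (0 : E) ε, |h (x - p)| := integral_const_mul _ _
    _ ≤ _ := by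
        refine mul_le_mul_of_nonneg_left ?_ hB0
        set F : E → ℝ := (closedBall (0 : E) (P + ε)).indicator fun y => |h y|
        have hF : Integrable F := (integrable_indicator_iff measurableSet_closedBall).2 (hi _)
        have hF2 : Integrable fun p => F (x - p) := hF.comp_sub_left x
        calc _ = ∫ p in closedBall (0 : E) ε, F (x - p) := by
              refine setIntegral_congr_fun measurableSet_closedBall fun p hp => ?_
              have : x - p ∈ closedBall (0 : E) (P + ε) := by
                rw [mem_closedBall_zero_iff]
                exact (norm_sub_le _ _).trans (add_le_add hx (by simpa using hp))
              exact (indicator_of_mem (f := fun y => |h y|) this).symm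
          _ ≤ ∫ p, F (x - p) := setIntegral_le_integral hF2
              (ae_of_all _ fun p => indicator_nonneg (f := fun y => |h y|)
                (fun z _ => abs_nonneg (h z)) (x - p))
          _ = ∫ p, F p := integral_sub_left_eq_self F volume x
          _ = _ := integral_indicator measurableSet_closedBall

end Smear

section Dominator

lemma volume_coord_eq_zero (i : Fin 4) : volume {x : E | x i = 0} = 0 := by
  have h : (LinearMap.ker (EuclideanSpace.proj (𝕜 := ℝ) i : E →L[ℝ] ℝ).toLinearMap) ≠ ⊤ := by
    intro h
    have : e i ∈ LinearMap.ker (EuclideanSpace.proj (𝕜 := ℝ) i : E →L[ℝ] ℝ).toLinearMap := by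
      rw [h]; trivial
    simp at this
  have := Measure.addHaar_submodule (volume : Measure E) _ h
  convert this using 2
  ext x
  simp

lemma ae_coord_ne_zero : ∀ᵐ x : E, ∀ i, x i ≠ 0 := by
  rw [ae_all_iff]
  intro i
  exact measure_eq_zero_iff_ae_notMem.1 (volume_coord_eq_zero i)

/-- An explicit locally integrable majorant of functions with a weak singularity. -/
noncomputable def majorant (x : E) : ℝ := ∏ i, |x i| ^ (-(1 / 2) : ℝ)

lemma integrableOn_majorant (P : ℝ) : IntegrableOn majorant (closedBall 0 P) := by
  have h1 : IntegrableOn (fun t : ℝ => |t| ^ (-(1 / 2) : ℝ)) (Icc (-P) P) := by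
    have h2 : ∀ c : ℝ, 0 ≤ c → IntegrableOn (fun t : ℝ => |t| ^ (-(1 / 2) : ℝ)) (Ioc 0 c) := by
      intro c hc
      have := (intervalIntegral.intervalIntegrable_rpow' (a := 0) (b := c)
        (r := (-(1 / 2) : ℝ)) (by norm_num)).1
      exact this.congr_fun (fun t ht => by simp only [abs_of_pos ht.1]) measurableSet_Ioc
    rcases lt_or_ge P 0 with hP | hP
    · rw [Icc_eq_empty (by linarith)]; exact integrableOn_empty
    have h3 : IntegrableOn (fun t : ℝ => |t| ^ (-(1 / 2) : ℝ)) (Icc 0 P) :=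
      (h2 P hP).congr_set_ae Ioc_ae_eq_Icc.symm
    have h4 : IntegrableOn (fun t : ℝ => |t| ^ (-(1 / 2) : ℝ)) (Icc (-P) 0) := by
      have := h3.comp_neg
      simpa using this
    rw [← Icc_union_Icc_eq_Icc (neg_nonpos.2 hP) hP]
    exact h4.union h3
  have h5 : Integrable ((Icc (-P) P).indicator fun t : ℝ => |t| ^ (-(1 / 2) : ℝ)) :=
    (integrable_indicator_iff measurableSet_Icc).2 h1
  have h6 := Integrable.fintype_prod (𝕜 := ℝ) (ι := Fin 4) (E := ℝ)
    (μ := fun _ => volume) (f := fun _ => (Icc (-P) P).indicator fun t : ℝ => |t| ^ (-(1 / 2) : ℝ))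
    fun _ => h5
  have h7 := ((EuclideanSpace.volume_preserving_symm_measurableEquiv_toLp
    (Fin 4)).integrable_comp_emb (MeasurableEquiv.measurableEmbedding _)).2 h6
  refine (h7.integrableOn (s := closedBall (0 : E) P)).congr_fun (fun x hx => ?_)
    measurableSet_closedBall
  simp only [majorant, Function.comp]
  refine Finset.prod_congr rfl fun i _ => ?_
  have : x i ∈ Icc (-P) P := abs_le.1 ((abs_coord_le x i).trans (by simpa using hx))
  exact indicator_of_mem this _

lemma inv_norm_sq_le_majorant {x : E} (hx : ∀ i, x i ≠ 0) : (‖x‖ ^ 2)⁻¹ ≤ majorant x := by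
  have hn : 0 < ‖x‖ := (abs_pos.2 (hx 0)).trans_le (abs_coord_le x 0)
  have h1 : ∀ i, ‖x‖ ^ (-(1 / 2) : ℝ) ≤ |x i| ^ (-(1 / 2) : ℝ) := fun i =>
    Real.rpow_le_rpow_of_nonpos (abs_pos.2 (hx i)) (abs_coord_le x i) (by norm_num)
  calc (‖x‖ ^ 2)⁻¹ = ∏ _i : Fin 4, ‖x‖ ^ (-(1 / 2) : ℝ) := by
        rw [Finset.prod_const, Finset.card_univ, Fintype.card_fin, ← Real.rpow_natCast,
          ← Real.rpow_natCast, ← Real.rpow_mul hn.le, ← Real.rpow_neg hn.le]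
        norm_num
    _ ≤ _ := Finset.prod_le_prod (fun _ _ => Real.rpow_nonneg hn.le _) fun i _ => h1 i

lemma inv_norm_proj_le_majorant {P : ℝ} {x : E} (hx : ∀ i, x i ≠ 0) (hP : ‖x‖ ≤ P) :
    ‖proj x‖⁻¹ ≤ P * majorant x := by
  have hn : 0 < ‖proj x‖ := by
    have := abs_coord_le (proj x) 0
    rw [proj_apply_of_ne x (by decide)] at this
    exact (abs_pos.2 (hx 0)).trans_le this
  have hP0 : 0 < P := hn.trans_le ((norm_proj_le x).trans hP)
  have h1 : ∀ i, i ≠ 3 → ‖proj x‖ ^ (-(1 / 2) : ℝ) ≤ |x i| ^ (-(1 / 2) : ℝ) := fun i hi =>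
    Real.rpow_le_rpow_of_nonpos (abs_pos.2 (hx i))
      (by have := abs_coord_le (proj x) i; rwa [proj_apply_of_ne x hi] at this) (by norm_num)
  have h2 : ∀ i, P ^ (-(1 / 2) : ℝ) ≤ |x i| ^ (-(1 / 2) : ℝ) := fun i =>
    Real.rpow_le_rpow_of_nonpos (abs_pos.2 (hx i)) ((abs_coord_le x i).trans hP) (by norm_num)
  have h3 : ∀ s : ℝ, 0 < s → s ^ (-(1 / 2) : ℝ) * s ^ (-(1 / 2) : ℝ) = s⁻¹ := fun s hs => by
    rw [← Real.rpow_add hs, ← Real.rpow_neg_one]; norm_num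
  have h4 : ∀ s : ℝ, 0 ≤ s → 0 ≤ s ^ (-(1 / 2) : ℝ) := fun s hs => Real.rpow_nonneg hs _
  have h5 : ‖proj x‖⁻¹ * P⁻¹ ≤ majorant x := by
    rw [majorant, Fin.prod_univ_four, ← h3 _ hn, ← h3 _ hP0]
    calc _ = ‖proj x‖ ^ (-(1 / 2) : ℝ) * ‖proj x‖ ^ (-(1 / 2) : ℝ) * P ^ (-(1 / 2) : ℝ) *
          P ^ (-(1 / 2) : ℝ) := by ring
      _ ≤ _ := by
        have := h1 0 (by decide)
        have := h1 1 (by decide)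
        have := h2 2
        have := h2 3
        have := h4 _ hn.le
        have := h4 _ hP0.le
        gcongr
  calc ‖proj x‖⁻¹ = P * (‖proj x‖⁻¹ * P⁻¹) := by field_simp
    _ ≤ _ := by gcongr

end Dominator

section Lift

/-- A function of the tangential variables: the trace of `f` at height `τ`. -/
noncomputable def flat (τ : ℝ) (f : E → ℝ) (y : E) : ℝ := f (proj y + τ • e 3)

variable {f a : E → ℝ} {ε τ : ℝ}

lemma proj_add_three (τ : ℝ) (y : E) : (proj y + τ • e 3) 3 = τ := by simp

lemma proj_add_mem (hτ : 0 < τ) (y : E) : proj y + τ • e 3 ∈ H := by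
  change 0 < (proj y + τ • e 3) 3
  rwa [proj_add_three]

lemma contDiff_flat (hτ : 0 < τ) (hf : ContDiffOn ℝ 1 f H) : ContDiff ℝ 1 (flat τ f) := by
  have := hf.comp (g := f) (f := fun y => proj y + τ • e 3) (s := univ)
    ((contDiff_proj.of_le (by simp)).add contDiff_const).contDiffOn (fun y _ => proj_add_mem hτ y)
  exact contDiffOn_univ.1 this

lemma pd_three_flat (hτ : 0 < τ) (hf : ContDiffOn ℝ 1 f H) (x : E) : pd 3 (flat τ f) x = 0 := by
  have h3 : HasFDerivAt (fun x : E => x 3) (EuclideanSpace.proj (𝕜 := ℝ) (3 : Fin 4)) x :=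
    (EuclideanSpace.proj (𝕜 := ℝ) (3 : Fin 4)).hasFDerivAt
  have h1 : HasFDerivAt (fun y : E => proj y + τ • e 3) (ContinuousLinearMap.id ℝ E -
      (EuclideanSpace.proj (𝕜 := ℝ) (3 : Fin 4)).smulRight (e 3)) x :=
    ((hasFDerivAt_id x).sub (h3.smul_const (e 3))).add_const _
  have h2 := (differentiableAt_above hf (proj_add_mem hτ x)).hasFDerivAt.comp x h1
  unfold pd
  change fderiv ℝ (f ∘ fun y : E => proj y + τ • e 3) x (e 3) = 0
  rw [h2.fderiv]
  simp

lemma smear_flat (a : E → ℝ) (ε : ℝ) {x : E} (hx : x 3 = 0) :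
    smear a ε (flat τ f) x = moll a ε τ f x := by
  unfold smear moll flat
  congr 1
  ext p
  rw [proj_sub, proj_of_three_eq_zero hx, lower, sub_add_eq_add_sub, add_sub_right_comm,
    sub_sub_eq_add_sub]
  congr 2
  abel

lemma exists_abs_le (hf : Continuous f) (hc : HasCompactSupport f) : ∃ B, ∀ x, |f x| ≤ B :=
  hc.exists_bound_of_continuous hf

/-- A solenoidal lift of boundary values depending on the tangential variables only, with bounds by
the `L¹` norm of the data. -/
theorem exists_lift (ha : ContDiff ℝ ∞ a) (has : tsupport a ⊆ closedBall 0 ε) {P : ℝ}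
    (hP : 0 ≤ P) :
    ∃ N ≥ 0, ∀ h : Fin 4 → E → ℝ, (∀ j, ContDiff ℝ 1 (h j)) → (∀ j x, pd 3 (h j) x = 0) →
      ∃ G : Fin 4 → E → ℝ, (∀ j, ContDiff ℝ 1 (G j)) ∧ (∀ x, ∑ i, pd i (G i) x = 0) ∧
        (∀ j, ∀ x : E, x 3 = 0 → G j x = smear a ε (h j) x) ∧
        (∀ j x, ‖x‖ ≤ P → |G j x| ≤ N * ∑ k, ∫ y in closedBall (0 : E) (P + ε), |h k y|) ∧
        ∀ i j x, ‖x‖ ≤ P →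
          |pd i (G j) x| ≤ N * ∑ k, ∫ y in closedBall (0 : E) (P + ε), |h k y| := by
  have hpa : ∀ i, ContDiff ℝ ∞ (pd i a) := fun i => contDiff_pd (by simpa using ha)
  have hppa : ∀ i j, ContDiff ℝ ∞ (pd i (pd j a)) := fun i j =>
    contDiff_pd (by simpa using hpa j)
  have hac : HasCompactSupport a := (isCompact_closedBall (0 : E) ε).of_isClosed_subset
    (isClosed_tsupport a) has
  have hpac : ∀ i, HasCompactSupport (pd i a) := fun i => hasCompactSupport_pd hac
  have hpas : ∀ i, tsupport (pd i a) ⊆ closedBall 0 ε := fun i => tsupport_pd_subset.trans has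
  obtain ⟨B0, hB0⟩ := exists_abs_le ha.continuous hac
  choose B1 hB1 using fun i => exists_abs_le (hpa i).continuous (hpac i)
  choose B2 hB2 using fun i j =>
    exists_abs_le (hppa i j).continuous (hasCompactSupport_pd (i := i) (hpac j))
  have hB00 : 0 ≤ B0 := (abs_nonneg _).trans (hB0 0)
  have hB10 : ∀ i, 0 ≤ B1 i := fun i => (abs_nonneg _).trans (hB1 i 0)
  have hB20 : ∀ i j, 0 ≤ B2 i j := fun i j => (abs_nonneg _).trans (hB2 i j 0)
  set b1 : ℝ := ∑ i, B1 i with hb1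
  set b2 : ℝ := ∑ i, ∑ j, B2 i j with hb2
  have hb10 : 0 ≤ b1 := Finset.sum_nonneg fun i _ => hB10 i
  have hb20 : 0 ≤ b2 := Finset.sum_nonneg fun i _ => Finset.sum_nonneg fun j _ => hB20 i j
  refine ⟨B0 + (P + 2) * b1 + P * b2, by positivity, fun h hh h3 => ?_⟩
  set S : E → ℝ := fun x => ∑ k, smear (pd k a) ε (h k) x with hS
  have hS1 : ContDiff ℝ 1 S := ContDiff.sum fun k _ => contDiff_smear (hpa k).continuous (hh k)
  have hpS : ∀ i x, pd i S x = ∑ k, smear (pd i (pd k a)) ε (h k) x := by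
    intro i x
    rw [hS, pd_sum fun k _ => (contDiff_smear (hpa k).continuous (hh k)).differentiable
      one_ne_zero x]
    refine Finset.sum_congr rfl fun k _ => ?_
    rw [pd_smear (hpa k).continuous (hh k),
      smear_pd ((hpa k).of_le (by simp)) (hpas k) (hh k)]
  have hpA : ∀ i j x, pd i (smear a ε (h j)) x = smear (pd i a) ε (h j) x := fun i j x => by
    rw [pd_smear ha.continuous (hh j), smear_pd (ha.of_le (by simp)) has (hh j)]
  have hpS3 : ∀ x, pd 3 S x = 0 := by
    intro x
    rw [hS, pd_sum fun k _ => (contDiff_smear (hpa k).continuous (hh k)).differentiable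
      one_ne_zero x]
    refine Finset.sum_eq_zero fun k _ => ?_
    rw [pd_smear (hpa k).continuous (hh k)]
    simp [smear, h3]
  set G : Fin 4 → E → ℝ := fun j x => smear a ε (h j) x - (if j = 3 then x 3 else 0) * S x with hG
  have hc3 : ∀ j : Fin 4, ContDiff ℝ 1 fun x : E => if j = 3 then x 3 else 0 := by
    intro j
    by_cases hj : j = 3
    · simp only [hj, if_true]; exact (contDiff_coord 3).of_le (by simp)
    · simp only [hj, if_false]; exact contDiff_const
  have hpc : ∀ i j x, pd i (fun x : E => if j = (3 : Fin 4) then x 3 else 0) x =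
      if j = 3 ∧ i = 3 then 1 else 0 := by
    intro i j x
    by_cases hj : j = 3
    · simp only [hj, if_true, true_and]
      unfold pd
      have h4 : HasFDerivAt (fun x : E => x 3) (EuclideanSpace.proj (𝕜 := ℝ) (3 : Fin 4)) x :=
        (EuclideanSpace.proj (𝕜 := ℝ) (3 : Fin 4)).hasFDerivAt
      rw [h4.fderiv]
      simp [eq_comm]
    · simp only [hj, if_false, false_and]
      exact pd_const 0
  have hpG : ∀ i j x, pd i (G j) x = smear (pd i a) ε (h j) x -
      ((if j = 3 ∧ i = 3 then 1 else 0) * S x + (if j = 3 then x 3 else 0) * pd i S x) := by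
    intro i j x
    have d1 := (hc3 j).differentiable one_ne_zero x
    have d2 := hS1.differentiable one_ne_zero x
    have d3 := (contDiff_smear (ε := ε) ha.continuous (hh j)).differentiable one_ne_zero x
    have d4 : DifferentiableAt ℝ (fun x : E => (if j = 3 then x 3 else 0) * S x) x := d1.mul d2
    refine (pd_sub d3 d4).trans ?_
    rw [pd_mul d1 d2, hpA, hpc]
  set I : ℝ := ∑ k, ∫ y in closedBall (0 : E) (P + ε), |h k y| with hI
  have hI0 : ∀ k, 0 ≤ ∫ y in closedBall (0 : E) (P + ε), |h k y| := fun k =>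
    integral_nonneg fun _ => abs_nonneg _
  have hIk : ∀ k, ∫ y in closedBall (0 : E) (P + ε), |h k y| ≤ I := fun k =>
    Finset.single_le_sum (f := fun k => ∫ y in closedBall (0 : E) (P + ε), |h k y|)
      (fun k _ => hI0 k) (Finset.mem_univ k)
  have hIn : 0 ≤ I := Finset.sum_nonneg fun k _ => hI0 k
  have hsm : ∀ (b : E → ℝ) (B : ℝ) (k : Fin 4) (x : E), (∀ p, |b p| ≤ B) → ‖x‖ ≤ P →
      |smear b ε (h k) x| ≤ B * I := fun b B k x hb hx =>
    (abs_smear_le hb (hh k).continuous hx).trans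
      (mul_le_mul_of_nonneg_left (hIk k) ((abs_nonneg _).trans (hb 0)))
  have hSb : ∀ x, ‖x‖ ≤ P → |S x| ≤ b1 * I := by
    intro x hx
    rw [hb1, Finset.sum_mul]
    exact (Finset.abs_sum_le_sum_abs _ _).trans
      (Finset.sum_le_sum fun k _ => hsm _ _ k x (hB1 k) hx)
  have hpSb : ∀ i x, ‖x‖ ≤ P → |pd i S x| ≤ b2 * I := by
    intro i x hx
    have h1 : ∑ k, B2 i k ≤ b2 := Finset.single_le_sum (f := fun i => ∑ k, B2 i k)
      (fun i _ => Finset.sum_nonneg fun k _ => hB20 i k) (Finset.mem_univ i)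
    refine le_trans ?_ (mul_le_mul_of_nonneg_right h1 hIn)
    rw [hpS, Finset.sum_mul]
    exact (Finset.abs_sum_le_sum_abs _ _).trans
      (Finset.sum_le_sum fun k _ => hsm _ _ k x (hB2 i k) hx)
  have hx3 : ∀ (j : Fin 4) (x : E), ‖x‖ ≤ P → |if j = 3 then x 3 else 0| ≤ P := by
    intro j x hx
    split_ifs
    · exact (abs_coord_le x 3).trans hx
    · simpa using hP
  have hB1b : ∀ i, B1 i ≤ b1 := fun i => Finset.single_le_sum (f := B1)
    (fun k _ => hB10 k) (Finset.mem_univ i)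
  refine ⟨G, fun j => (contDiff_smear ha.continuous (hh j)).sub ((hc3 j).mul hS1), fun x => ?_,
    fun j x hx => ?_, fun j x hx => ?_, fun i j x hx => ?_⟩
  · simp only [hpG]
    rw [Finset.sum_sub_distrib, Finset.sum_add_distrib]
    have h1 : ∑ i : Fin 4, (if i = 3 ∧ i = 3 then (1 : ℝ) else 0) * S x = S x := by simp
    have h2 : ∑ i : Fin 4, (if i = 3 then x 3 else 0) * pd i S x = 0 := by simp [hpS3]
    rw [h1, h2]
    simp [hS]
  · simp [hG, hx]
  · calc |G j x| ≤ |smear a ε (h j) x| + |if j = 3 then x 3 else 0| * |S x| := by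
          rw [hG, ← abs_mul]; exact abs_sub _ _
      _ ≤ B0 * I + P * (b1 * I) :=
          add_le_add (hsm _ _ j x hB0 hx) (mul_le_mul (hx3 j x hx) (hSb x hx) (abs_nonneg _) hP)
      _ ≤ _ := by
          have : 0 ≤ b1 * I := by positivity
          have : 0 ≤ P * (b2 * I) := by positivity
          linarith
  · calc |pd i (G j) x| ≤ |smear (pd i a) ε (h j) x| + (|S x| +
          |if j = 3 then x 3 else 0| * |pd i S x|) := by
          rw [hpG]
          refine (abs_sub _ _).trans (add_le_add le_rfl ((abs_add_le _ _).trans ?_))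
          rw [abs_mul, abs_mul]
          refine add_le_add ?_ le_rfl
          split_ifs <;> simp
      _ ≤ b1 * I + (b1 * I + P * (b2 * I)) := by
          refine add_le_add ?_ (add_le_add (hSb x hx)
            (mul_le_mul (hx3 j x hx) (hpSb i x hx) (abs_nonneg _) hP))
          exact (hsm _ _ j x (hB1 i) hx).trans (mul_le_mul_of_nonneg_right (hB1b i) hIn)
      _ ≤ _ := by
          have : 0 ≤ B0 * I := by positivity
          have : 0 ≤ P * (b1 * I) := by positivity
          linarith

end Lift

section Solution

/-- A solution of the steady Navier-Stokes system in the half space, in divergence form, with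
Dirichlet data away from the origin and critical decay. -/
structure IsSolution (C : ℝ) (u : Fin 4 → E → ℝ) (π : E → ℝ) : Prop where
  contDiffOn : ∀ j, ContDiffOn ℝ ∞ (u j) H
  contDiffOn_pressure : ContDiffOn ℝ 1 π H
  continuousOn : ∀ j, ContinuousOn (u j) {x | 0 ≤ x 3 ∧ x ≠ 0}
  eq_zero : ∀ j, ∀ x : E, x 3 = 0 → x ≠ 0 → u j x = 0
  bound : ∀ j, ∀ x ∈ H, |u j x| * ‖x‖ ≤ C
  momentum : ∀ x ∈ H, ∀ j, ∑ i, pd i (fun y => pd i (u j) y - u i y * u j y) x = pd j π x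
  divergence : ∀ x ∈ H, ∑ i, pd i (u i) x = 0

variable {C : ℝ} {u : Fin 4 → E → ℝ} {π : E → ℝ}

lemma ne_zero_of_mem_H {x : E} (hx : x ∈ H) : x ≠ 0 := by
  rintro rfl
  exact lt_irrefl (0 : ℝ) hx

lemma IsSolution.nonneg (hs : IsSolution C u π) : 0 ≤ C :=
  (mul_nonneg (abs_nonneg _) (norm_nonneg _)).trans
    (hs.bound 0 (e 3) (by simp [H]))

lemma IsSolution.abs_le (hs : IsSolution C u π) (j : Fin 4) {x : E} (hx : x ∈ H) :
    |u j x| ≤ C / ‖x‖ :=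
  (le_div_iff₀ (norm_pos_iff.2 (ne_zero_of_mem_H hx))).2 (hs.bound j x hx)

/-- The traces at height `τ` tend to zero off the origin. -/
lemma IsSolution.tendsto_flat (hs : IsSolution C u π) (j : Fin 4) {y : E} (hy : proj y ≠ 0) :
    Tendsto (fun τ => flat τ (u j) y) (𝓝[>] 0) (𝓝 0) := by
  have h3 : u j (proj y) = 0 := hs.eq_zero j _ (proj_three y) hy
  have h4 := hs.continuousOn j (proj y) ⟨(proj_three y).ge, hy⟩
  have h5 : Tendsto (fun τ : ℝ => proj y + τ • e 3) (𝓝[>] 0)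
      (𝓝[{x : E | 0 ≤ x 3 ∧ x ≠ 0}] (proj y)) := by
    refine tendsto_nhdsWithin_iff.2 ⟨?_, ?_⟩
    · have : Tendsto (fun τ : ℝ => proj y + τ • e 3) (𝓝 0) (𝓝 (proj y + (0 : ℝ) • e 3)) :=
        Continuous.tendsto (by fun_prop) 0
      simp only [zero_smul, add_zero] at this
      exact this.mono_left nhdsWithin_le_nhds
    · filter_upwards [self_mem_nhdsWithin] with τ hτ
      have := proj_add_mem hτ y
      exact ⟨le_of_lt this, ne_zero_of_mem_H this⟩
  have h6 := h4.tendsto.comp h5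
  rw [h3] at h6
  exact h6

lemma proj_ne_zero {y : E} (hy : y 0 ≠ 0) : proj y ≠ 0 := fun h => hy (by
  rw [← proj_apply_of_ne y (i := 0) (by decide), h]; simp)

/-- The traces at height `τ` tend to zero in `L¹`. -/
lemma IsSolution.tendsto_integral_flat (hs : IsSolution C u π) (j : Fin 4) (P : ℝ) :
    Tendsto (fun τ => ∫ y in closedBall (0 : E) P, |flat τ (u j) y|) (𝓝[>] 0) (𝓝 0) := by
  have h0 : ∫ _y in closedBall (0 : E) P, (0 : ℝ) = 0 := by simp
  suffices h : Tendsto (fun τ => ∫ y in closedBall (0 : E) P, |flat τ (u j) y|) (𝓝[>] 0)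
      (𝓝 (∫ _y in closedBall (0 : E) P, (0 : ℝ))) by rwa [h0] at h
  refine tendsto_integral_filter_of_dominated_convergence (fun y => C * (P * majorant y)) ?_ ?_
    (((integrableOn_majorant P).const_mul P).const_mul C) ?_
  · filter_upwards [self_mem_nhdsWithin] with τ hτ
    exact (contDiff_flat hτ ((hs.contDiffOn j).of_le (by simp))).continuous.abs.aestronglyMeasurable
  · filter_upwards [self_mem_nhdsWithin] with τ hτ
    filter_upwards [ae_restrict_mem measurableSet_closedBall,
      ae_restrict_of_ae ae_coord_ne_zero] with y hy h1
    have h2 : 0 < ‖proj y‖ := by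
      have := abs_coord_le (proj y) 0
      rw [proj_apply_of_ne y (by decide)] at this
      exact (abs_pos.2 (h1 0)).trans_le this
    have h3 : ‖proj y‖ ≤ ‖proj y + τ • e 3‖ := by
      have := norm_proj_le (proj y + τ • e 3)
      convert this using 2
      ext i
      simp [proj]
    rw [Real.norm_eq_abs, abs_abs]
    calc |flat τ (u j) y| ≤ C / ‖proj y + τ • e 3‖ := hs.abs_le j (proj_add_mem hτ y)
      _ ≤ C / ‖proj y‖ := by have := hs.nonneg; gcongr
      _ = C * ‖proj y‖⁻¹ := rfl
      _ ≤ _ := mul_le_mul_of_nonneg_left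
          (inv_norm_proj_le_majorant h1 (by simpa using hy)) hs.nonneg
  · filter_upwards [ae_restrict_of_ae ae_coord_ne_zero] with y h1
    simpa only [abs_zero] using (hs.tendsto_flat j (proj_ne_zero (h1 0))).abs

lemma IsSolution.integrableOn_sq (hs : IsSolution C u π) (j : Fin 4) (P : ℝ) :
    IntegrableOn (fun x => u j x ^ 2) (closedBall 0 P ∩ H) := by
  have hm : MeasurableSet (closedBall (0 : E) P ∩ H) :=
    measurableSet_closedBall.inter isOpen_H.measurableSet
  refine Integrable.mono' (g := fun x => C ^ 2 * majorant x) ?_ ?_ ?_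
  · exact ((integrableOn_majorant P).mono_set inter_subset_left).const_mul _
  · exact (((hs.contDiffOn j).continuousOn.mono inter_subset_right).pow 2).aestronglyMeasurable hm
  · filter_upwards [ae_restrict_mem hm, ae_restrict_of_ae ae_coord_ne_zero] with x hx h1
    have h2 : 0 < ‖x‖ := norm_pos_iff.2 (ne_zero_of_mem_H hx.2)
    rw [Real.norm_eq_abs, abs_pow]
    calc |u j x| ^ 2 ≤ (C / ‖x‖) ^ 2 := by gcongr; exact hs.abs_le j hx.2
      _ = C ^ 2 * (‖x‖ ^ 2)⁻¹ := by rw [div_pow]; rfl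
      _ ≤ _ := by gcongr; exact inv_norm_sq_le_majorant h1

end Solution

section Approximation

lemma exists_mollifier {ε : ℝ} (hε : 0 < ε) : ∃ a : E → ℝ, ContDiff ℝ ∞ a ∧ (∀ p, 0 ≤ a p) ∧
    tsupport a ⊆ closedBall 0 ε ∧ ∫ p in closedBall (0 : E) ε, a p = 1 := by
  let φ : ContDiffBump (0 : E) := ⟨ε / 2, ε, by positivity, by linarith⟩
  have h1 : tsupport (φ.normed volume) ⊆ closedBall 0 ε := (φ.tsupport_normed_eq (μ := volume)).subset
  refine ⟨φ.normed volume, φ.contDiff_normed, fun p => φ.nonneg_normed p, h1, ?_⟩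
  rw [setIntegral_eq_integral_of_forall_compl_eq_zero fun p hp =>
    image_eq_zero_of_notMem_tsupport fun h => hp (h1 h)]
  exact φ.integral_normed

lemma exists_uniform_step_family {ι : Type*} [Fintype ι] [Nonempty ι] {g : ι → E → ℝ}
    {k ρ₁ ρ₂ : ℝ} (hρ : 0 < ρ₁) (hg : ∀ i, ContinuousOn (g i) {x | k ≤ x 3 ∧ x ≠ 0}) {η : ℝ}
    (hη : 0 < η) :
    ∃ δ > 0, ∀ ε τ : ℝ, 0 ≤ ε → 0 ≤ τ → ε ≤ δ → τ ≤ δ → ∀ i, ∀ x : E, k ≤ x 3 → ρ₁ ≤ ‖x‖ →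
      ‖x‖ ≤ ρ₂ → ∀ p ∈ closedBall (0 : E) ε, |g i (x - lower τ p) - g i x| ≤ η := by
  choose δ hδ h using fun i => exists_uniform_step (ρ₂ := ρ₂) hρ (hg i) hη
  refine ⟨Finset.univ.inf' Finset.univ_nonempty δ, (Finset.lt_inf'_iff _).2 fun i _ => hδ i,
    fun ε τ h0 h1 h2 h3 i => h i ε τ h0 h1 ?_ ?_⟩
  · exact h2.trans (Finset.inf'_le _ (Finset.mem_univ i))
  · exact h3.trans (Finset.inf'_le _ (Finset.mem_univ i))

variable {C : ℝ} {u : Fin 4 → E → ℝ} {π : E → ℝ}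

lemma continuousOn_pd_H {f : E → ℝ} (hf : ContDiffOn ℝ 1 f H) (i : Fin 4) :
    ContinuousOn (pd i f) H :=
  (hf.continuousOn_fderiv_of_isOpen isOpen_H (by norm_num)).clm_apply continuousOn_const

lemma contDiffOn_pd_H {f : E → ℝ} (hf : ContDiffOn ℝ ∞ f H) (i : Fin 4) :
    ContDiffOn ℝ 1 (pd i f) H :=
  ((contDiffOn_infty.1 hf 2).fderiv_of_isOpen isOpen_H (by norm_num)).clm_apply contDiffOn_const

lemma integral_moll_sq_le {a g : E → ℝ} {ε τ P s : ℝ} (ha : Continuous a) (ha0 : ∀ p, 0 ≤ a p)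
    (ha1 : ∫ p in closedBall (0 : E) ε, a p = 1) (hg : ContinuousOn g H) (hτ : 0 < τ)
    (hs : ε + τ ≤ s) (hgi : IntegrableOn (fun x => g x ^ 2) (closedBall (0 : E) (P + s) ∩ H)) :
    IntegrableOn (fun x => moll a ε τ g x ^ 2) (closedBall (0 : E) P ∩ H) ∧
    ∫ x in closedBall (0 : E) P ∩ H, moll a ε τ g x ^ 2 ≤
      ∫ x in closedBall (0 : E) (P + s) ∩ H, g x ^ 2 := by
  have hi : IntegrableOn (fun x => moll a ε τ g x ^ 2) (closedBall (0 : E) P ∩ H) := by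
    have hc : IsCompact (closedBall (0 : E) P ∩ {x | 0 ≤ x 3}) :=
      (isCompact_closedBall _ _).inter_right
        (isClosed_le continuous_const (contDiff_coord 3).continuous)
    have : ContinuousOn (fun x => moll a ε τ g x ^ 2) (closedBall (0 : E) P ∩ {x | 0 ≤ x 3}) :=
      ((continuousOn_moll ha hg).mono fun x hx => by
        have : 0 ≤ x 3 := hx.2
        change -τ < x 3
        linarith).pow 2
    exact (this.integrableOn_compact hc).mono_set
      (inter_subset_inter_right _ fun x (hx : 0 < x 3) => (hx.le : 0 ≤ x 3))
  refine ⟨hi, ?_⟩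
  have h1 : 0 ≤ ∫ x in closedBall (0 : E) (P + s) ∩ H, g x ^ 2 :=
    integral_nonneg fun _ => sq_nonneg _
  rw [← ENNReal.ofReal_le_ofReal_iff h1, ofReal_integral_sq hi, ofReal_integral_sq hgi]
  refine (lintegral_moll_sq_le ha ha0 ha1 hg hτ.le).trans (lintegral_mono_set ?_)
  exact inter_subset_inter_left _ (closedBall_subset_closedBall (by linarith))

/-- Smooth solenoidal approximation of a solution up to the boundary, together with an
approximate stress. -/
theorem IsSolution.exists_smooth_approx (hs : IsSolution C u π) {ρ₁ ρ₂ k P s η : ℝ} (hρ : 0 < ρ₁)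
    (hP : 0 ≤ P) (hρP : ρ₂ ≤ P) (hk : 0 < k) (hs0 : 0 < s) (hη : 0 < η) :
    ∃ τ > 0, ∃ (U : Fin 4 → E → ℝ) (F : Fin 4 → Fin 4 → E → ℝ),
      (∀ j, ContDiffOn ℝ 1 (U j) {x | -τ < x 3}) ∧
      (∀ x : E, -τ < x 3 → ∑ i, pd i (U i) x = 0) ∧
      (∀ j, ∀ x : E, x 3 = 0 → U j x = 0) ∧
      (∀ i j, ContinuousOn (F i j) {x | -τ < x 3}) ∧
      (∀ w : Fin 4 → E → ℝ, (∀ j, ContDiff ℝ 1 (w j)) → (∀ j, HasCompactSupport (w j)) →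
        (∀ j, ∀ x : E, x 3 ≤ 0 → w j x = 0) → (∀ x, ∑ j, pd j (w j) x = 0) →
        ∑ i, ∑ j, ∫ x, F i j x * pd i (w j) x = 0) ∧
      (∀ j, ∀ x : E, 0 ≤ x 3 → ρ₁ ≤ ‖x‖ → ‖x‖ ≤ ρ₂ → |U j x - u j x| ≤ η) ∧
      (∀ i j, ∀ x : E, 0 < x 3 → ρ₁ ≤ ‖x‖ → ‖x‖ ≤ ρ₂ →
        |F i j x - (pd i (U j) x - u i x * u j x)| ≤ η) ∧
      (∀ i j, ∀ x : E, k ≤ x 3 → ρ₁ ≤ ‖x‖ → ‖x‖ ≤ ρ₂ → |pd i (U j) x - pd i (u j) x| ≤ η) ∧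
      ∀ j, ∀ P' ≤ P, ∫ x in closedBall (0 : E) P' ∩ H, U j x ^ 2 ≤
        2 * (∫ x in closedBall (0 : E) (P' + s) ∩ H, u j x ^ 2) + η := by
  set vol : ℝ := volume.real (closedBall (0 : E) P) with hvol
  have hvol0 : 0 ≤ vol := measureReal_nonneg
  obtain ⟨η', hη', hη1, hη2⟩ : ∃ η' > 0, 2 * η' ≤ η ∧ 2 * (vol * η' ^ 2) ≤ η := by
    refine ⟨min (min (η / 2) 1) (η / (2 * (vol + 1))), by positivity, ?_, ?_⟩
    · have := (min_le_left (min (η / 2) 1) (η / (2 * (vol + 1)))).trans (min_le_left _ _)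
      linarith
    · set m := min (min (η / 2) 1) (η / (2 * (vol + 1))) with hm
      have hm0 : 0 < m := by positivity
      have h1 : m ≤ 1 := (min_le_left _ _).trans (min_le_right _ _)
      have h2 : m ≤ η / (2 * (vol + 1)) := min_le_right _ _
      have h3 : m * (2 * (vol + 1)) ≤ η := (le_div_iff₀ (by positivity)).1 h2
      have h4 : vol * m ^ 2 ≤ vol * m := by gcongr; nlinarith
      nlinarith
  have hu1 : ∀ j, ContDiffOn ℝ 1 (u j) H := fun j => (hs.contDiffOn j).of_le (by simp)
  have hpu : ∀ i j, ContDiffOn ℝ 1 (pd i (u j)) H := fun i j => contDiffOn_pd_H (hs.contDiffOn j) i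
  have huu : ∀ i j, ContDiffOn ℝ 1 (fun x => u i x * u j x) H := fun i j => (hu1 i).mul (hu1 j)
  obtain ⟨δ₁, hδ₁, h₁⟩ := exists_uniform_step_family (ρ₂ := ρ₂) hρ hs.continuousOn hη'
  obtain ⟨δ₂, hδ₂, h₂⟩ := exists_uniform_step_family (ρ₂ := ρ₂)
    (g := fun (i : Fin 4 × Fin 4) x => u i.1 x * u i.2 x) hρ
    (fun i => (hs.continuousOn i.1).mul (hs.continuousOn i.2)) hη'
  obtain ⟨δ₃, hδ₃, h₃⟩ := exists_uniform_step_family (ρ₂ := ρ₂) (k := k)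
    (g := fun (i : Fin 4 × Fin 4) => pd i.1 (u i.2)) hρ
    (fun i => (hpu i.1 i.2).continuousOn.mono fun x hx => hk.trans_le hx.1) hη'
  set ε := min (min δ₁ δ₂) (min δ₃ (s / 2)) with hε
  have hε0 : 0 < ε := by positivity
  obtain ⟨a, ha, ha0, has, ha1⟩ := exists_mollifier hε0
  obtain ⟨N, hN0, hN⟩ := exists_lift ha has hP
  have hlim : Tendsto (fun τ => N * ∑ j, ∫ y in closedBall (0 : E) (P + ε), |flat τ (u j) y|)
      (𝓝[>] 0) (𝓝 0) := by
    have := (tendsto_finsetSum Finset.univ fun j _ =>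
      hs.tendsto_integral_flat j (P + ε)).const_mul N
    simpa using this
  obtain ⟨τ, hτε, hτ0, hτη⟩ : ∃ τ : ℝ, τ ≤ ε ∧ 0 < τ ∧
      N * ∑ j, ∫ y in closedBall (0 : E) (P + ε), |flat τ (u j) y| ≤ η' := by
    have e1 : ∀ᶠ τ : ℝ in 𝓝[>] 0, τ ≤ ε :=
      nhdsWithin_le_nhds (Iic_mem_nhds hε0)
    have e2 : ∀ᶠ τ : ℝ in 𝓝[>] 0, 0 < τ := self_mem_nhdsWithin
    exact (e1.and (e2.and (hlim.eventually_le_const hη'))).exists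
  have hε1 : ε ≤ δ₁ := (min_le_left _ _).trans (min_le_left _ _)
  have hε2 : ε ≤ δ₂ := (min_le_left _ _).trans (min_le_right _ _)
  have hε3 : ε ≤ δ₃ := (min_le_right _ _).trans (min_le_left _ _)
  have hεs : ε + τ ≤ s := by
    have : ε ≤ s / 2 := (min_le_right _ _).trans (min_le_right _ _)
    linarith
  have hac := ha.continuous
  obtain ⟨G, hG1, hGdiv, hG0, hGb, hpGb⟩ := hN (fun j => flat τ (u j))
    (fun j => contDiff_flat hτ0 (hu1 j)) (fun j x => pd_three_flat hτ0 (hu1 j) x)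
  have hGη : ∀ j x, ‖x‖ ≤ P → |G j x| ≤ η' := fun j x hx => (hGb j x hx).trans hτη
  have hpGη : ∀ i j x, ‖x‖ ≤ P → |pd i (G j) x| ≤ η' := fun i j x hx => (hpGb i j x hx).trans hτη
  set M : (E → ℝ) → E → ℝ := moll a ε τ with hM
  have hMd : ∀ j, ∀ x : E, -τ < x 3 → DifferentiableAt ℝ (M (u j)) x := fun j x hx =>
    differentiableAt_above (contDiffOn_moll hac (hu1 j)) hx
  have hpd : ∀ i j, ∀ x : E, -τ < x 3 →
      pd i (fun x => M (u j) x - G j x) x = M (pd i (u j)) x - pd i (G j) x := fun i j x hx => by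
    rw [pd_sub (hMd j x hx) ((hG1 j).differentiable one_ne_zero x), hM, pd_moll hac (hu1 j) i hx]
  refine ⟨τ, hτ0, fun j x => M (u j) x - G j x,
    fun i j => M (fun x => pd i (u j) x - u i x * u j x), ?_, ?_, ?_, ?_, ?_, ?_, ?_, ?_, ?_⟩
  · exact fun j => (contDiffOn_moll hac (hu1 j)).sub (hG1 j).contDiffOn
  · intro x hx
    simp only [hpd _ _ x hx]
    rw [Finset.sum_sub_distrib, hGdiv, hM,
      ← moll_sum hac (fun i => continuousOn_pd_H (hu1 i) i) hx,
      moll_congr (g := fun _ => 0) (fun y hy => hs.divergence y hy) hx]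
    simp [moll]
  · intro j x hx
    simp only [hG0 j x hx, smear_flat a ε hx, hM, sub_self]
  · exact fun i j => continuousOn_moll hac ((hpu i j).sub (huu i j)).continuousOn
  · intro w hw hwc hw0 hwd
    exact sum_integral_moll_stress hac hτ0 (fun i j => (hpu i j).sub (huu i j))
      hs.contDiffOn_pressure hs.momentum hw hwc hw0 hwd
  · intro j x hx hx1 hx2
    have h4 := abs_moll_sub_le hac ha0 ha1 (hu1 j).continuousOn (show -τ < x 3 by linarith)
      (h₁ ε τ hε0.le hτ0.le hε1 (hτε.trans hε1) j x hx hx1 hx2)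
    have h5 := hGη j x (hx2.trans hρP)
    calc |M (u j) x - G j x - u j x| = |(M (u j) x - u j x) - G j x| := by congr 1; ring
      _ ≤ η' + η' := (abs_sub _ _).trans (add_le_add h4 h5)
      _ ≤ η := by linarith
  · intro i j x hx hx1 hx2
    have hx' : -τ < x 3 := by linarith
    have h4 := abs_moll_sub_le hac ha0 ha1 (huu i j).continuousOn hx'
      (h₂ ε τ hε0.le hτ0.le hε2 (hτε.trans hε2) (i, j) x hx.le hx1 hx2)
    have h5 := hpGη i j x (hx2.trans hρP)
    rw [hpd i j x hx']
    change |moll a ε τ (fun x => pd i (u j) x - u i x * u j x) x - _| ≤ η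
    rw [moll_sub hac (hpu i j).continuousOn (huu i j).continuousOn hx', hM]
    set m := moll a ε τ (fun x => u i x * u j x) x
    calc _ = |pd i (G j) x - (m - u i x * u j x)| := by congr 1; ring
      _ ≤ η' + η' := (abs_sub _ _).trans (add_le_add h5 h4)
      _ ≤ η := by linarith
  · intro i j x hx hx1 hx2
    have hx' : -τ < x 3 := by linarith
    have h4 := abs_moll_sub_le hac ha0 ha1 (hpu i j).continuousOn hx'
      (h₃ ε τ hε0.le hτ0.le hε3 (hτε.trans hε3) (i, j) x hx hx1 hx2)
    have h5 := hpGη i j x (hx2.trans hρP)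
    rw [hpd i j x hx']
    calc _ = |(M (pd i (u j)) x - pd i (u j) x) - pd i (G j) x| := by congr 1; ring
      _ ≤ η' + η' := (abs_sub _ _).trans (add_le_add h4 h5)
      _ ≤ η := by linarith
  · intro j P' hP'
    obtain ⟨hi, hle⟩ := integral_moll_sq_le hac ha0 ha1 (hu1 j).continuousOn hτ0 hεs
      (hs.integrableOn_sq j (P' + s))
    have hfin : volume (closedBall (0 : E) P' ∩ H) ≠ ⊤ :=
      ((measure_mono inter_subset_left).trans_lt measure_closedBall_lt_top).ne
    have hm : MeasurableSet (closedBall (0 : E) P' ∩ H) :=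
      measurableSet_closedBall.inter isOpen_H.measurableSet
    have hc : IntegrableOn (fun _ : E => 2 * η' ^ 2) (closedBall (0 : E) P' ∩ H) :=
      integrableOn_const hfin
    have h5 : Integrable (fun x => 2 * M (u j) x ^ 2 + 2 * η' ^ 2)
        (volume.restrict (closedBall (0 : E) P' ∩ H)) := (hi.const_mul 2).add hc
    calc _ ≤ ∫ x in closedBall (0 : E) P' ∩ H, (2 * M (u j) x ^ 2 + 2 * η' ^ 2) := by
          refine integral_mono_of_nonneg (ae_of_all _ fun x => sq_nonneg _) h5 ?_
          filter_upwards [ae_restrict_mem hm] with x hx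
          have h6 := hGη j x ((mem_closedBall_zero_iff.1 hx.1).trans hP')
          have h7 : G j x ^ 2 ≤ η' ^ 2 := sq_le_sq.2 (h6.trans (le_abs_self _))
          nlinarith [sq_nonneg (M (u j) x + G j x)]
      _ = 2 * (∫ x in closedBall (0 : E) P' ∩ H, M (u j) x ^ 2) +
          volume.real (closedBall (0 : E) P' ∩ H) * (2 * η' ^ 2) := by
          rw [integral_add (hi.const_mul 2) hc, integral_const_mul, setIntegral_const, smul_eq_mul]
      _ ≤ _ := by
          have h8 : volume.real (closedBall (0 : E) P' ∩ H) ≤ vol :=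
            measureReal_mono (inter_subset_left.trans (closedBall_subset_closedBall hP'))
              measure_closedBall_lt_top.ne
          have h9 : volume.real (closedBall (0 : E) P' ∩ H) * (2 * η' ^ 2) ≤
              vol * (2 * η' ^ 2) := by gcongr
          have : ∫ x in closedBall (0 : E) P' ∩ H, M (u j) x ^ 2 ≤
            ∫ x in closedBall (0 : E) (P' + s) ∩ H, u j x ^ 2 := hle
          linarith

end Approximation

section Perturbation

/-- The part of a dyadic shell that lies in the half space. -/
def halfShell (r R : ℝ) : Set E := H ∩ (closedBall 0 (2 * R) \ ball 0 (r / 2))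

lemma integrableOn_halfShell {f : E → ℝ} {r R : ℝ} (hf : ContinuousOn f {x | 0 ≤ x 3}) :
    IntegrableOn f (halfShell r R) := by
  have hc : IsCompact (closedBall (0 : E) (2 * R) ∩ {x | 0 ≤ x 3}) :=
    (isCompact_closedBall _ _).inter_right
      (isClosed_le continuous_const (contDiff_coord 3).continuous)
  exact ((hf.mono inter_subset_right).integrableOn_compact hc).mono_set
    fun x hx => ⟨hx.2.1, le_of_lt (show 0 < x 3 from hx.1)⟩

lemma setIntegral_halfShell_eq {f g : E → ℝ} {i : Fin 4} {r R : ℝ}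
    (hgs : tsupport g ⊆ closedBall 0 (2 * R) \ ball 0 (r / 2))
    (hg0 : ∀ x : E, x 3 ≤ 0 → g x = 0) :
    ∫ x in halfShell r R, f x * pd i g x = ∫ x, f x * pd i g x := by
  refine setIntegral_eq_integral_of_ae_compl_eq_zero ?_
  filter_upwards [ae_coord_ne_zero] with x hx hxS
  rw [pd_eq_zero_of_notMem (f := g), mul_zero]
  intro h
  have h1 : 0 ≤ x 3 := tsupport_subset_of_eq_zero hg0 h
  exact hxS ⟨lt_of_le_of_ne h1 (hx 3).symm, hgs h⟩

/-- A field whose stress is close to a weakly solenoidal one satisfies the perturbed weak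
inequality. -/
lemma weakIneq_of_stress {r R Q τ : ℝ} {V : Fin 4 → E → ℝ} {F : Fin 4 → Fin 4 → E → ℝ}
    (hτ : 0 < τ) (hV : ∀ j, ContDiff ℝ 1 (V j)) (hF : ∀ i j, ContinuousOn (F i j) {x | -τ < x 3})
    (hFw : ∀ w : Fin 4 → E → ℝ, (∀ j, ContDiff ℝ 1 (w j)) → (∀ j, HasCompactSupport (w j)) →
        (∀ j, ∀ x : E, x 3 ≤ 0 → w j x = 0) → (∀ x, ∑ j, pd j (w j) x = 0) →
        ∑ i, ∑ j, ∫ x, F i j x * pd i (w j) x = 0)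
    (hQ : ∑ i, ∑ j, ∫ x in halfShell r R, (pd i (V j) x - V i x * V j x - F i j x) ^ 2 ≤ Q) :
    WeakIneq r R Q V := by
  intro w hw hws hwd hw0
  have hwc : ∀ j, HasCompactSupport (w j) := fun j =>
    (isCompact_closedBall (0 : E) (2 * R)).of_isClosed_subset (isClosed_tsupport _)
      ((hws j).trans sdiff_subset)
  have hF' : ∀ i j, ContinuousOn (F i j) {x | 0 ≤ x 3} := fun i j => (hF i j).mono
    fun x (hx : 0 ≤ x 3) => show -τ < x 3 by linarith
  have hVc : ∀ j, Continuous (V j) := fun j => (hV j).continuous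
  have hpV : ∀ i j, Continuous (pd i (V j)) := fun i j => continuous_pd (hV j)
  have hpw : ∀ i j, Continuous (pd i (w j)) := fun i j => continuous_pd (hw j)
  set G : Fin 4 → Fin 4 → E → ℝ := fun i j x => pd i (V j) x - V i x * V j x - F i j x with hG
  have hGc : ∀ i j, ContinuousOn (G i j) {x | 0 ≤ x 3} := fun i j =>
    (((hpV i j).sub ((hVc i).mul (hVc j))).continuousOn).sub (hF' i j)
  have hsq : ∀ i j, ∫ x in halfShell r R, pd i (w j) x ^ 2 = ∫ x, pd i (w j) x ^ 2 := fun i j => by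
    simpa only [sq] using setIntegral_halfShell_eq (f := pd i (w j)) (i := i) (hws j) (hw0 j)
  have key : ∀ i j, ∫ x, (pd i (V j) x - V i x * V j x) * pd i (w j) x ≤
      (∫ x in halfShell r R, G i j x ^ 2) + 1 / 4 * (∫ x, pd i (w j) x ^ 2) +
        ∫ x, F i j x * pd i (w j) x := by
    intro i j
    have m1 : Integrable (fun x => G i j x ^ 2) (volume.restrict (halfShell r R)) :=
      integrableOn_halfShell ((hGc i j).pow 2)
    have m2 : Integrable (fun x => 1 / 4 * pd i (w j) x ^ 2) (volume.restrict (halfShell r R)) :=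
      integrableOn_halfShell (((hpw i j).pow 2).const_mul (1 / 4)).continuousOn
    have m3 : Integrable (fun x => F i j x * pd i (w j) x) (volume.restrict (halfShell r R)) :=
      integrableOn_halfShell ((hF' i j).mul (hpw i j).continuousOn)
    have m12 : Integrable (fun x => G i j x ^ 2 + 1 / 4 * pd i (w j) x ^ 2)
      (volume.restrict (halfShell r R)) := m1.add m2
    have m4 : Integrable (fun x => (pd i (V j) x - V i x * V j x) * pd i (w j) x)
        (volume.restrict (halfShell r R)) :=
      integrableOn_halfShell (((hpV i j).sub ((hVc i).mul (hVc j))).mul (hpw i j)).continuousOn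
    rw [← setIntegral_halfShell_eq (hws j) (hw0 j), ← setIntegral_halfShell_eq (hws j) (hw0 j),
      ← hsq, ← integral_const_mul, ← integral_add m1 m2, ← integral_add m12 m3]
    refine integral_mono m4 (m12.add m3) fun x => ?_
    simp only [hG]
    nlinarith [sq_nonneg (pd i (V j) x - V i x * V j x - F i j x - 1 / 2 * pd i (w j) x)]
  have hsum := Finset.sum_le_sum fun i (_ : i ∈ Finset.univ) =>
    Finset.sum_le_sum fun j (_ : j ∈ Finset.univ) => key i j
  simp only [Finset.sum_add_distrib, ← Finset.mul_sum] at hsum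
  rw [hFw w hw hwc hw0 hwd] at hsum
  linarith

lemma eventually_le_of_continuous {f : ℝ → ℝ} (hf : Continuous f) (h0 : f 0 = 0) {c : ℝ}
    (hc : 0 < c) : ∀ᶠ t in 𝓝[>] 0, f t ≤ c := by
  have : Tendsto f (𝓝[>] 0) (𝓝 0) := by
    simpa only [h0] using (hf.tendsto 0).mono_left nhdsWithin_le_nhds
  exact this.eventually_le_const hc

lemma tendsto_volume_strip (P : ℝ) :
    Tendsto (fun κ => volume.real (closedBall (0 : E) P ∩ {x | 0 < x 3 ∧ x 3 ≤ κ})) (𝓝[>] 0)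
      (𝓝 0) := by
  have h1 := tendsto_measure_biInter_gt (μ := volume) (a := (0 : ℝ))
    (s := fun κ : ℝ => closedBall (0 : E) P ∩ {x | 0 < x 3 ∧ x 3 ≤ κ}) ?_ ?_ ?_
  · have h2 : ⋂ κ > (0 : ℝ), (closedBall (0 : E) P ∩ {x | 0 < x 3 ∧ x 3 ≤ κ}) = ∅ := by
      refine eq_empty_of_forall_notMem fun x hx => ?_
      simp only [mem_iInter] at hx
      have h3 := (hx 1 one_pos).2.1
      have h4 := (hx (x 3 / 2) (by positivity)).2.2
      linarith
    rw [h2, measure_empty] at h1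
    exact (ENNReal.tendsto_toReal ENNReal.zero_ne_top).comp h1
  · intro κ _
    have hc := (contDiff_coord 3).continuous
    exact (measurableSet_closedBall.inter ((isOpen_lt continuous_const hc).measurableSet.inter
      (isClosed_le hc continuous_const).measurableSet)).nullMeasurableSet
  · exact fun κ κ' _ h x hx => ⟨hx.1, hx.2.1, hx.2.2.trans h⟩
  · exact ⟨1, one_pos, ((measure_mono inter_subset_left).trans_lt measure_closedBall_lt_top).ne⟩

end Perturbation

section Approximation

lemma integral_sq_le_add_strip {f : E → ℝ} {r R κ a b : ℝ}
    (hf : IntegrableOn (fun x => f x ^ 2) (halfShell r R))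
    (ha : ∀ x ∈ halfShell r R, κ < x 3 → |f x| ≤ a)
    (hb : ∀ x ∈ halfShell r R, x 3 ≤ κ → |f x| ≤ b) :
    ∫ x in halfShell r R, f x ^ 2 ≤ a ^ 2 * volume.real (closedBall (0 : E) (2 * R)) +
      b ^ 2 * volume.real (closedBall (0 : E) (2 * R) ∩ {x | 0 < x 3 ∧ x 3 ≤ κ}) := by
  have hc := (contDiff_coord 3).continuous
  have hT : MeasurableSet {x : E | κ < x 3} := (isOpen_lt continuous_const hc).measurableSet
  have hball : volume (closedBall (0 : E) (2 * R)) ≠ ⊤ := measure_closedBall_lt_top.ne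
  have s1 : halfShell r R ∩ {x | κ < x 3} ⊆ closedBall 0 (2 * R) := fun x hx => hx.1.2.1
  have s2 : halfShell r R \ {x | κ < x 3} ⊆ closedBall 0 (2 * R) ∩ {x | 0 < x 3 ∧ x 3 ≤ κ} :=
    fun x hx => ⟨hx.1.2.1, hx.1.1, not_lt.1 hx.2⟩
  have h2 : volume (closedBall (0 : E) (2 * R) ∩ {x | 0 < x 3 ∧ x 3 ≤ κ}) ≠ ⊤ :=
    ((measure_mono inter_subset_left).trans_lt measure_closedBall_lt_top).ne
  rw [← integral_inter_add_sdiff hT hf]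
  refine add_le_add ?_ ?_
  · refine (Real.le_norm_self _).trans ((norm_setIntegral_le_of_norm_le_const (C := a ^ 2)
      ((measure_mono s1).trans_lt measure_closedBall_lt_top) fun x hx => ?_).trans ?_)
    · rw [Real.norm_eq_abs, abs_pow]
      have := ha x hx.1 hx.2
      gcongr
    · gcongr
  · refine (Real.le_norm_self _).trans ((norm_setIntegral_le_of_norm_le_const (C := b ^ 2)
      ((measure_mono (s2.trans inter_subset_left)).trans_lt measure_closedBall_lt_top)
      fun x hx => ?_).trans ?_)
    · rw [Real.norm_eq_abs, abs_pow]
      have := hb x hx.1 (not_lt.1 hx.2)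
      gcongr
    · gcongr

variable {C : ℝ} {u : Fin 4 → E → ℝ} {π : E → ℝ}

/-- Approximation of a solution by globally defined solenoidal fields vanishing in the lower half
space. -/
theorem IsSolution.exists_approx (hs : IsSolution C u π) {r R k q : ℝ} (hr : 0 < r) (hrR : r ≤ R)
    (hk : 0 < k) (hq : 0 < q) :
    ∃ V : Fin 4 → E → ℝ, (∀ j, ContDiff ℝ 1 (V j)) ∧ (∀ x, ∑ i, pd i (V i) x = 0) ∧
      (∀ j, ∀ x : E, x 3 ≤ 0 → V j x = 0) ∧
      (∀ x ∈ annulus (r / 2) ∪ annulus R, ∀ j, |V j x| * ‖x‖ ≤ C + 1) ∧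
      WeakIneq r R q V ∧
      (∀ a, r / 2 ≤ a → a ≤ R → ∀ j, mass a (V j) ≤
        2 * ((a ^ 2)⁻¹ * ∫ x in closedBall (0 : E) (9 * a) ∩ H, u j x ^ 2) + q) ∧
      ∀ i j, ∀ x : E, k ≤ x 3 → r ≤ ‖x‖ → ‖x‖ ≤ R → |pd i (V j) x - pd i (u j) x| ≤ q := by
  have hR : 0 < R := hr.trans_le hrR
  have hC := hs.nonneg
  have hr2 : 0 < r / 2 := by positivity
  set vol : ℝ := volume.real (closedBall (0 : E) (2 * R)) with hvol
  set vol' : ℝ := volume.real (closedBall (0 : E) (8 * R)) with hvol'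
  set D : ℝ := 2 * (C / (r / 2)) + 2 with hD
  have hD0 : 0 < D := by positivity
  obtain ⟨η, hη, hη1, hηR, hηq, hηm, hηe⟩ : ∃ η : ℝ, 0 < η ∧ η ≤ 1 ∧ η * (2 * R) ≤ 1 ∧ η ≤ q ∧
      ((r / 2) ^ 2)⁻¹ * η ≤ q / 2 ∧ 16 * ((D * η) ^ 2 * vol) ≤ q / 2 := by
    have e0 : ∀ᶠ η : ℝ in 𝓝[>] 0, 0 < η := self_mem_nhdsWithin
    have e1 := eventually_le_of_continuous (f := fun η => η) continuous_id rfl one_pos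
    have e2 := eventually_le_of_continuous (f := fun η => η * (2 * R)) (by fun_prop) (by simp)
      one_pos
    have e3 := eventually_le_of_continuous (f := fun η => η) continuous_id rfl hq
    have e4 := eventually_le_of_continuous (f := fun η => ((r / 2) ^ 2)⁻¹ * η) (by fun_prop)
      (by simp) (half_pos hq)
    have e5 := eventually_le_of_continuous (f := fun η => 16 * ((D * η) ^ 2 * vol)) (by fun_prop)
      (by simp) (half_pos hq)
    exact (e0.and (e1.and (e2.and (e3.and (e4.and e5))))).exists
  obtain ⟨τ, hτ, U, F, hU, hUd, hU0, hF, hFw, hUu, hFU, hpU, hUm⟩ :=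
    hs.exists_smooth_approx (ρ₁ := r / 2) (ρ₂ := 2 * R) (k := k) (P := 8 * R) (s := r / 2) hr2
      (by positivity) (by linarith) hk hr2 hη
  obtain ⟨B, hB, hpio⟩ := exists_piola (neg_neg_of_pos hτ) hU hUd hU0 (8 * R)
  have hF0 : ∃ b, 0 ≤ b ∧ ∀ i j, ∀ x : E, 0 ≤ x 3 → ‖x‖ ≤ 2 * R → |F i j x| ≤ b := by
    have hc : IsCompact (closedBall (0 : E) (2 * R) ∩ {x | 0 ≤ x 3}) :=
      (isCompact_closedBall _ _).inter_right
        (isClosed_le continuous_const (contDiff_coord 3).continuous)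
    choose b hb using fun i j => hc.exists_bound_of_continuousOn ((hF i j).mono
      fun x hx => show -τ < x 3 from (neg_neg_of_pos hτ).trans_le hx.2)
    refine ⟨∑ i, ∑ j, |b i j|, by positivity, fun i j x hx hxR => ?_⟩
    refine ((hb i j x ⟨mem_closedBall_zero_iff.2 hxR, hx⟩).trans (le_abs_self _)).trans ?_
    exact (Finset.single_le_sum (f := fun j => |b i j|) (fun _ _ => abs_nonneg _)
      (Finset.mem_univ j)).trans (Finset.single_le_sum (f := fun i => ∑ j, |b i j|)
      (fun _ _ => Finset.sum_nonneg fun _ _ => abs_nonneg _) (Finset.mem_univ i))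
  obtain ⟨b, hb0, hFb⟩ := hF0
  set D' : ℝ := B + B * B + b with hD'
  obtain ⟨κ, hκ, hκ1, hκk, hκR, hκm, hκe⟩ : ∃ κ : ℝ, 0 < κ ∧ κ ≤ 1 ∧ κ ≤ k / 2 ∧
      B * κ * (2 * R) ≤ 1 ∧ ((r / 2) ^ 2)⁻¹ * ((B * κ) ^ 2 * vol') ≤ q / 2 ∧
      16 * (D' ^ 2 * volume.real (closedBall (0 : E) (2 * R) ∩ {x | 0 < x 3 ∧ x 3 ≤ κ})) ≤
        q / 2 := by
    have e0 : ∀ᶠ κ : ℝ in 𝓝[>] 0, 0 < κ := self_mem_nhdsWithin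
    have e1 := eventually_le_of_continuous (f := fun κ => κ) continuous_id rfl one_pos
    have e2 := eventually_le_of_continuous (f := fun κ => κ) continuous_id rfl (half_pos hk)
    have e3 := eventually_le_of_continuous (f := fun κ => B * κ * (2 * R)) (by fun_prop) (by simp)
      one_pos
    have e4 := eventually_le_of_continuous
      (f := fun κ => ((r / 2) ^ 2)⁻¹ * ((B * κ) ^ 2 * vol')) (by fun_prop) (by simp) (half_pos hq)
    have e5 := (((tendsto_volume_strip (2 * R)).const_mul (D' ^ 2)).const_mul 16)
    rw [mul_zero, mul_zero] at e5
    exact (e0.and (e1.and (e2.and (e3.and (e4.and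
      (e5.eventually_le_const (half_pos hq))))))).exists
  obtain ⟨V, hV, hVd, hV0, hVU, hVb, hpVb⟩ := hpio κ hκ hκ1
  have hBκ : B * κ ≤ B := mul_le_of_le_one_right hB.le hκ1
  have hpVU : ∀ i j, ∀ x : E, κ < x 3 → pd i (V j) x = pd i (U j) x := fun i j x hx => by
    refine pd_congr ?_
    filter_upwards [(isOpen_above κ).mem_nhds hx] with y hy using hVU j y hy
  refine ⟨V, hV, hVd, hV0, ?_, ?_, ?_, ?_⟩
  · intro x hx j
    obtain ⟨hx1, hx2⟩ : r / 2 ≤ ‖x‖ ∧ ‖x‖ ≤ 2 * R := by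
      rcases hx with hx | hx <;> rw [mem_annulus] at hx <;> constructor <;> linarith
    rcases lt_or_ge κ (x 3) with h | h
    · have hx0 : 0 < x 3 := hκ.trans h
      rw [hVU j x h]
      have h1 := hUu j x hx0.le hx1 hx2
      have h2 := hs.bound j x hx0
      have h3 : |U j x| ≤ |u j x| + η := by
        have := abs_add_le (U j x - u j x) (u j x)
        rw [sub_add_cancel] at this
        linarith
      have h4 : η * ‖x‖ ≤ η * (2 * R) := by gcongr
      nlinarith [norm_nonneg x]
    · have h1 : |V j x| ≤ B * κ := hVb j x (by linarith) h
      have h4 : |V j x| * ‖x‖ ≤ B * κ * (2 * R) := by gcongr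
      linarith
  · refine weakIneq_of_stress hτ hV hF hFw ?_
    have hcl : ∀ i j, ContinuousOn (fun x => (pd i (V j) x - V i x * V j x - F i j x) ^ 2)
        {x | 0 ≤ x 3} := fun i j =>
      ((((continuous_pd (hV j)).sub ((hV i).continuous.mul (hV j).continuous)).continuousOn).sub
        ((hF i j).mono fun x (hx : 0 ≤ x 3) => show -τ < x 3 by linarith)).pow 2
    have hij : ∀ i j, ∫ x in halfShell r R, (pd i (V j) x - V i x * V j x - F i j x) ^ 2 ≤
        (D * η) ^ 2 * vol +
        D' ^ 2 * volume.real (closedBall (0 : E) (2 * R) ∩ {x | 0 < x 3 ∧ x 3 ≤ κ}) := by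
      intro i j
      refine integral_sq_le_add_strip (integrableOn_halfShell (hcl i j)) (fun x hx h => ?_)
        fun x hx h => ?_
      all_goals
        have hx0 : 0 < x 3 := hx.1
        have hx2 : ‖x‖ ≤ 2 * R := mem_closedBall_zero_iff.1 hx.2.1
        have hx1 : r / 2 ≤ ‖x‖ := by simpa using hx.2.2
      · rw [hVU i x h, hVU j x h, hpVU i j x h]
        have hb : ∀ l, |u l x| ≤ C / (r / 2) := fun l => (hs.abs_le l hx0).trans (by gcongr)
        have h1 := hUu i x hx0.le hx1 hx2
        have h2 := hUu j x hx0.le hx1 hx2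
        have h3 := hFU i j x hx0 hx1 hx2
        have hbi := hb i
        have hbj := hb j
        have h4 : |U i x * U j x - u i x * u j x| ≤ η * (2 * (C / (r / 2)) + 1) := by
          calc |U i x * U j x - u i x * u j x|
              = |(U i x - u i x) * (U j x - u j x) + (U i x - u i x) * u j x +
                u i x * (U j x - u j x)| := by congr 1; ring
            _ ≤ |U i x - u i x| * |U j x - u j x| + |U i x - u i x| * |u j x| +
                |u i x| * |U j x - u j x| := by
                simp only [← abs_mul]
                exact (abs_add_le _ _).trans (add_le_add_left (abs_add_le _ _) _)
            _ ≤ η * 1 + η * (C / (r / 2)) + (C / (r / 2)) * η := by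
                gcongr
                exact h2.trans hη1
            _ = _ := by ring
        calc |pd i (U j) x - U i x * U j x - F i j x|
            = |-(U i x * U j x - u i x * u j x) -
              (F i j x - (pd i (U j) x - u i x * u j x))| := by congr 1; ring
          _ ≤ η * (2 * (C / (r / 2)) + 1) + η := by
              refine (abs_sub _ _).trans (add_le_add ?_ h3)
              rwa [abs_neg]
          _ = D * η := by rw [hD]; ring
      · have hP : ‖x‖ ≤ 8 * R := by linarith
        have h1 := (hVb i x hP h).trans hBκ
        have h2 := (hVb j x hP h).trans hBκ
        calc |pd i (V j) x - V i x * V j x - F i j x|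
            ≤ |pd i (V j) x| + |V i x| * |V j x| + |F i j x| := by
              rw [← abs_mul]
              exact (abs_sub _ _).trans (add_le_add_left (abs_sub _ _) _)
          _ ≤ B + B * B + b := by
              gcongr
              · exact hpVb i j x hP hx0.le h
              · exact hFb i j x hx0.le hx2
    refine (Finset.sum_le_sum fun i _ => Finset.sum_le_sum fun j _ => hij i j).trans ?_
    simp only [Finset.sum_const, Finset.card_univ, Fintype.card_fin, nsmul_eq_mul]
    push_cast
    linarith
  · intro a ha1 ha2 j
    have ha : 0 < a := hr2.trans_le ha1
    have hPa : 8 * a ≤ 8 * R := by linarith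
    have hm : MeasurableSet (closedBall (0 : E) (8 * a) ∩ H) :=
      measurableSet_closedBall.inter isOpen_H.measurableSet
    have hcl : IsCompact (closedBall (0 : E) (8 * a) ∩ {x | 0 ≤ x 3}) :=
      (isCompact_closedBall _ _).inter_right
        (isClosed_le continuous_const (contDiff_coord 3).continuous)
    have hsub : closedBall (0 : E) (8 * a) ∩ H ⊆ closedBall (0 : E) (8 * a) ∩ {x | 0 ≤ x 3} :=
      fun x hx => ⟨hx.1, le_of_lt (show 0 < x 3 from hx.2)⟩
    have hUi : IntegrableOn (fun x => U j x ^ 2) (closedBall (0 : E) (8 * a) ∩ H) :=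
      ((((hU j).continuousOn.mono fun x hx => show -τ < x 3 from
        (neg_neg_of_pos hτ).trans_le hx.2).pow 2).integrableOn_compact hcl).mono_set hsub
    have hfin : volume (closedBall (0 : E) (8 * a) ∩ H) ≠ ⊤ :=
      ((measure_mono inter_subset_left).trans_lt measure_closedBall_lt_top).ne
    have hci : IntegrableOn (fun _ : E => (B * κ) ^ 2) (closedBall (0 : E) (8 * a) ∩ H) :=
      integrableOn_const hfin
    have h1 : ∫ x in closedBall (0 : E) (8 * a), V j x ^ 2 =
        ∫ x in closedBall (0 : E) (8 * a) ∩ H, V j x ^ 2 := by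
      refine setIntegral_eq_of_subset_of_forall_sdiff_eq_zero measurableSet_closedBall
        inter_subset_left fun x hx => ?_
      rw [hV0 j x (not_lt.1 fun h => hx.2 ⟨hx.1, h⟩)]
      simp
    have h2 : ∫ x in closedBall (0 : E) (8 * a) ∩ H, V j x ^ 2 ≤
        (∫ x in closedBall (0 : E) (8 * a) ∩ H, U j x ^ 2) + vol' * (B * κ) ^ 2 := by
      calc _ ≤ ∫ x in closedBall (0 : E) (8 * a) ∩ H, (U j x ^ 2 + (B * κ) ^ 2) := by
            refine integral_mono_of_nonneg (ae_of_all _ fun x => sq_nonneg _) (hUi.add hci) ?_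
            filter_upwards [ae_restrict_mem hm] with x hx
            rcases lt_or_ge κ (x 3) with h | h
            · rw [hVU j x h]
              have : 0 ≤ (B * κ) ^ 2 := sq_nonneg _
              linarith
            · have h3 := hVb j x ((mem_closedBall_zero_iff.1 hx.1).trans hPa) h
              have h4 : V j x ^ 2 ≤ (B * κ) ^ 2 := sq_le_sq.2 (h3.trans (le_abs_self _))
              have : 0 ≤ U j x ^ 2 := sq_nonneg _
              linarith
        _ = (∫ x in closedBall (0 : E) (8 * a) ∩ H, U j x ^ 2) +
            volume.real (closedBall (0 : E) (8 * a) ∩ H) * (B * κ) ^ 2 := by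
            rw [integral_add hUi hci, setIntegral_const, smul_eq_mul]
        _ ≤ _ := by
            have : volume.real (closedBall (0 : E) (8 * a) ∩ H) ≤ vol' :=
              measureReal_mono (inter_subset_left.trans (closedBall_subset_closedBall hPa))
                measure_closedBall_lt_top.ne
            gcongr
    have h3 := hUm j (8 * a) hPa
    have h4 : ∫ x in closedBall (0 : E) (8 * a + r / 2) ∩ H, u j x ^ 2 ≤
        ∫ x in closedBall (0 : E) (9 * a) ∩ H, u j x ^ 2 :=
      setIntegral_mono_set (hs.integrableOn_sq j _) (ae_of_all _ fun x => sq_nonneg _)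
        (inter_subset_inter_left _ (closedBall_subset_closedBall (by linarith))).eventuallyLE
    have h5 : (a ^ 2)⁻¹ ≤ ((r / 2) ^ 2)⁻¹ := by gcongr
    have h6 : (a ^ 2)⁻¹ * η ≤ ((r / 2) ^ 2)⁻¹ * η := by gcongr
    have h7 : (a ^ 2)⁻¹ * ((B * κ) ^ 2 * vol') ≤ ((r / 2) ^ 2)⁻¹ * ((B * κ) ^ 2 * vol') := by
      gcongr
    have h8 : (a ^ 2)⁻¹ * ∫ x in closedBall (0 : E) (8 * a), V j x ^ 2 ≤ (a ^ 2)⁻¹ *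
        (2 * (∫ x in closedBall (0 : E) (9 * a) ∩ H, u j x ^ 2) + η + (B * κ) ^ 2 * vol') := by
      refine mul_le_mul_of_nonneg_left ?_ (by positivity)
      rw [h1]
      linarith
    rw [mass]
    linarith
  · intro i j x hx hx1 hx2
    rw [hpVU i j x (by linarith)]
    exact (hpU i j x hx (by linarith) (by linarith)).trans hηq

end Approximation

section Caccioppoli

/-- A compact piece of the half space. -/
def core (r R k : ℝ) : Set E := {x | k ≤ x 3 ∧ r ≤ ‖x‖ ∧ ‖x‖ ≤ R}

lemma isCompact_core (r R k : ℝ) : IsCompact (core r R k) := by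
  have h : core r R k = closedBall (0 : E) R ∩ ({x | k ≤ x 3} ∩ {x | r ≤ ‖x‖}) := by
    ext x
    simp only [core, mem_inter_iff, mem_closedBall_zero_iff, Set.mem_ofPred_eq]
    tauto
  rw [h]
  exact (isCompact_closedBall _ _).inter_right ((isClosed_le continuous_const
    (contDiff_coord 3).continuous).inter (isClosed_le continuous_const continuous_norm))

lemma core_subset_H {r R k : ℝ} (hk : 0 < k) : core r R k ⊆ H := fun _ hx => hk.trans_le hx.1

/-- The scale invariant mass of a field on the half ball. -/
noncomputable def halfMass (u : Fin 4 → E → ℝ) (a : ℝ) : ℝ :=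
  ∑ j, (a ^ 2)⁻¹ * ∫ x in closedBall (0 : E) (9 * a) ∩ H, u j x ^ 2

variable {C : ℝ} {u : Fin 4 → E → ℝ} {π : E → ℝ}

theorem IsSolution.exists_energy_bound (hs : IsSolution C u π) :
    ∃ K > 0, ∀ r R k : ℝ, 0 < r → r ≤ R → 0 < k →
      ∑ i, ∑ j, ∫ x in core r R k, pd i (u j) x ^ 2 ≤
        K * (halfMass u (r / 2) + halfMass u R) := by
  obtain ⟨K, hK, hKV⟩ := exists_energy_const (C + 1) (by linarith [hs.nonneg])
  refine ⟨4 * K, by positivity, fun r R k hr hrR hk => ?_⟩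
  have hR : 0 < R := hr.trans_le hrR
  set vol : ℝ := volume.real (core r R k) with hvol
  refine le_of_forall_pos_le_add fun c hc => ?_
  obtain ⟨q, hq, hqc⟩ : ∃ q : ℝ, 0 < q ∧ 2 * (4 * q + K * (8 * q)) + 16 * (vol * (2 * q ^ 2)) ≤ c :=
    ((eventually_mem_nhdsWithin (s := Ioi (0 : ℝ))).and (eventually_le_of_continuous
      (f := fun q => 2 * (4 * q + K * (8 * q)) + 16 * (vol * (2 * q ^ 2))) (by fun_prop) (by simp)
      hc)).exists
  obtain ⟨V, hV, hVd, hV0, hVb, hVw, hVm, hVu⟩ := hs.exists_approx hr hrR hk hq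
  have hE := hKV r R q hr hR V hV hVd hV0 hVb hVw
  have hm : ∑ j, (mass (r / 2) (V j) + mass R (V j)) ≤
      2 * (halfMass u (r / 2) + halfMass u R) + 8 * q := by
    refine (Finset.sum_le_sum fun j _ => add_le_add (hVm (r / 2) le_rfl (by linarith) j)
      (hVm R (by linarith) le_rfl j)).trans (le_of_eq ?_)
    simp only [halfMass, Finset.sum_add_distrib, ← Finset.mul_sum]
    simp only [Finset.sum_const, Finset.card_univ, Fintype.card_fin, nsmul_eq_mul]
    push_cast
    ring
  have hcomp := isCompact_core r R k
  have hmeas : MeasurableSet (core r R k) := hcomp.isClosed.measurableSet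
  have hfin : volume (core r R k) ≠ ⊤ := hcomp.measure_lt_top.ne
  have hij : ∀ i j, ∫ x in core r R k, pd i (u j) x ^ 2 ≤
      2 * (∫ x, shell r R x ^ 6 * pd i (V j) x ^ 2) + vol * (2 * q ^ 2) := by
    intro i j
    have hpV : Continuous (pd i (V j)) := continuous_pd (hV j)
    have hS : Integrable fun x => shell r R x ^ 6 * pd i (V j) x ^ 2 := by
      refine Continuous.integrable_of_hasCompactSupport ?_ ?_
      · exact ((contDiff_shell r R).continuous.pow 6).mul (hpV.pow 2)
      · refine HasCompactSupport.mul_right ?_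
        exact (hasCompactSupport_shell hr hR).comp_left (g := fun t : ℝ => t ^ 6) (by simp)
    have hc1 : IntegrableOn (fun _ : E => 2 * q ^ 2) (core r R k) := integrableOn_const hfin
    have h1 : IntegrableOn (fun x => 2 * pd i (V j) x ^ 2) (core r R k) :=
      (((hpV.pow 2).const_mul 2).continuousOn).integrableOn_compact hcomp
    calc _ ≤ ∫ x in core r R k, (2 * pd i (V j) x ^ 2 + 2 * q ^ 2) := by
          refine integral_mono_of_nonneg (ae_of_all _ fun x => sq_nonneg _) (h1.add hc1) ?_
          filter_upwards [ae_restrict_mem hmeas] with x hx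
          have h2 := hVu i j x hx.1 hx.2.1 hx.2.2
          have h3 : (pd i (V j) x - pd i (u j) x) ^ 2 ≤ q ^ 2 :=
            sq_le_sq.2 (h2.trans (le_abs_self _))
          nlinarith [sq_nonneg (pd i (V j) x - (pd i (u j) x - pd i (V j) x))]
      _ = 2 * (∫ x in core r R k, pd i (V j) x ^ 2) + vol * (2 * q ^ 2) := by
          rw [integral_add h1 hc1, integral_const_mul, setIntegral_const, smul_eq_mul]
      _ = 2 * (∫ x in core r R k, shell r R x ^ 6 * pd i (V j) x ^ 2) + vol * (2 * q ^ 2) := by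
          congr 2
          refine setIntegral_congr_fun hmeas fun x hx => ?_
          simp only [shell_eq_one hr hR hx.2.1 hx.2.2, one_pow, one_mul]
      _ ≤ _ := by
          have : ∫ x in core r R k, shell r R x ^ 6 * pd i (V j) x ^ 2 ≤
              ∫ x, shell r R x ^ 6 * pd i (V j) x ^ 2 := setIntegral_le_integral hS
            (ae_of_all _ fun x => mul_nonneg (by positivity) (sq_nonneg _))
          linarith
  refine (Finset.sum_le_sum fun i _ => Finset.sum_le_sum fun j _ => hij i j).trans ?_
  simp only [Finset.sum_add_distrib, ← Finset.mul_sum]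
  simp only [Finset.sum_const, Finset.card_univ, Fintype.card_fin, nsmul_eq_mul]
  push_cast
  have := mul_le_mul_of_nonneg_left hm hK.le
  linarith

/-- The mass of a critically decaying field is bounded uniformly in the scale. -/
lemma IsSolution.exists_halfMass_le (hs : IsSolution C u π) : ∃ M, ∀ a, 0 < a → halfMass u a ≤ M := by
  refine ⟨4 * (C ^ 2 * ∫ x in closedBall (0 : E) 9, (‖x‖ ^ 2)⁻¹), fun a ha => ?_⟩
  have hint : ∀ P : ℝ, IntegrableOn (fun x : E => (‖x‖ ^ 2)⁻¹) (closedBall 0 P) := fun P => by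
    refine Integrable.mono' (integrableOn_majorant P) ?_ ?_
    · exact (Measurable.inv (by fun_prop)).aestronglyMeasurable
    · filter_upwards [ae_restrict_of_ae ae_coord_ne_zero] with x h1
      rw [Real.norm_eq_abs, abs_of_nonneg (by positivity)]
      exact inv_norm_sq_le_majorant h1
  have hsc : (a ^ 2)⁻¹ * ∫ x in closedBall (0 : E) (9 * a), (‖x‖ ^ 2)⁻¹ =
      ∫ x in closedBall (0 : E) 9, (‖x‖ ^ 2)⁻¹ := by
    have h1 := Measure.setIntegral_comp_smul_of_pos (volume : Measure E)
      (fun x : E => (‖x‖ ^ 2)⁻¹) (closedBall 0 9) ha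
    rw [smul_closedBall a (0 : E) (by norm_num), smul_zero, Real.norm_of_nonneg ha.le,
      mul_comm a 9] at h1
    simp only [norm_smul, Real.norm_of_nonneg ha.le, mul_pow, mul_inv, finrank_euclideanSpace,
      Fintype.card_fin, smul_eq_mul, integral_const_mul] at h1
    field_simp at h1 ⊢
    linarith
  have hj : ∀ j, (a ^ 2)⁻¹ * ∫ x in closedBall (0 : E) (9 * a) ∩ H, u j x ^ 2 ≤
      C ^ 2 * ∫ x in closedBall (0 : E) 9, (‖x‖ ^ 2)⁻¹ := by
    intro j
    rw [← hsc, mul_left_comm, ← integral_const_mul (C ^ 2)]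
    refine mul_le_mul_of_nonneg_left ?_ (by positivity)
    have hm : MeasurableSet (closedBall (0 : E) (9 * a) ∩ H) :=
      measurableSet_closedBall.inter isOpen_H.measurableSet
    calc _ ≤ ∫ x in closedBall (0 : E) (9 * a) ∩ H, C ^ 2 * (‖x‖ ^ 2)⁻¹ := by
          refine integral_mono_of_nonneg (ae_of_all _ fun x => sq_nonneg _)
            (((hint _).mono_set inter_subset_left).const_mul _) ?_
          filter_upwards [ae_restrict_mem hm] with x hx
          calc u j x ^ 2 = |u j x| ^ 2 := (sq_abs _).symm
            _ ≤ (C / ‖x‖) ^ 2 := by gcongr; exact hs.abs_le j hx.2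
            _ = _ := by rw [div_pow]; rfl
      _ ≤ _ := setIntegral_mono_set ((hint _).const_mul _)
          (ae_of_all _ fun x => by positivity) inter_subset_left.eventuallyLE
  calc halfMass u a ≤ ∑ _j : Fin 4, C ^ 2 * ∫ x in closedBall (0 : E) 9, (‖x‖ ^ 2)⁻¹ :=
        Finset.sum_le_sum fun j _ => hj j
    _ = _ := by simp

end Caccioppoli

section Hardy

/-- A one dimensional Hardy inequality for functions vanishing at the left end point. -/
lemma ofReal_sq_le_lintegral {f f' : ℝ → ℝ} {x : ℝ} (hx : 0 < x)
    (hf : ∀ s, 0 < s → HasDerivAt f (f' s) s) (hf' : ContinuousOn f' (Ioi 0))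
    (h0 : Tendsto f (𝓝[>] 0) (𝓝 0)) :
    ENNReal.ofReal (f x ^ 2) ≤
      ENNReal.ofReal (2 * √x) * ∫⁻ s in Ioc 0 x, ENNReal.ofReal (√s * f' s ^ 2) := by
  have hx2 : 0 < √x := Real.sqrt_pos.2 hx
  by_cases hI : ∫⁻ s in Ioc 0 x, ENNReal.ofReal (√s * f' s ^ 2) = ⊤
  · rw [hI, ENNReal.mul_top (by simpa using hx2)]
    exact le_top
  set I : ℝ := (∫⁻ s in Ioc 0 x, ENNReal.ofReal (√s * f' s ^ 2)).toReal with hIdef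
  have key : ∀ l ε : ℝ, 0 < ε → ε < x → 2 * l * (f x - f ε) - 2 * l ^ 2 * √x ≤ I := by
    intro l ε hε hεx
    have hsub : uIcc ε x ⊆ Ioi 0 := by
      rw [uIcc_of_le hεx.le]
      exact fun s hs => hε.trans_le hs.1
    have c0 : ContinuousOn (fun s => √s * f' s ^ 2) (uIcc ε x) :=
      Real.continuous_sqrt.continuousOn.mul ((hf'.mono hsub).pow 2)
    have c1 : ContinuousOn (fun s => 2 * l * f' s - 2 * l ^ 2 * (1 / (2 * √s))) (uIcc ε x) :=
      (continuousOn_const.mul (hf'.mono hsub)).sub (continuousOn_const.mul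
        (continuousOn_const.div (continuousOn_const.mul Real.continuous_sqrt.continuousOn)
        fun s hs => by have := Real.sqrt_pos.2 (hsub hs); positivity))
    have h1 : ∫ s in ε..x, (2 * l * f' s - 2 * l ^ 2 * (1 / (2 * √s))) =
        (2 * l * f x - 2 * l ^ 2 * √x) - (2 * l * f ε - 2 * l ^ 2 * √ε) :=
      intervalIntegral.integral_eq_sub_of_hasDerivAt
        (f := fun s => 2 * l * f s - 2 * l ^ 2 * √s) (fun s hs =>
        ((hf s (hsub hs)).const_mul (2 * l)).sub
          ((Real.hasDerivAt_sqrt (ne_of_gt (hsub hs))).const_mul (2 * l ^ 2)))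
        c1.intervalIntegrable
    have h2 : ∫ s in ε..x, (2 * l * f' s - 2 * l ^ 2 * (1 / (2 * √s))) ≤
        ∫ s in ε..x, √s * f' s ^ 2 := by
      refine intervalIntegral.integral_mono_on hεx.le c1.intervalIntegrable c0.intervalIntegrable
        fun s hs => ?_
      have hs0 := Real.sqrt_pos.2 (hε.trans_le hs.1)
      rw [sub_le_iff_le_add]
      have : √s * f' s ^ 2 + 2 * l ^ 2 * (1 / (2 * √s)) - 2 * l * f' s =
          (√s * f' s - l) ^ 2 / √s := by
        field_simp
        ring
      have : 0 ≤ (√s * f' s - l) ^ 2 / √s := by positivity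
      linarith
    have h3 : ∫ s in ε..x, √s * f' s ^ 2 ≤ I := by
      rw [intervalIntegral.integral_of_le hεx.le, integral_eq_lintegral_of_nonneg_ae
        (ae_of_all _ fun s => by positivity)
        ((c0.mono (by rw [uIcc_of_le hεx.le]; exact Ioc_subset_Icc_self)).aestronglyMeasurable
          measurableSet_Ioc)]
      exact ENNReal.toReal_mono hI (lintegral_mono_set (Ioc_subset_Ioc_left hε.le))
    have h4 : 0 ≤ 2 * l ^ 2 * √ε := by positivity
    linarith
  have key2 : ∀ l : ℝ, 2 * l * f x - 2 * l ^ 2 * √x ≤ I := by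
    intro l
    have h1 : Tendsto (fun ε => 2 * l * (f x - f ε) - 2 * l ^ 2 * √x) (𝓝[>] 0)
        (𝓝 (2 * l * (f x - 0) - 2 * l ^ 2 * √x)) :=
      ((tendsto_const_nhds.sub h0).const_mul _).sub_const _
    rw [sub_zero] at h1
    refine le_of_tendsto h1 ?_
    filter_upwards [Ioo_mem_nhdsGT hx] with ε hε using key l ε hε.1 hε.2
  have h5 : f x ^ 2 ≤ 2 * √x * I := by
    have h6 := key2 (f x / (2 * √x))
    have h7 : 2 * (f x / (2 * √x)) * f x - 2 * (f x / (2 * √x)) ^ 2 * √x =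
        f x ^ 2 / (2 * √x) := by
      field_simp
      ring
    rw [h7, div_le_iff₀ (by positivity)] at h6
    linarith
  calc ENNReal.ofReal (f x ^ 2) ≤ ENNReal.ofReal (2 * √x * I) := ENNReal.ofReal_le_ofReal h5
    _ = _ := by rw [ENNReal.ofReal_mul (by positivity), hIdef, ENNReal.ofReal_toReal hI]

variable {C : ℝ} {u : Fin 4 → E → ℝ} {π : E → ℝ}

/-- A Hardy inequality on half balls. -/
lemma IsSolution.lintegral_sq_le (hs : IsSolution C u π) (j : Fin 4) (P : ℝ) :
    ∫⁻ x in closedBall (0 : E) P ∩ H, ENNReal.ofReal (u j x ^ 2) ≤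
      ENNReal.ofReal (2 * √P) * ENNReal.ofReal P *
        ∫⁻ x in closedBall (0 : E) (2 * P) ∩ H, ENNReal.ofReal (√(x 3) * pd 3 (u j) x ^ 2) := by
  have hmH : ∀ R : ℝ, MeasurableSet (closedBall (0 : E) R ∩ H) := fun R =>
    measurableSet_closedBall.inter isOpen_H.measurableSet
  have hu1 : ContDiffOn ℝ 1 (u j) H := (hs.contDiffOn j).of_le (by simp)
  set Ψ : E → ℝ≥0∞ := (closedBall (0 : E) (2 * P) ∩ H).indicator
    fun x => ENNReal.ofReal (√(x 3) * pd 3 (u j) x ^ 2) with hΨ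
  have hΨm : Measurable Ψ := by
    refine Measurable.indicator (ENNReal.measurable_ofReal.comp ?_) (hmH _)
    refine Measurable.mul ?_ ((measurable_fderiv_apply_const ℝ (u j) (e 3)).pow_const 2)
    exact (Real.continuous_sqrt.comp (contDiff_coord 3).continuous).measurable
  have hpt : ∀ᵐ x ∂volume.restrict (closedBall (0 : E) P ∩ H), ENNReal.ofReal (u j x ^ 2) ≤
      ENNReal.ofReal (2 * √P) * ∫⁻ t in Icc 0 P, Ψ (x - t • e 3) := by
    filter_upwards [ae_restrict_mem (hmH P), ae_restrict_of_ae ae_coord_ne_zero] with x hx h1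
    have hxP : ‖x‖ ≤ P := mem_closedBall_zero_iff.1 hx.1
    have hx3 : 0 < x 3 := hx.2
    have hx3P : x 3 ≤ P := (le_abs_self _).trans ((abs_coord_le x 3).trans hxP)
    have hline : ∀ s : ℝ, proj x + s • e 3 = x - (x 3 - s) • e 3 := fun s => by
      simp only [proj, sub_smul]
      abel
    have hd : ∀ s, 0 < s → HasDerivAt (fun s => flat s (u j) x)
        (pd 3 (u j) (proj x + s • e 3)) s := by
      intro s hs0
      have h2 : HasDerivAt (fun s : ℝ => proj x + s • e 3) (e 3) s := by
        simpa using ((hasDerivAt_id s).smul_const (e 3)).const_add (proj x)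
      exact (differentiableAt_above hu1 (proj_add_mem hs0 x)).hasFDerivAt.comp_hasDerivAt s h2
    have hc : ContinuousOn (fun s : ℝ => pd 3 (u j) (proj x + s • e 3)) (Ioi 0) :=
      (continuousOn_pd_H hu1 3).comp (by fun_prop) fun s hs0 => proj_add_mem hs0 x
    have h3 := ofReal_sq_le_lintegral hx3 hd hc (hs.tendsto_flat j (proj_ne_zero (h1 0)))
    have h4 : flat (x 3) (u j) x = u j x := by
      rw [flat, hline, sub_self, zero_smul, sub_zero]
    rw [h4] at h3
    refine h3.trans (mul_le_mul' (ENNReal.ofReal_le_ofReal (by gcongr)) ?_)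
    rw [← lintegral_indicator measurableSet_Ioc, ← lintegral_indicator measurableSet_Icc,
      ← lintegral_sub_left_eq_self _ (x 3)]
    refine lintegral_mono fun t => ?_
    by_cases ht : x 3 - t ∈ Ioc 0 (x 3)
    · have ht0 : 0 ≤ t := by linarith [ht.2]
      have htP : t ≤ P := by linarith [ht.1]
      have h5 := hline (x 3 - t)
      rw [sub_sub_cancel] at h5
      rw [indicator_of_mem ht, indicator_of_mem (show t ∈ Icc 0 P from ⟨ht0, htP⟩), ← h5, hΨ,
        indicator_of_mem, proj_add_three]
      refine ⟨mem_closedBall_zero_iff.2 ?_, proj_add_mem ht.1 x⟩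
      rw [h5]
      refine (norm_sub_le _ _).trans ?_
      rw [norm_smul, Real.norm_of_nonneg ht0]
      simp only [e, PiLp.norm_single, norm_one, mul_one]
      linarith
    · rw [indicator_of_notMem ht]
      exact zero_le
  have hsub : Continuous fun p : E × ℝ => p.1 - p.2 • e 3 := by fun_prop
  calc _ ≤ ∫⁻ x in closedBall (0 : E) P ∩ H,
        ENNReal.ofReal (2 * √P) * (∫⁻ t in Icc 0 P, Ψ (x - t • e 3)) := lintegral_mono_ae hpt
    _ ≤ ∫⁻ x, ENNReal.ofReal (2 * √P) * (∫⁻ t in Icc 0 P, Ψ (x - t • e 3)) :=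
        setLIntegral_le_lintegral _ _
    _ = ENNReal.ofReal (2 * √P) * ∫⁻ x, (∫⁻ t in Icc 0 P, Ψ (x - t • e 3)) := by
        rw [lintegral_const_mul' _ _ ENNReal.ofReal_ne_top]
    _ = ENNReal.ofReal (2 * √P) * ∫⁻ t in Icc 0 P, (∫⁻ x, Ψ (x - t • e 3)) := by
        rw [lintegral_lintegral_swap (f := fun x t => Ψ (x - t • e 3)) (hΨm.comp hsub.measurable).aemeasurable]
    _ = _ := by
        simp_rw [lintegral_sub_right_eq_self (μ := (volume : Measure E)) Ψ]
        rw [lintegral_const, Measure.restrict_apply_univ, Real.volume_Icc, sub_zero, hΨ,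
          lintegral_indicator (hmH _), mul_comm _ (ENNReal.ofReal P), mul_assoc]

end Hardy

section Liouville

variable {C : ℝ} {u : Fin 4 → E → ℝ} {π : E → ℝ}

lemma core_mono {r R k r' R' k' : ℝ} (hr : r' ≤ r) (hR : R ≤ R') (hk : k' ≤ k) :
    core r R k ⊆ core r' R' k' :=
  fun _ hx => ⟨hk.trans hx.1, hr.trans hx.2.1, hx.2.2.trans hR⟩

lemma IsSolution.continuousOn_pd (hs : IsSolution C u π) (i j : Fin 4) :
    ContinuousOn (pd i (u j)) H :=
  continuousOn_pd_H ((hs.contDiffOn j).of_le (by simp)) i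

lemma IsSolution.integrableOn_core (hs : IsSolution C u π) (i j : Fin 4) {r R k : ℝ} (hk : 0 < k) :
    IntegrableOn (fun x => pd i (u j) x ^ 2) (core r R k) :=
  (((hs.continuousOn_pd i j).mono (core_subset_H hk)).pow 2).integrableOn_compact
    (isCompact_core r R k)

lemma IsSolution.exists_energy_bound_single (hs : IsSolution C u π) :
    ∃ K > 0, ∀ i j, ∀ r R k : ℝ, 0 < r → r ≤ R → 0 < k →
      ∫ x in core r R k, pd i (u j) x ^ 2 ≤ K * (halfMass u (r / 2) + halfMass u R) := by
  obtain ⟨K, hK, h⟩ := hs.exists_energy_bound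
  refine ⟨K, hK, fun i j r R k hr hrR hk => le_trans ?_ (h r R k hr hrR hk)⟩
  have h0 : ∀ i j, 0 ≤ ∫ x in core r R k, pd i (u j) x ^ 2 := fun i j =>
    integral_nonneg fun _ => sq_nonneg _
  exact (Finset.single_le_sum (f := fun j => ∫ x in core r R k, pd i (u j) x ^ 2)
    (fun j _ => h0 i j) (Finset.mem_univ j)).trans (Finset.single_le_sum
    (f := fun i => ∑ j, ∫ x in core r R k, pd i (u j) x ^ 2)
    (fun i _ => Finset.sum_nonneg fun j _ => h0 i j) (Finset.mem_univ i))

/-- A critically decaying solution has finite Dirichlet energy. -/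
lemma IsSolution.integrableOn_pd_sq (hs : IsSolution C u π) (i j : Fin 4) :
    IntegrableOn (fun x => pd i (u j) x ^ 2) H := by
  obtain ⟨K, hK, h⟩ := hs.exists_energy_bound_single
  obtain ⟨M, hM⟩ := hs.exists_halfMass_le
  have hcov : AECover (volume.restrict H) atTop
      fun n : ℕ => core (1 / ((n : ℝ) + 1)) ((n : ℝ) + 1) (1 / ((n : ℝ) + 1)) := by
    refine ⟨?_, fun n => (isCompact_core _ _ _).isClosed.measurableSet⟩
    filter_upwards [ae_restrict_mem isOpen_H.measurableSet] with x hx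
    have hx3 : 0 < x 3 := hx
    have hxn : 0 < ‖x‖ := norm_pos_iff.2 (ne_zero_of_mem_H hx)
    have t := tendsto_one_div_add_atTop_nhds_zero_nat (𝕜 := ℝ)
    have t' : Tendsto (fun n : ℕ => (n : ℝ) + 1) atTop atTop :=
      tendsto_atTop_add_const_right _ _ tendsto_natCast_atTop_atTop
    filter_upwards [t.eventually_le_const hx3, t.eventually_le_const hxn,
      t'.eventually_ge_atTop ‖x‖] with n h1 h2 h3 using ⟨h1, h2, h3⟩
  have hres : ∀ n : ℕ, (volume.restrict H).restrict
      (core (1 / ((n : ℝ) + 1)) ((n : ℝ) + 1) (1 / ((n : ℝ) + 1))) =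
      volume.restrict (core (1 / ((n : ℝ) + 1)) ((n : ℝ) + 1) (1 / ((n : ℝ) + 1))) := fun n =>
    Measure.restrict_restrict_of_subset (core_subset_H (by positivity))
  refine hcov.integrable_of_integral_bounded_of_nonneg_ae (K * (M + M)) (fun n => ?_)
    (ae_of_all _ fun x => sq_nonneg _) (Eventually.of_forall fun n => ?_)
  · rw [IntegrableOn, hres]
    exact hs.integrableOn_core i j (by positivity)
  · rw [hres]
    have hn : (0 : ℝ) < (n : ℝ) + 1 := by positivity
    refine (h i j _ _ _ (by positivity) ?_ (by positivity)).trans ?_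
    · rw [div_le_iff₀ hn]
      have : (0 : ℝ) ≤ n := by positivity
      nlinarith
    · have := hM (1 / ((n : ℝ) + 1) / 2) (by positivity)
      have := hM ((n : ℝ) + 1) hn
      gcongr

/-- The weighted energy that controls the mass at scale `a`. -/
noncomputable def weightedEnergy (u : Fin 4 → E → ℝ) (a : ℝ) : ℝ :=
  ∑ j, ∫ x in H, (closedBall (0 : E) (18 * a)).indicator
    (fun x => √(x 3 / a) * pd 3 (u j) x ^ 2) x

lemma sqrt_div_le {a : ℝ} (ha : 0 < a) {x : E} (hx : ‖x‖ ≤ 18 * a) : √(x 3 / a) ≤ √18 := by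
  refine Real.sqrt_le_sqrt ((div_le_iff₀ ha).2 ?_)
  exact ((le_abs_self _).trans (abs_coord_le x 3)).trans hx

lemma IsSolution.aestronglyMeasurable_weightedEnergy (hs : IsSolution C u π) (j : Fin 4) (a : ℝ) :
    AEStronglyMeasurable (fun x => (closedBall (0 : E) (18 * a)).indicator
      (fun x => √(x 3 / a) * pd 3 (u j) x ^ 2) x) (volume.restrict H) := by
  refine AEStronglyMeasurable.indicator ?_ measurableSet_closedBall
  refine AEStronglyMeasurable.mul ?_ (hs.integrableOn_pd_sq 3 j).1
  exact (Real.continuous_sqrt.comp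
    ((contDiff_coord 3).continuous.div_const a)).aestronglyMeasurable

lemma norm_weightedEnergy_le (j : Fin 4) {a : ℝ} (ha : 0 < a) (x : E) :
    ‖(closedBall (0 : E) (18 * a)).indicator (fun x => √(x 3 / a) * pd 3 (u j) x ^ 2) x‖ ≤
      √18 * pd 3 (u j) x ^ 2 := by
  by_cases hx : x ∈ closedBall (0 : E) (18 * a)
  · rw [indicator_of_mem hx, Real.norm_of_nonneg (by positivity)]
    exact mul_le_mul_of_nonneg_right (sqrt_div_le ha (mem_closedBall_zero_iff.1 hx)) (sq_nonneg _)
  · rw [indicator_of_notMem hx, norm_zero]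
    positivity

lemma IsSolution.tendsto_weightedEnergy (hs : IsSolution C u π) {l : Filter ℝ}
    [l.IsCountablyGenerated] (hl : ∀ᶠ a in l, 0 < a)
    (h : ∀ j, ∀ x ∈ H, Tendsto (fun a => (closedBall (0 : E) (18 * a)).indicator
      (fun x => √(x 3 / a) * pd 3 (u j) x ^ 2) x) l (𝓝 0)) :
    Tendsto (weightedEnergy u) l (𝓝 0) := by
  have h0 : ∀ j : Fin 4, Tendsto (fun a => ∫ x in H, (closedBall (0 : E) (18 * a)).indicator
      (fun x => √(x 3 / a) * pd 3 (u j) x ^ 2) x) l (𝓝 (∫ _x in H, (0 : ℝ))) := fun j => by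
    refine tendsto_integral_filter_of_dominated_convergence (fun x => √18 * pd 3 (u j) x ^ 2)
      (Eventually.of_forall fun a => hs.aestronglyMeasurable_weightedEnergy j a) ?_
      ((hs.integrableOn_pd_sq 3 j).const_mul _) ?_
    · filter_upwards [hl] with a ha using ae_of_all _ fun x => norm_weightedEnergy_le j ha x
    · filter_upwards [ae_restrict_mem isOpen_H.measurableSet] with x hx using h j x hx
  have := tendsto_finsetSum Finset.univ fun j _ => h0 j
  simp only [integral_zero, Finset.sum_const_zero] at this
  exact this

lemma IsSolution.halfMass_le (hs : IsSolution C u π) {a : ℝ} (ha : 0 < a) :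
    halfMass u a ≤ 54 * weightedEnergy u a := by
  rw [halfMass, weightedEnergy, Finset.mul_sum]
  refine Finset.sum_le_sum fun j _ => ?_
  set W : E → ℝ := fun x => √(x 3 / a) * pd 3 (u j) x ^ 2 with hW
  have hint : IntegrableOn (fun x => (closedBall (0 : E) (18 * a)).indicator W x) H :=
    Integrable.mono' ((hs.integrableOn_pd_sq 3 j).const_mul _)
      (hs.aestronglyMeasurable_weightedEnergy j a)
      (ae_of_all _ fun x => norm_weightedEnergy_le j ha x)
  have hnn : 0 ≤ ∫ x in H, (closedBall (0 : E) (18 * a)).indicator W x :=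
    integral_nonneg fun x => indicator_nonneg (fun x _ => by positivity) x
  have h1 := hs.lintegral_sq_le j (9 * a)
  rw [← mul_assoc, show (2 : ℝ) * 9 = 18 by norm_num] at h1
  have hm : MeasurableSet (closedBall (0 : E) (18 * a)) := measurableSet_closedBall
  have h2 : ∫⁻ x in closedBall (0 : E) (18 * a) ∩ H, ENNReal.ofReal (√(x 3) * pd 3 (u j) x ^ 2) =
      ENNReal.ofReal (√a * ∫ x in H, (closedBall (0 : E) (18 * a)).indicator W x) := by
    rw [← integral_const_mul, ofReal_integral_eq_lintegral_ofReal (hint.const_mul _)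
      (ae_of_all _ fun x => mul_nonneg (Real.sqrt_nonneg _)
        (indicator_nonneg (fun x _ => by positivity) x)),
      ← Measure.restrict_restrict hm, ← lintegral_indicator hm]
    refine lintegral_congr fun x => ?_
    by_cases hx : x ∈ closedBall (0 : E) (18 * a)
    · rw [indicator_of_mem hx, indicator_of_mem hx, hW, ← mul_assoc, ← Real.sqrt_mul ha.le,
        mul_div_cancel₀ _ ha.ne']
    · simp [indicator_of_notMem hx]
  rw [h2, ← ofReal_integral_eq_lintegral_ofReal (hs.integrableOn_sq j _)
    (ae_of_all _ fun _ => sq_nonneg _), ← ENNReal.ofReal_mul (by positivity),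
    ← ENNReal.ofReal_mul (by positivity), ENNReal.ofReal_le_ofReal_iff (by positivity)] at h1
  calc _ ≤ (a ^ 2)⁻¹ * (2 * √(9 * a) * (9 * a) *
        (√a * ∫ x in H, (closedBall (0 : E) (18 * a)).indicator W x)) := by gcongr
    _ = _ := by
      have h9 : √(9 * a) = 3 * √a := by
        rw [Real.sqrt_mul (by norm_num), show (9 : ℝ) = 3 ^ 2 by norm_num,
          Real.sqrt_sq (by norm_num)]
      have hsq : √a * √a = a := Real.mul_self_sqrt ha.le
      rw [h9]
      field_simp
      rw [sq, hsq]
      ring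

lemma IsSolution.tendsto_halfMass (hs : IsSolution C u π) {l : Filter ℝ}
    (hl : ∀ᶠ a in l, 0 < a) (h : Tendsto (weightedEnergy u) l (𝓝 0)) :
    Tendsto (halfMass u) l (𝓝 0) := by
  refine squeeze_zero' (g := fun a => 54 * weightedEnergy u a) ?_ ?_ (by simpa using h.const_mul 54)
  · refine Eventually.of_forall fun a => Finset.sum_nonneg fun j _ => mul_nonneg (by positivity)
      (integral_nonneg fun _ => sq_nonneg _)
  · filter_upwards [hl] with a ha using hs.halfMass_le ha

lemma IsSolution.tendsto_halfMass_zero (hs : IsSolution C u π) :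
    Tendsto (halfMass u) (𝓝[>] 0) (𝓝 0) := by
  refine hs.tendsto_halfMass self_mem_nhdsWithin
    (hs.tendsto_weightedEnergy self_mem_nhdsWithin fun j x hx => ?_)
  have hxn : 0 < ‖x‖ := norm_pos_iff.2 (ne_zero_of_mem_H hx)
  refine tendsto_const_nhds.congr' ?_
  filter_upwards [Ioo_mem_nhdsGT (show 0 < ‖x‖ / 18 by positivity)] with a ha
  rw [indicator_of_notMem]
  rw [mem_closedBall_zero_iff]
  linarith [ha.2]

lemma IsSolution.tendsto_halfMass_atTop (hs : IsSolution C u π) :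
    Tendsto (halfMass u) atTop (𝓝 0) := by
  refine hs.tendsto_halfMass (eventually_gt_atTop 0)
    (hs.tendsto_weightedEnergy (eventually_gt_atTop 0) fun j x _ => ?_)
  have h1 : Tendsto (fun a : ℝ => √(x 3 / a) * pd 3 (u j) x ^ 2) atTop (𝓝 0) := by
    have h2 : Tendsto (fun a : ℝ => x 3 / a) atTop (𝓝 0) := tendsto_const_nhds.div_atTop tendsto_id
    have h3 := ((Real.continuous_sqrt.tendsto 0).comp h2).mul_const (pd 3 (u j) x ^ 2)
    simpa using h3
  refine squeeze_zero (fun a => indicator_nonneg (fun x _ => by positivity) x) (fun a => ?_) h1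
  exact indicator_le_self' (fun _ _ => by positivity) x

lemma IsSolution.pd_eq_zero (hs : IsSolution C u π) (i j : Fin 4) {x : E} (hx : x ∈ H) :
    pd i (u j) x = 0 := by
  obtain ⟨K, hK, h⟩ := hs.exists_energy_bound_single
  have hx3 : 0 < x 3 := hx
  have hxn : 0 < ‖x‖ := norm_pos_iff.2 (ne_zero_of_mem_H hx)
  have hk : 0 < x 3 / 2 := by positivity
  have h1 : ∫ y in core (‖x‖ / 2) (2 * ‖x‖) (x 3 / 2), pd i (u j) y ^ 2 ≤ 0 := by
    have t1 : Tendsto (fun n : ℝ => halfMass u (n⁻¹ / 2)) atTop (𝓝 0) := by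
      refine hs.tendsto_halfMass_zero.comp (tendsto_nhdsWithin_iff.2 ⟨?_, ?_⟩)
      · simpa using (tendsto_inv_atTop_zero (𝕜 := ℝ)).div_const 2
      · filter_upwards [eventually_gt_atTop 0] with n hn
        exact half_pos (inv_pos.2 hn)
    have t2 : Tendsto (fun n : ℝ => K * (halfMass u (n⁻¹ / 2) + halfMass u n)) atTop (𝓝 0) := by
      simpa using (t1.add hs.tendsto_halfMass_atTop).const_mul K
    refine ge_of_tendsto t2 ?_
    have t3 : ∀ᶠ n : ℝ in atTop, n⁻¹ ≤ ‖x‖ / 2 :=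
      (tendsto_inv_atTop_zero (𝕜 := ℝ)).eventually_le_const (by positivity)
    filter_upwards [eventually_ge_atTop (2 * ‖x‖), t3, eventually_gt_atTop 0] with n hn hn' hn0
    refine le_trans ?_ (h i j n⁻¹ n (x 3 / 2) (inv_pos.2 hn0) (by linarith) hk)
    exact setIntegral_mono_set (hs.integrableOn_core i j hk) (ae_of_all _ fun _ => sq_nonneg _)
      (core_mono hn' hn le_rfl).eventuallyLE
  have h2 : (fun y => pd i (u j) y ^ 2) =ᵐ[volume.restrict (core (‖x‖ / 2) (2 * ‖x‖) (x 3 / 2))]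
      0 := (setIntegral_eq_zero_iff_of_nonneg_ae (ae_of_all _ fun _ => sq_nonneg _)
        (hs.integrableOn_core i j hk)).1 (h1.antisymm (integral_nonneg fun _ => sq_nonneg _))
  set U : Set E := {y | x 3 / 2 < y 3} ∩ ({y | ‖x‖ / 2 < ‖y‖} ∩ {y | ‖y‖ < 2 * ‖x‖}) with hU
  have hUo : IsOpen U := (isOpen_above _).inter
    ((isOpen_lt continuous_const continuous_norm).inter
      (isOpen_lt continuous_norm continuous_const))
  have hUs : U ⊆ core (‖x‖ / 2) (2 * ‖x‖) (x 3 / 2) :=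
    fun y hy => ⟨le_of_lt hy.1, le_of_lt hy.2.1, le_of_lt hy.2.2⟩
  have h3 := Measure.eqOn_open_of_ae_eq (ae_restrict_of_ae_restrict_of_subset hUs h2) hUo
    (((hs.continuousOn_pd i j).mono (hUs.trans (core_subset_H hk))).pow 2) continuousOn_const
  have h4 : x ∈ U := ⟨half_lt_self hx3, half_lt_self hxn, by
    change ‖x‖ < 2 * ‖x‖
    linarith⟩
  exact pow_eq_zero_iff two_ne_zero |>.1 (h3 h4)

/-- A critically decaying solution in the half space with Dirichlet data vanishes. -/
theorem IsSolution.eq_zero_of_mem_H (hs : IsSolution C u π) (j : Fin 4) {x : E} (hx : x ∈ H) :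
    u j x = 0 := by
  have hconv : Convex ℝ H := by
    have : H = (EuclideanSpace.proj (𝕜 := ℝ) (3 : Fin 4) : E →L[ℝ] ℝ) ⁻¹' Ioi 0 := rfl
    rw [this]
    exact (convex_Ioi 0).linear_preimage (EuclideanSpace.proj (𝕜 := ℝ) (3 : Fin 4)).toLinearMap
  have hu1 : ContDiffOn ℝ 1 (u j) H := (hs.contDiffOn j).of_le (by simp)
  have hconst : ∀ y ∈ H, u j y = u j x := fun y hy =>
    isOpen_H.is_const_of_fderiv_eq_zero hconv.isPreconnected
      (hu1.differentiableOn one_ne_zero) (fun z hz => by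
        ext v
        rw [fderiv_apply_eq_sum]
        simp [hs.pd_eq_zero _ j hz]) hy hx
  have ht := hs.tendsto_flat j (y := e 0) (proj_ne_zero (by simp [e]))
  refine tendsto_nhds_unique (tendsto_const_nhds.congr' ?_) ht
  filter_upwards [self_mem_nhdsWithin] with τ hτ
  exact (hconst _ (proj_add_mem hτ _)).symm

end Liouville

section Reduction

/-- A smooth solution in convective form is a solution in divergence form. -/
lemma isSolution_of_convective {C : ℝ} {u : E → E} {p : E → ℝ}
    (hu : ContDiffOn ℝ ∞ u H) (hp : ContDiffOn ℝ ∞ p H)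
    (hu0 : ContinuousOn u {x | 0 ≤ x 3 ∧ x ≠ 0})
    (hNS : ∀ x ∈ H, ∀ j, -(∑ i, pd i (pd i fun z => u z j) x) +
      (∑ i, u x i * pd i (fun z => u z j) x) + pd j p x = 0)
    (hdiv : ∀ x ∈ H, ∑ i, pd i (fun z => u z i) x = 0)
    (hDir : ∀ x : E, x 3 = 0 → x ≠ 0 → u x = 0)
    (hbound : ∀ x ∈ H, ‖u x‖ ≤ C / ‖x‖) :
    IsSolution C (fun j x => u x j) p where
  contDiffOn j := (EuclideanSpace.proj (𝕜 := ℝ) j).contDiff.comp_contDiffOn hu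
  contDiffOn_pressure := hp.of_le (by simp)
  continuousOn j := (EuclideanSpace.proj (𝕜 := ℝ) j).continuous.comp_continuousOn hu0
  eq_zero j x h3 h0 := by simp [hDir x h3 h0]
  bound j x hx := (le_div_iff₀ (norm_pos_iff.2 (ne_zero_of_mem_H hx))).1
    ((abs_coord_le (u x) j).trans (hbound x hx))
  momentum x hx j := by
    have hs : ∀ k, ContDiffOn ℝ ∞ (fun z => u z k) H := fun k =>
      (EuclideanSpace.proj (𝕜 := ℝ) k).contDiff.comp_contDiffOn hu
    have hH : H ∈ 𝓝 x := isOpen_H.mem_nhds hx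
    have d : ∀ k, DifferentiableAt ℝ (fun z => u z k) x := fun k =>
      ((hs k).contDiffAt hH).differentiableAt (by simp)
    have dd : ∀ i, DifferentiableAt ℝ (pd i fun z => u z j) x := fun i =>
      ((contDiffOn_pd_H (hs j) i).contDiffAt hH).differentiableAt one_ne_zero
    have key : ∀ i, pd i (fun y => pd i (fun z => u z j) y - u y i * u y j) x =
        pd i (pd i fun z => u z j) x - u x i * pd i (fun z => u z j) x -
          pd i (fun z => u z i) x * u x j := fun i => by
      rw [pd_sub (dd i) ((d i).fun_mul (d j)), pd_mul (d i) (d j)]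
      ring
    rw [Finset.sum_congr rfl fun i _ => key i, Finset.sum_sub_distrib, Finset.sum_sub_distrib,
      ← Finset.sum_mul, hdiv x hx]
    linarith [hNS x hx j]
  divergence := hdiv

end Reduction

end SteadyNS

/-- **Rigidity of steady Navier-Stokes solutions in the half space ℝ⁴₊ \ {0}
with Dirichlet boundary conditions.**  If `(u, p)` is a smooth solution of the steady
Navier-Stokes equations on `Ω = ℝ⁴₊ \ {0}`, `u` extends continuously up to
`∂ℝ⁴₊ \ {0}` where `u = 0`, and `|u(x)| ≤ C/|x|` on `Ω`, then `u ≡ 0` on `Ω`. -/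
theorem rigidity_steady_NS_half_space_dim4_Dirichlet
    (u : EuclideanSpace ℝ (Fin 4) → EuclideanSpace ℝ (Fin 4))
    (p : EuclideanSpace ℝ (Fin 4) → ℝ)
    -- smoothness in the open half space minus the origin
    (hu : ContDiffOn ℝ (⊤ : ℕ∞) u {x : EuclideanSpace ℝ (Fin 4) | 0 < x 3 ∧ x ≠ 0})
    (hp : ContDiffOn ℝ (⊤ : ℕ∞) p {x : EuclideanSpace ℝ (Fin 4) | 0 < x 3 ∧ x ≠ 0})
    -- `u` extends continuously up to the boundary
    (hu0 : ContinuousOn u ({x : EuclideanSpace ℝ (Fin 4) | 0 ≤ x 3} \ {0}))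
    -- steady Navier-Stokes equations on Ω
    (hNS : ∀ x : EuclideanSpace ℝ (Fin 4), 0 < x 3 → x ≠ 0 → ∀ j : Fin 4,
      -(∑ i : Fin 4, fderiv ℝ (fun y => fderiv ℝ (fun z => u z j) y
            (EuclideanSpace.single i 1)) x (EuclideanSpace.single i 1)) +
        (∑ i : Fin 4, u x i * fderiv ℝ (fun z => u z j) x (EuclideanSpace.single i 1)) +
        fderiv ℝ p x (EuclideanSpace.single j 1) = 0)
    (hdiv : ∀ x : EuclideanSpace ℝ (Fin 4), 0 < x 3 → x ≠ 0 →
      ∑ i : Fin 4, fderiv ℝ (fun z => u z i) x (EuclideanSpace.single i 1) = 0)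
    -- Dirichlet boundary condition on ∂ℝ⁴₊ \ {0}
    (hDir : ∀ x : EuclideanSpace ℝ (Fin 4), x 3 = 0 → x ≠ 0 → u x = 0)
    (C : ℝ) (hC : 0 < C)
    (hbound : ∀ x : EuclideanSpace ℝ (Fin 4), 0 < x 3 → x ≠ 0 → ‖u x‖ ≤ C / ‖x‖) :
    ∀ x : EuclideanSpace ℝ (Fin 4), 0 < x 3 → x ≠ 0 → u x = 0 := by
  intro x hx _
  have hH : {x : EuclideanSpace ℝ (Fin 4) | 0 < x 3 ∧ x ≠ 0} = SteadyNS.H :=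
    Set.ext fun y => ⟨fun h => h.1, fun h => ⟨h, SteadyNS.ne_zero_of_mem_H h⟩⟩
  rw [hH] at hu hp
  have hs := SteadyNS.isSolution_of_convective hu hp hu0
    (fun y hy => hNS y hy (SteadyNS.ne_zero_of_mem_H hy))
    (fun y hy => hdiv y hy (SteadyNS.ne_zero_of_mem_H hy)) hDir
    (fun y hy => hbound y hy (SteadyNS.ne_zero_of_mem_H hy))
  ext j
  exact hs.eq_zero_of_mem_H j hx
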